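/- The centralizer algebra S_q(n;r,s) := {φ ∈ End_R(V^{⊗r}⊗(V*)^{⊗s}) : φ commutes with E and with all S_t (1 ≤ t ≤ r−1) and Ŝ_t (1 ≤ t ≤ s−1)} is a free R-module, and its rank equals the number of pairs of standard rational (ρ,σ)-tableaux with entries in {1,…,n}, where the pairs range over all k with 0 ≤ k ≤ min(r,s) and all ρ ∈ Λ+(r−k), σ ∈ Λ+(s−k). In particular this rank is independent of the ring R and of the invertible element q. -/

import Mathlib

open scoped BigOperators

/-- The iterated tensor product of `m` copies of `V = R^n` and its dual `V*`
(which of the two is used in each tensor position is recorded separately by a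
function `c : Fin m → Bool`, `true` meaning `V` and `false` meaning `V*`);
its basis is indexed by multi-indices. -/
abbrev Mx (R : Type*) [CommRing R] (n m : ℕ) := ((Fin m → Fin n) →₀ R)

/-- Kronecker delta with values in `ℤ`. -/
def deltaZ {n : ℕ} (a j : Fin n) : ℤ := if j = a then 1 else 0

/-- The action of `K_i^z e_i^{(k)}` on a single tensor factor (`b = true`: the
vector representation `V`; `b = false`: its dual `V*`, on which an element `x`
acts by `φ ↦ φ ∘ S(x)`).  Here `a` plays the role of the index `i` and `b'`
of `i+1`.  The value at the basis vector with index `j` is returned as an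
element of `Fin n →₀ R`. -/
noncomputable def singleE (R : Type*) [CommRing R] (q : Rˣ) (n : ℕ) (b : Bool)
    (a b' : Fin n) (z : ℤ) (k : ℕ) (j : Fin n) : Fin n →₀ R :=
  match b, k with
  | true, 0 => Finsupp.single j ((q ^ (z * (deltaZ a j - deltaZ b' j)) : Rˣ) : R)
  | true, 1 => if j = b' then Finsupp.single a ((q ^ z : Rˣ) : R) else 0
  | false, 0 => Finsupp.single j ((q ^ (z * (deltaZ b' j - deltaZ a j)) : Rˣ) : R)
  | false, 1 => if j = a then Finsupp.single b' ((-(q ^ (z - 1)) : Rˣ) : R) else 0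
  | _, _ + 2 => 0

/-- The action of `f_i^{(k)} K_i^z` on a single tensor factor; conventions as
in `singleE`. -/
noncomputable def singleF (R : Type*) [CommRing R] (q : Rˣ) (n : ℕ) (b : Bool)
    (a b' : Fin n) (z : ℤ) (k : ℕ) (j : Fin n) : Fin n →₀ R :=
  match b, k with
  | true, 0 => Finsupp.single j ((q ^ (z * (deltaZ a j - deltaZ b' j)) : Rˣ) : R)
  | true, 1 => if j = a then Finsupp.single b' ((q ^ z : Rˣ) : R) else 0
  | false, 0 => Finsupp.single j ((q ^ (z * (deltaZ b' j - deltaZ a j)) : Rˣ) : R)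
  | false, 1 => if j = b' then Finsupp.single a ((-(q ^ (z + 1)) : Rˣ) : R) else 0
  | _, _ + 2 => 0

/-- The operator `ρ(K_i^z e_i^{(k)})` on an `m`-fold tensor product of copies
of `V` and `V*` (described by `c`), obtained by iterating the comultiplication
`Δ(K_i^z e_i^{(k)}) = Σ_t q^{t(k−t)}·K_i^z e_i^{(k−t)} ⊗ K_i^{z+t−k} e_i^{(t)}`;
`a`, `b'` play the roles of `i`, `i+1`. -/
noncomputable def opE (R : Type*) [CommRing R] (q : Rˣ) (n : ℕ) (a b' : Fin n) :
    (m : ℕ) → (c : Fin m → Bool) → ℤ → ℕ → (Mx R n m →ₗ[R] Mx R n m)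
  | 0, _, _, k => if k = 0 then LinearMap.id else 0
  | (m + 1), c, z, k =>
    Finsupp.linearCombination R fun J : Fin (m + 1) → Fin n =>
      ∑ t ∈ Finset.range (k + 1),
        ((q ^ (t * (k - t)) : Rˣ) : R) •
          ((singleE R q n (c 0) a b' z (k - t) (J 0)).sum fun j' co =>
            co • Finsupp.mapDomain (Fin.cons j')
              (opE R q n a b' m (fun u => c u.succ) (z + (t : ℤ) - (k : ℤ)) t
                (Finsupp.single (Fin.tail J) 1)))

/-- The operator `ρ(f_i^{(k)} K_i^z)`, obtained by iterating
`Δ(f_i^{(k)} K_i^z) = Σ_t q^{−t(k−t)}·f_i^{(k−t)} K_i^{z+t} ⊗ f_i^{(t)} K_i^z`. -/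
noncomputable def opF (R : Type*) [CommRing R] (q : Rˣ) (n : ℕ) (a b' : Fin n) :
    (m : ℕ) → (c : Fin m → Bool) → ℤ → ℕ → (Mx R n m →ₗ[R] Mx R n m)
  | 0, _, _, k => if k = 0 then LinearMap.id else 0
  | (m + 1), c, z, k =>
    Finsupp.linearCombination R fun J : Fin (m + 1) → Fin n =>
      ∑ t ∈ Finset.range (k + 1),
        ((q ^ (-(t * (k - t) : ℤ)) : Rˣ) : R) •
          ((singleF R q n (c 0) a b' (z + (t : ℤ)) (k - t) (J 0)).sum fun j' co =>
            co • Finsupp.mapDomain (Fin.cons j')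
              (opF R q n a b' m (fun u => c u.succ) z t
                (Finsupp.single (Fin.tail J) 1)))

/-- The operator `ρ(q^h)` for `h = Σ h_i·(dual basis)` in the coweight lattice
`P∨` (identified with `Fin n → ℤ`): it acts diagonally, by `q^{ε_j(h)}` on a
`V`-factor with index `j` and by `q^{−ε_j(h)}` on a `V*`-factor. -/
noncomputable def opH (R : Type*) [CommRing R] (q : Rˣ) (n : ℕ)
    (m : ℕ) (c : Fin m → Bool) (h : Fin n → ℤ) : Mx R n m →ₗ[R] Mx R n m :=
  Finsupp.linearCombination R fun J : Fin m → Fin n =>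
    Finsupp.single J ((q ^ (∑ t, (if c t then (1 : ℤ) else -1) * h (J t)) : Rˣ) : R)

/-- The multi-index `j` with the entries in positions `p`, `p+1` swapped. -/
def swapIdx {n m : ℕ} (j : Fin m → Fin n) (p : ℕ) (hp : p + 1 < m) : Fin m → Fin n :=
  Function.update (Function.update j ⟨p, by omega⟩ (j ⟨p + 1, hp⟩)) ⟨p + 1, hp⟩ (j ⟨p, by omega⟩)

/-- The Hecke operator `S` acting on two adjacent `V`-factors in tensor
positions `p`, `p+1` (0-based). -/
noncomputable def heckeOpX (R : Type*) [CommRing R] (q : Rˣ) (n m : ℕ)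
    (p : ℕ) (hp : p + 1 < m) : Mx R n m →ₗ[R] Mx R n m :=
  Finsupp.linearCombination R fun j : Fin m → Fin n =>
    if j ⟨p, by omega⟩ = j ⟨p + 1, hp⟩ then
      ((q⁻¹ : Rˣ) : R) • Finsupp.single j 1
    else if j ⟨p, by omega⟩ < j ⟨p + 1, hp⟩ then
      Finsupp.single (swapIdx j p hp) 1
    else
      Finsupp.single (swapIdx j p hp) 1 + (((q⁻¹ : Rˣ) : R) - (q : R)) • Finsupp.single j 1

/-- The Hecke operator `Ŝ` acting on two adjacent `V*`-factors in tensor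
positions `p`, `p+1` (0-based). -/
noncomputable def heckeOpStar (R : Type*) [CommRing R] (q : Rˣ) (n m : ℕ)
    (p : ℕ) (hp : p + 1 < m) : Mx R n m →ₗ[R] Mx R n m :=
  Finsupp.linearCombination R fun j : Fin m → Fin n =>
    if j ⟨p, by omega⟩ = j ⟨p + 1, hp⟩ then
      ((q⁻¹ : Rˣ) : R) • Finsupp.single j 1
    else if j ⟨p + 1, hp⟩ < j ⟨p, by omega⟩ then
      Finsupp.single (swapIdx j p hp) 1
    else
      Finsupp.single (swapIdx j p hp) 1 + (((q⁻¹ : Rˣ) : R) - (q : R)) • Finsupp.single j 1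

/-- The contraction operator `E` of the walled Brauer algebra, acting on the
mixed tensor space `V^{⊗r} ⊗ (V*)^{⊗s}` at the tensor positions `r−1`, `r`
(0-based), i.e. at the last `V`-factor and the first `V*`-factor (it is `0`
by convention if `r = 0` or `s = 0`). -/
noncomputable def wallE (R : Type*) [CommRing R] (q : Rˣ) (n : ℕ) (r s : ℕ) :
    Mx R n (r + s) →ₗ[R] Mx R n (r + s) :=
  if h : 0 < r ∧ 0 < s then
    Finsupp.linearCombination R fun j : Fin (r + s) → Fin n =>
      if j ⟨r - 1, by omega⟩ = j ⟨r, by omega⟩ then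
        ((q ^ (2 * ((j ⟨r - 1, by omega⟩ : ℕ) : ℤ) + 2 - (n : ℤ) - 1) : Rˣ) : R) •
          ∑ u : Fin n,
            Finsupp.single
              (Function.update (Function.update j ⟨r - 1, by omega⟩ u) ⟨r, by omega⟩ u) 1
      else 0
  else 0

/-- The generating operators `E`, `S_t` (`1 ≤ t ≤ r−1`), `Ŝ_t` (`1 ≤ t ≤ s−1`)
of the action of the walled Brauer algebra `𝔅_{r,s}^n(q)` on the mixed tensor
space. -/
def wallSet (R : Type*) [CommRing R] (q : Rˣ) (n : ℕ) (r s : ℕ) :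
    Set (Module.End R (Mx R n (r + s))) :=
  {g | g = wallE R q n r s ∨
       (∃ (p : ℕ) (hp : p + 1 < r), g = heckeOpX R q n (r + s) p (by omega)) ∨
       (∃ (p : ℕ) (hp : p + 1 < s), g = heckeOpStar R q n (r + s) (r + p) (by omega))}

/-- The generators of the image of the quantized enveloping algebra `U`:
the operators `ρ(q^h)` (`h ∈ P∨`) together with the divided powers
`ρ(e_i^{(l)})`, `ρ(f_i^{(l)})` (`1 ≤ i ≤ n−1`, `l ≥ 1`). -/
def qgGens (R : Type*) [CommRing R] (q : Rˣ) (n m : ℕ) (c : Fin m → Bool) :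
    Set (Module.End R (Mx R n m)) :=
  {g | (∃ h : Fin n → ℤ, g = opH R q n m c h) ∨
       (∃ (i : Fin n) (hi : (i : ℕ) + 1 < n) (l : ℕ), 1 ≤ l ∧
          g = opE R q n i ⟨(i : ℕ) + 1, hi⟩ m c 0 l) ∨
       (∃ (i : Fin n) (hi : (i : ℕ) + 1 < n) (l : ℕ), 1 ≤ l ∧
          g = opF R q n i ⟨(i : ℕ) + 1, hi⟩ m c 0 l)}

/-- The generators of the image of the subalgebra `U'` (corresponding to
`sl_n`): the operators `ρ(K_i^{±1})` (`1 ≤ i ≤ n−1`) together with the divided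
powers `ρ(e_i^{(l)})`, `ρ(f_i^{(l)})` (`1 ≤ i ≤ n−1`, `l ≥ 1`). -/
def qgGensK (R : Type*) [CommRing R] (q : Rˣ) (n m : ℕ) (c : Fin m → Bool) :
    Set (Module.End R (Mx R n m)) :=
  {g | (∃ (i : Fin n) (hi : (i : ℕ) + 1 < n) (ε : ℤ), (ε = 1 ∨ ε = -1) ∧
          g = opH R q n m c (fun j => ε * (deltaZ i j - deltaZ ⟨(i : ℕ) + 1, hi⟩ j))) ∨
       (∃ (i : Fin n) (hi : (i : ℕ) + 1 < n) (l : ℕ), 1 ≤ l ∧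
          g = opE R q n i ⟨(i : ℕ) + 1, hi⟩ m c 0 l) ∨
       (∃ (i : Fin n) (hi : (i : ℕ) + 1 < n) (l : ℕ), 1 ≤ l ∧
          g = opF R q n i ⟨(i : ℕ) + 1, hi⟩ m c 0 l)}

/-- A partition of `m`: an antitone sequence of parts which vanishes from
index `m` on and has total sum `m`. -/
structure RPartition (m : ℕ) where
  part : ℕ → ℕ
  antitone' : ∀ ⦃i j : ℕ⦄, i ≤ j → part j ≤ part i
  vanish : ∀ i, m ≤ i → part i = 0
  sum_eq : ∑ i ∈ Finset.range m, part i = m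

/-- A tableau of shape `p` with entries in `{1,…,n}` (encoded as `Fin n`,
0-based); entries outside the shape are the junk value `0`. -/
structure Tab (n : ℕ) [NeZero n] (p : ℕ → ℕ) where
  entry : ℕ → ℕ → Fin n
  outside : ∀ i j, p i ≤ j → entry i j = 0

/-- A tableau is standard if its rows strictly increase from left to right and
its columns are nondecreasing downward. -/
def IsStdTab {n : ℕ} [NeZero n] {p : ℕ → ℕ} (T : Tab n p) : Prop :=
  (∀ i j1 j2, j1 < j2 → j2 < p i → T.entry i j1 < T.entry i j2) ∧
  (∀ i j, j < p (i + 1) → T.entry i j ≤ T.entry (i + 1) j)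

/-- The number of entries `≤ x` in the first row of a tableau. -/
def firstRowCount {n : ℕ} [NeZero n] {p : ℕ → ℕ} (T : Tab n p) (x : Fin n) : ℕ :=
  ((Finset.range (p 0)).filter fun j => T.entry 0 j ≤ x).card

/-- A rational tableau `(T1, T2)` is standard if both tableaux are standard
and for every `i = 1,…,n` the number of entries `≤ i` in the first row of `T1`
plus the number of entries `≤ i` in the first row of `T2` is at most `i`. -/
def IsStdRatPair {n : ℕ} [NeZero n] {p1 p2 : ℕ → ℕ} (T1 : Tab n p1) (T2 : Tab n p2) : Prop :=
  IsStdTab T1 ∧ IsStdTab T2 ∧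
    ∀ x : Fin n, firstRowCount T1 x + firstRowCount T2 x ≤ (x : ℕ) + 1

/-- A rational `(ρ,σ)`-bitableau: a pair of rational `(ρ,σ)`-tableaux
`(t1, t2)` and `(t1', t2')`, where `ρ ∈ Λ⁺(r−k)`, `σ ∈ Λ⁺(s−k)` for some
`0 ≤ k ≤ min(r,s)` and `ρ₁ + σ₁ ≤ n`. -/
structure RatBitab (n r s : ℕ) [NeZero n] where
  k : ℕ
  hk : k ≤ min r s
  ρ : RPartition (r - k)
  σ : RPartition (s - k)
  hrow : ρ.part 0 + σ.part 0 ≤ n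
  t1 : Tab n ρ.part
  t2 : Tab n σ.part
  t1' : Tab n ρ.part
  t2' : Tab n σ.part

/-- A rational bitableau is standard if both of its rational tableaux are. -/
def RatBitab.IsStd {n r s : ℕ} [NeZero n] (B : RatBitab n r s) : Prop :=
  IsStdRatPair B.t1 B.t2 ∧ IsStdRatPair B.t1' B.t2'

/-- The type of standard rational bitableaux. -/
abbrev StdRatBitab (n r s : ℕ) [NeZero n] := {B : RatBitab n r s // B.IsStd}

namespace RS
open Finset

section basics
variable {R : Type*} [CommRing R] {α β γ : Type*}

/-- standard basis vector -/
noncomputable def bs (a : α) : α →₀ R := Finsupp.single a 1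

/-- linear extension -/
noncomputable def lc {M : Type*} [AddCommMonoid M] [Module R M] (f : α → M) : (α →₀ R) →ₗ[R] M :=
  Finsupp.linearCombination R f

@[simp] lemma lc_bs {M : Type*} [AddCommMonoid M] [Module R M] (f : α → M) (a : α) :
    lc (R := R) f (bs a) = f a := by simp [lc, bs]

lemma ext_bs {M : Type*} [AddCommMonoid M] [Module R M] {f g : (α →₀ R) →ₗ[R] M}
    (h : ∀ a, f (bs a) = g (bs a)) : f = g := by
  apply Finsupp.lhom_ext'
  intro a
  ext
  exact h a

lemma ext_bs' {M : Type*} [AddCommMonoid M] [Module R M] {f g : (α →₀ R) →ₗ[R] M}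
    (h : ∀ a, f (bs a) = g (bs a)) (x : α →₀ R) : f x = g x := by rw [ext_bs h]

lemma bs_apply [DecidableEq α] (a b : α) : (bs a : α →₀ R) b = if a = b then 1 else 0 := by
  simp [bs, Finsupp.single_apply]

/-- dot product -/
noncomputable def dot : (α →₀ R) →ₗ[R] (α →₀ R) →ₗ[R] R :=
  lc (fun a => Finsupp.lapply a)

@[simp] lemma dot_bs (a : α) (y : α →₀ R) : dot (bs a) y = y a := by
  simp [dot]

lemma dot_comm (x y : α →₀ R) : dot x y = dot y x := by
  classical
  have : (dot : (α →₀ R) →ₗ[R] (α →₀ R) →ₗ[R] R) = dot.flip := by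
    apply ext_bs; intro a; apply ext_bs; intro b
    simp [bs_apply, eq_comm]
  conv_lhs => rw [this]
  rfl

@[simp] lemma dot_bs' (a : α) (y : α →₀ R) : dot y (bs a) = y a := by
  rw [dot_comm, dot_bs]

/-- adjointness for the dot products -/
def Adj (A : (α →₀ R) →ₗ[R] (β →₀ R)) (B : (β →₀ R) →ₗ[R] (α →₀ R)) : Prop :=
  ∀ x y, dot (A x) y = dot x (B y)

lemma Adj.of {A : (α →₀ R) →ₗ[R] (β →₀ R)} {B : (β →₀ R) →ₗ[R] (α →₀ R)}
    (h : ∀ a b, A (bs a) b = B (bs b) a) : Adj A B := by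
  have : dot ∘ₗ A = LinearMap.flip (dot.flip ∘ₗ B) := by
    apply ext_bs; intro a; apply ext_bs; intro b
    simp [h]
  intro x y
  exact LinearMap.congr_fun (LinearMap.congr_fun this x) y

lemma Adj.symm {A : (α →₀ R) →ₗ[R] (β →₀ R)} {B : (β →₀ R) →ₗ[R] (α →₀ R)}
    (h : Adj A B) : Adj B A := by
  intro x y
  rw [dot_comm, ← h, dot_comm]

lemma Adj.comp {A : (α →₀ R) →ₗ[R] (β →₀ R)} {B : (β →₀ R) →ₗ[R] (α →₀ R)}
    {A' : (β →₀ R) →ₗ[R] (γ →₀ R)} {B' : (γ →₀ R) →ₗ[R] (β →₀ R)}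
    (h : Adj A B) (h' : Adj A' B') : Adj (A' ∘ₗ A) (B ∘ₗ B') := by
  intro x y
  simp [h' _ _, h _ _]

lemma Adj.zero : Adj (0 : (α →₀ R) →ₗ[R] (β →₀ R)) 0 := by
  intro x y; simp

lemma Adj.id : Adj (LinearMap.id : (α →₀ R) →ₗ[R] (α →₀ R)) LinearMap.id := by
  intro x y; simp

lemma Adj.add {A A' : (α →₀ R) →ₗ[R] (β →₀ R)} {B B' : (β →₀ R) →ₗ[R] (α →₀ R)}
    (h : Adj A B) (h' : Adj A' B') : Adj (A + A') (B + B') := by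
  intro x y; simp [h x y, h' x y]

lemma Adj.smul {A : (α →₀ R) →ₗ[R] (β →₀ R)} {B : (β →₀ R) →ₗ[R] (α →₀ R)} (c : R)
    (h : Adj A B) : Adj (c • A) (c • B) := by
  intro x y; simp [h x y]

lemma Adj.sum {ι : Type*} (s : Finset ι) {A : ι → (α →₀ R) →ₗ[R] (β →₀ R)}
    {B : ι → (β →₀ R) →ₗ[R] (α →₀ R)}
    (h : ∀ i ∈ s, Adj (A i) (B i)) : Adj (∑ i ∈ s, A i) (∑ i ∈ s, B i) := by
  intro x y
  simp only [LinearMap.sum_apply, map_sum]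
  exact Finset.sum_congr rfl fun i hi => h i hi x y

end basics

/-- words -/
abbrev W (n : ℕ) := List (Fin n)
/-- row lists -/
abbrev RL (n : ℕ) := List (Finset (Fin n))

section words
variable {R : Type*} [CommRing R] (θ : Rˣ) {n : ℕ}

/-- the free module on words -/
abbrev FW (R : Type*) [CommRing R] (n : ℕ) := W n →₀ R

/-- prepend a letter -/
noncomputable def cs (b : Fin n) : Module.End R (FW R n) := lc fun u => bs (b :: u)

/-- remove the first letter -/
noncomputable def un (b : Fin n) : Module.End R (FW R n) := lc fun u =>
  match u with
  | [] => 0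
  | c :: u => if c = b then bs u else 0

@[simp] lemma cs_bs (b : Fin n) (u : W n) : cs (R := R) b (bs u) = bs (b :: u) := by simp [cs]
@[simp] lemma un_bs_nil (b : Fin n) : un (R := R) b (bs []) = 0 := by simp [un]
@[simp] lemma un_bs_cons (b c : Fin n) (u : W n) :
    un (R := R) b (bs (c :: u)) = if c = b then bs u else 0 := by simp [un]

lemma un_cs (b c : Fin n) (x : FW R n) : un b (cs c x) = if c = b then x else 0 := by
  have : (un b ∘ₗ cs c : FW R n →ₗ[R] FW R n) = if c = b then LinearMap.id else 0 := by
    apply ext_bs; intro u; split_ifs <;> simp [*]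
  have := LinearMap.congr_fun this x
  simp only [LinearMap.comp_apply] at this
  rw [this]; split_ifs <;> simp

lemma adj_cs (b : Fin n) : Adj (cs (R := R) b) (un b) := by
  apply Adj.of
  intro a c
  cases c with
  | nil => simp [bs_apply]
  | cons d c =>
    simp only [cs_bs, un_bs_cons, bs_apply, List.cons.injEq]
    by_cases h : d = b
    · simp [h, bs_apply, eq_comm]
    · simp [h, eq_comm]
      intro h'; exact absurd h'.symm h

/-- act on the tail of a word -/
noncomputable def shift (A : Module.End R (FW R n)) : Module.End R (FW R n) :=
  ∑ b, cs b * A * un b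

@[simp] lemma shift_bs_nil (A : Module.End R (FW R n)) : shift A (bs []) = 0 := by
  simp [shift]
@[simp] lemma shift_bs_cons (A : Module.End R (FW R n)) (b : Fin n) (u : W n) :
    shift A (bs (b :: u)) = cs b (A (bs u)) := by
  simp [shift, apply_ite, Finset.sum_ite_eq]

lemma shift_cs (A : Module.End R (FW R n)) (b : Fin n) (x : FW R n) :
    shift A (cs b x) = cs b (A x) := by
  simp [shift, un_cs, apply_ite, Finset.sum_ite_eq]

lemma un_shift (A : Module.End R (FW R n)) (b : Fin n) (x : FW R n) :
    un b (shift A x) = A (un b x) := by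
  simp [shift, un_cs]

lemma shift_mul (A B : Module.End R (FW R n)) : shift (A * B) = shift A * shift B := by
  apply ext_bs; intro u
  cases u with
  | nil => simp
  | cons b u => simp [shift_cs]

lemma shift_add (A B : Module.End R (FW R n)) : shift (A + B) = shift A + shift B := by
  simp [shift, mul_add, add_mul, Finset.sum_add_distrib]

lemma shift_smul (c : R) (A : Module.End R (FW R n)) : shift (c • A) = c • shift A := by
  simp [shift, Finset.smul_sum]

lemma Adj.shift {A B : Module.End R (FW R n)} (h : Adj A B) : Adj (shift A) (shift B) := by
  apply Adj.sum
  intro b _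
  intro x y
  exact Adj.comp (adj_cs b).symm (Adj.comp h (adj_cs b)) x y

/-- projection to words of length `k` -/
noncomputable def pr (k : ℕ) : Module.End R (FW R n) := lc fun u => if u.length = k then bs u else 0

@[simp] lemma pr_bs (k : ℕ) (u : W n) :
    pr (R := R) k (bs u) = if u.length = k then bs u else 0 := by simp [pr]

lemma shift_pr (k : ℕ) : shift (pr (R := R) (n := n) k) = pr (k + 1) := by
  apply ext_bs; intro u
  cases u with
  | nil => simp
  | cons b u =>
    by_cases h : u.length = k <;> simp [h]

lemma shift_one : shift (1 : Module.End R (FW R n)) = 1 - pr 0 := by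
  apply ext_bs; intro u
  cases u with
  | nil => simp
  | cons b u => simp

lemma adj_pr (k : ℕ) : Adj (pr (R := R) (n := n) k) (pr k) := by
  apply Adj.of
  intro a b
  simp only [pr_bs]
  split_ifs with h1 h2 h2 <;> simp [bs_apply, eq_comm]
  · intro h; subst h; contradiction
  · intro h; subst h; contradiction

/-- basic Hecke generator on the first two letters -/
noncomputable def S0 : Module.End R (FW R n) := lc fun u =>
  match u with
  | a :: b :: u => if a = b then (-((θ⁻¹ : Rˣ) : R)) • bs (a :: b :: u)
      else if b < a then bs (b :: a :: u)
      else bs (b :: a :: u) + ((θ : R) - ((θ⁻¹ : Rˣ) : R)) • bs (a :: b :: u)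
  | _ => 0

@[simp] lemma S0_nil : S0 θ (bs ([] : W n)) = 0 := by simp [S0]
@[simp] lemma S0_one (a : Fin n) : S0 θ (bs [a]) = 0 := by simp [S0]
lemma S0_cons (a b : Fin n) (u : W n) : S0 θ (bs (a :: b :: u)) =
    if a = b then (-((θ⁻¹ : Rˣ) : R)) • bs (a :: b :: u)
      else if b < a then bs (b :: a :: u)
      else bs (b :: a :: u) + ((θ : R) - ((θ⁻¹ : Rˣ) : R)) • bs (a :: b :: u) := by
  simp [S0]

/-- Hecke generators -/
noncomputable def SS : ℕ → Module.End R (FW R n)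
  | 0 => S0 θ
  | t + 1 => shift (SS t)

lemma adj_S0 : Adj (S0 (n := n) θ) (S0 θ) := by
  apply Adj.of
  intro u v
  match u, v with
  | [], [] => simp
  | [], [a] => simp
  | [a], [] => simp
  | [a], [b] => simp
  | [], a :: b :: v => rw [S0_cons]; split_ifs <;> simp [bs_apply]
  | [c], a :: b :: v => rw [S0_cons]; split_ifs <;> simp [bs_apply]
  | a :: b :: v, [] => rw [S0_cons]; split_ifs <;> simp [bs_apply]
  | a :: b :: v, [c] => rw [S0_cons]; split_ifs <;> simp [bs_apply]
  | a :: b :: u, c :: d :: v =>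
    rw [S0_cons, S0_cons]
    split_ifs <;> simp [bs_apply] <;> grind

lemma adj_SS (t : ℕ) : Adj (SS (n := n) θ t) (SS θ t) := by
  induction t with
  | zero => exact adj_S0 θ
  | succ t ih => exact ih.shift

/-- the Hecke algebra of words -/
noncomputable def HH : Subalgebra R (Module.End R (FW R n)) :=
  Algebra.adjoin R (Set.range (SS θ) ∪ Set.range pr)

lemma SS_mem (t : ℕ) : SS (n := n) θ t ∈ HH θ :=
  Algebra.subset_adjoin (Or.inl ⟨t, rfl⟩)
lemma pr_mem (t : ℕ) : pr (R := R) (n := n) t ∈ HH θ :=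
  Algebra.subset_adjoin (Or.inr ⟨t, rfl⟩)

lemma shift_mem {A : Module.End R (FW R n)} (h : A ∈ HH θ) : shift A ∈ HH θ := by
  induction h using Algebra.adjoin_induction with
  | mem x hx =>
    rcases hx with ⟨t, rfl⟩ | ⟨t, rfl⟩
    · exact SS_mem θ (t + 1)
    · rw [shift_pr]; exact pr_mem θ _
  | algebraMap r =>
    rw [Algebra.algebraMap_eq_smul_one, shift_smul, shift_one]
    have h : (1 - pr 0 : Module.End R (FW R n)) = 1 + (-1 : R) • pr 0 := by
      apply LinearMap.ext; intro x; simp [sub_eq_add_neg]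
    rw [h]
    exact Subalgebra.smul_mem (HH θ) (add_mem (one_mem (HH θ))
      (Subalgebra.smul_mem (HH θ) (pr_mem θ _) _)) _
  | add x y _ _ hx hy => rw [shift_add]; exact Subalgebra.add_mem _ hx hy
  | mul x y _ _ hx hy => rw [shift_mul]; exact Subalgebra.mul_mem _ hx hy

/-- coset sums -/
noncomputable def cc : ℕ → Module.End R (FW R n)
  | 0 => 1
  | a + 1 => 1 + (θ : R) • (S0 θ * shift (cc a))

lemma cc_mem (a : ℕ) : cc (n := n) θ a ∈ HH θ := by
  induction a with
  | zero => exact Subalgebra.one_mem _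
  | succ a ih =>
    exact Subalgebra.add_mem _ (Subalgebra.one_mem _) (Subalgebra.smul_mem _
      (Subalgebra.mul_mem _ (SS_mem θ 0) (shift_mem θ ih)) _)

lemma un_S0_ne {b e : Fin n} (h : b ≠ e) (m : FW R n) :
    un b (S0 θ (cs e m)) = cs e (un b m) := by
  have : (un b ∘ₗ S0 θ ∘ₗ cs e : FW R n →ₗ[R] FW R n) = cs e ∘ₗ un b := by
    apply ext_bs; intro u
    cases u with
    | nil => simp
    | cons d w =>
      simp only [LinearMap.comp_apply, cs_bs, S0_cons, un_bs_cons]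
      split_ifs <;> simp <;> grind
  exact LinearMap.congr_fun this m

lemma un_S0_eq (e : Fin n) (m : FW R n) :
    un e (S0 θ (cs e m)) = (-((θ⁻¹ : Rˣ) : R)) • cs e (un e m) +
      ((θ : R) - ((θ⁻¹ : Rˣ) : R)) • ∑ y ∈ univ.filter (e < ·), cs y (un y m) := by
  have : (un e ∘ₗ S0 θ ∘ₗ cs e : FW R n →ₗ[R] FW R n) = (-((θ⁻¹ : Rˣ) : R)) • cs e ∘ₗ un e +
      ((θ : R) - ((θ⁻¹ : Rˣ) : R)) • ∑ y ∈ univ.filter (e < ·), cs y ∘ₗ un y := by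
    apply ext_bs; intro u
    cases u with
    | nil => simp
    | cons d w =>
      have h0 : ∀ y : Fin n, cs y (if d = y then bs w else 0) =
          if d = y then (cs d (bs w) : FW R n) else 0 := by
        intro y; split_ifs with h
        · rw [h]
        · simp
      simp only [LinearMap.comp_apply, cs_bs, S0_cons, LinearMap.add_apply, LinearMap.smul_apply,
        LinearMap.sum_apply, un_bs_cons, h0, Finset.sum_ite_eq, mem_filter,
        mem_univ, true_and]
      rcases lt_trichotomy e d with h | h | h
      · simp [h.ne, h.ne', h, not_lt_of_gt h]
      · subst h; simp
      · simp [h.ne, h.ne', h, not_lt_of_gt h]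
  have := LinearMap.congr_fun this m
  simpa using this

end words
end RS

namespace RS
open Finset

section rows
variable {R : Type*} [CommRing R] (θ : Rˣ) {n : ℕ} {β γ : Type*}

/-- number of elements of `X` above `b` -/
def up (X : Finset (Fin n)) (b : Fin n) : ℕ := (X.filter (b < ·)).card

/-- number of pairs `p < q'` -/
def inv (X Y : Finset (Fin n)) : ℕ := ∑ p ∈ X, up Y p

lemma up_insert_self (X : Finset (Fin n)) (b : Fin n) : up (insert b X) b = up X b := by
  simp [up, Finset.filter_insert]

lemma up_erase_self (X : Finset (Fin n)) (b : Fin n) : up (X.erase b) b = up X b := by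
  simp [up, Finset.filter_erase]

lemma up_insert {X : Finset (Fin n)} {e : Fin n} (he : e ∉ X) (b : Fin n) :
    up (insert e X) b = up X b + if b < e then 1 else 0 := by
  unfold up; rw [Finset.filter_insert]; split_ifs
  · rw [card_insert_of_notMem]; simp [he]
  · simp

lemma up_erase {X : Finset (Fin n)} {e : Fin n} (he : e ∈ X) (b : Fin n) :
    up X b = up (X.erase e) b + if b < e then 1 else 0 := by
  rw [← up_insert (notMem_erase e X), insert_erase he]

lemma up_union {X Y : Finset (Fin n)} (h : Disjoint X Y) (b : Fin n) :
    up (X ∪ Y) b = up X b + up Y b := by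
  unfold up; rw [filter_union, card_union_of_disjoint]
  exact disjoint_filter_filter h

/-- exterior multiplication in the first row -/
noncomputable def wedge (b : Fin n) : (Finset (Fin n) × β →₀ R) →ₗ[R] (Finset (Fin n) × β →₀ R) :=
  lc fun p => if b ∈ p.1 then 0 else ((θ : R) ^ up p.1 b) • bs (insert b p.1, p.2)

/-- exterior contraction in the first row -/
noncomputable def dd (b : Fin n) : (Finset (Fin n) × β →₀ R) →ₗ[R] (Finset (Fin n) × β →₀ R) :=
  lc fun p => if b ∈ p.1 then ((θ : R) ^ up p.1 b) • bs (p.1.erase b, p.2) else 0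

lemma wedge_bs (b : Fin n) (X : Finset (Fin n)) (L : β) : wedge θ b (bs (X, L)) =
    if b ∈ X then 0 else ((θ : R) ^ up X b) • bs (insert b X, L) := by simp [wedge]
lemma dd_bs (b : Fin n) (X : Finset (Fin n)) (L : β) : dd θ b (bs (X, L)) =
    if b ∈ X then ((θ : R) ^ up X b) • bs (X.erase b, L) else 0 := by simp [dd]

lemma adj_wedge (b : Fin n) : Adj (wedge (β := β) θ b) (dd θ b) := by
  classical
  apply Adj.of
  rintro ⟨X, L⟩ ⟨Y, M⟩
  rw [wedge_bs, dd_bs]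
  by_cases h : b ∈ X <;> by_cases h' : b ∈ Y
  · simp only [h, h', if_true, Finsupp.smul_apply, bs_apply, Finsupp.zero_apply]
    rw [if_neg]; · simp
    intro e; have := congrArg Prod.fst e; simp only at this
    rw [← this] at h; simp at h
  · simp [h, h']
  · simp only [h, h', if_true, if_false, Finsupp.smul_apply, bs_apply]
    by_cases e : insert b X = Y
    · subst e; simp [up_insert_self, h, eq_comm]
    · rw [if_neg, if_neg]
      · simp
      · intro e'; apply e; have := congrArg Prod.fst e'; simp only at this
        rw [← this, insert_erase h']
      · intro e'; exact e (congrArg Prod.fst e')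
  · simp only [h, h', if_false, Finsupp.smul_apply, bs_apply, Finsupp.zero_apply]
    rw [if_neg]; · simp
    intro e; have := congrArg Prod.fst e; simp only at this
    rw [← this] at h'; simp at h'

lemma geo (X : Finset (Fin n)) (t : R) :
    1 + (t - 1) * ∑ y ∈ X, t ^ up X y = t ^ X.card := by
  induction X using Finset.induction_on_min with
  | empty => simp
  | insert a s ha ih =>
    have ha' : a ∉ s := fun h => lt_irrefl _ (ha a h)
    rw [sum_insert ha', up_insert_self, card_insert_of_notMem ha']
    have h1 : ∑ y ∈ s, t ^ up (insert a s) y = ∑ y ∈ s, t ^ up s y := by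
      apply sum_congr rfl; intro y hy
      rw [up_insert ha', if_neg (not_lt_of_gt (ha y hy))]; simp
    have h2 : up s a = s.card := by
      unfold up; rw [filter_true_of_mem ha]
    rw [h1, h2, pow_succ]
    linear_combination ih

lemma geo' (X : Finset (Fin n)) (t : R) (x : Fin n) :
    1 + (t - 1) * ∑ y ∈ X.filter (x < ·), t ^ up X y = t ^ up X x := by
  have := geo (X.filter (x < ·)) t
  rw [show (X.filter (x < ·)).card = up X x from rfl] at this
  rw [← this]
  congr 2
  apply sum_congr rfl; intro y hy
  congr 1; unfold up; congr 1; ext z; simp at *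
  intro h1 _; exact hy.2.trans h1

lemma wedge_dd_ne {b e : Fin n} (h : b ≠ e) (M : Finset (Fin n) × β →₀ R) :
    (θ : R) • wedge θ e (dd θ b M) = dd θ b (wedge θ e M) := by
  have : (θ : R) • wedge (β := β) θ e ∘ₗ dd θ b = dd θ b ∘ₗ wedge θ e := by
    apply ext_bs; rintro ⟨X, L⟩
    simp only [LinearMap.smul_apply, LinearMap.comp_apply, dd_bs, wedge_bs]
    by_cases hb : b ∈ X <;> by_cases he : e ∈ X
    · simp [hb, he, wedge_bs, h.symm]
    · simp only [hb, he, if_true, if_false, map_smul, wedge_bs, dd_bs, mem_erase, mem_insert,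
        or_true, and_false, smul_smul, h.symm]
      rw [erase_insert_of_ne h.symm]
      congr 1
      rw [up_insert he, up_erase hb e]
      rcases lt_or_gt_of_ne h with h' | h'
      · rw [if_pos h', if_neg (not_lt_of_gt h')]; ring
      · rw [if_pos h', if_neg (not_lt_of_gt h')]; ring
    · simp [hb, he]
    · simp [hb, he, dd_bs, h]
  exact LinearMap.congr_fun this M

lemma wedge_dd_eq (y : Fin n) (X : Finset (Fin n)) (L : β) :
    wedge θ y (dd θ y (bs (X, L))) = if y ∈ X then ((θ : R) ^ 2) ^ up X y • bs (X, L) else 0 := by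
  rw [dd_bs]; split_ifs with h
  · rw [map_smul, wedge_bs]; simp only [notMem_erase, if_false, insert_erase h, smul_smul]
    rw [up_erase_self, ← pow_add, ← pow_mul]; congr 2; ring
  · simp

lemma wedge_dd_self (x : Fin n) (M : Finset (Fin n) × β →₀ R) :
    M + (θ : R) • ((-((θ⁻¹ : Rˣ) : R)) • wedge θ x (dd θ x M) +
      ((θ : R) - ((θ⁻¹ : Rˣ) : R)) • ∑ y ∈ univ.filter (x < ·), wedge θ y (dd θ y M))
      = dd θ x (wedge θ x M) := by
  have : LinearMap.id + (θ : R) • ((-((θ⁻¹ : Rˣ) : R)) • wedge (β := β) θ x ∘ₗ dd θ x +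
      ((θ : R) - ((θ⁻¹ : Rˣ) : R)) • ∑ y ∈ univ.filter (x < ·), wedge θ y ∘ₗ dd θ y)
      = dd θ x ∘ₗ wedge θ x := by
    apply ext_bs; rintro ⟨X, L⟩
    simp only [LinearMap.smul_apply, LinearMap.comp_apply, LinearMap.add_apply,
      LinearMap.sum_apply, LinearMap.id_apply, wedge_dd_eq]
    have h1 : ∑ y ∈ univ.filter (x < ·), (if y ∈ X then ((θ : R) ^ 2) ^ up X y • (bs (X, L) : Finset (Fin n) × β →₀ R) else 0)
        = (∑ y ∈ X.filter (x < ·), ((θ : R) ^ 2) ^ up X y) • bs (X, L) := by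
      rw [sum_smul, ← sum_filter]
      apply sum_congr _ (fun _ _ => rfl)
      ext z; simp [and_comm]
    rw [h1]
    have g := geo' X ((θ : R) ^ 2) x
    have ht : (θ : R) * ((θ⁻¹ : Rˣ) : R) = 1 := by simp
    by_cases hx : x ∈ X
    · simp only [hx, if_true, wedge_bs, map_zero, smul_smul, smul_add]
      rw [← one_smul R (bs (X, L) : Finset (Fin n) × β →₀ R)]
      simp only [smul_smul, ← add_smul]
      convert zero_smul R _ using 2
      linear_combination g + (-(((θ : R) ^ 2) ^ up X x) - (∑ y ∈ X.filter (x < ·), ((θ : R) ^ 2) ^ up X y)) * ht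
    · simp only [hx, if_false, wedge_bs, map_smul, dd_bs, mem_insert_self, if_true, smul_zero,
        zero_add, smul_smul, up_insert_self, erase_insert hx]
      conv_lhs => rw [← one_smul R (bs (X, L) : Finset (Fin n) × β →₀ R)]
      simp only [smul_smul, ← add_smul]
      congr 1
      rw [← pow_add, ← two_mul, pow_mul]
      linear_combination g + (- (∑ y ∈ X.filter (x < ·), ((θ : R) ^ 2) ^ up X y)) * ht
  have := LinearMap.congr_fun this M
  simpa using this

/-- add an empty row -/
noncomputable def ce : (β →₀ R) →ₗ[R] (Finset (Fin n) × β →₀ R) := lc fun b => bs (∅, b)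
/-- remove an empty row -/
noncomputable def ce' : (Finset (Fin n) × β →₀ R) →ₗ[R] (β →₀ R) :=
  lc fun p => if p.1 = ∅ then bs p.2 else 0
@[simp] lemma ce_bs (b : β) : ce (R := R) (n := n) (bs b) = bs (∅, b) := by simp [ce]
@[simp] lemma ce'_bs (X : Finset (Fin n)) (b : β) : ce' (R := R) (bs (X, b)) = if X = ∅ then bs b else 0 := by
  simp [ce']

lemma adj_ce : Adj (ce (R := R) (n := n) (β := β)) ce' := by
  classical
  apply Adj.of; rintro b ⟨X, c⟩
  by_cases h : X = ∅ <;> simp [bs_apply, h, eq_comm]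

/-- row projection -/
noncomputable def Pr (Q : FW R n →ₗ[R] (β →₀ R)) : ℕ → (FW R n →ₗ[R] (Finset (Fin n) × β →₀ R))
  | 0 => ce ∘ₗ Q
  | a + 1 => ∑ b, wedge θ b ∘ₗ Pr Q a ∘ₗ un b

/-- row injection -/
noncomputable def JJ (G : (β →₀ R) →ₗ[R] FW R n) : ℕ → ((Finset (Fin n) × β →₀ R) →ₗ[R] FW R n)
  | 0 => G ∘ₗ ce'
  | a + 1 => ∑ b, cs b ∘ₗ JJ G a ∘ₗ dd θ b

lemma adj_Pr {Q : FW R n →ₗ[R] (β →₀ R)} {G : (β →₀ R) →ₗ[R] FW R n} (h : Adj Q G) (a : ℕ) :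
    Adj (Pr θ Q a) (JJ θ G a) := by
  induction a with
  | zero => exact h.comp adj_ce
  | succ a ih =>
    apply Adj.sum; intro b _ x y
    have h1 := adj_wedge θ b (Pr θ Q a (un b x)) y
    have h2 := ih (un b x) (dd θ b y)
    have h3 := (adj_cs b).symm x (JJ θ G a (dd θ b y))
    exact h1.trans (h2.trans h3)

lemma Pr_cs (Q : FW R n →ₗ[R] (β →₀ R)) (a : ℕ) (b : Fin n) (x : FW R n) :
    Pr θ Q (a + 1) (cs b x) = wedge θ b (Pr θ Q a x) := by
  simp [Pr, un_cs, apply_ite, Finset.sum_ite_eq]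

lemma Pr_succ_nil (Q : FW R n →ₗ[R] (β →₀ R)) (a : ℕ) : Pr θ Q (a + 1) (bs []) = 0 := by
  simp [Pr]

lemma K1 (Q : FW R n →ₗ[R] (β →₀ R)) (a : ℕ) (b : Fin n) (x : FW R n) :
    Pr θ Q a (un b (cc θ a x)) = dd θ b (Pr θ Q (a + 1) x) := by
  induction a generalizing b x with
  | zero =>
    apply ext_bs' (f := Pr θ Q 0 ∘ₗ un b ∘ₗ cc θ 0) (g := dd θ b ∘ₗ Pr θ Q 1)
    intro u
    cases u with
    | nil => simp [cc, Pr_succ_nil]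
    | cons c u =>
      simp only [LinearMap.comp_apply, cc, Module.End.one_apply, un_bs_cons]
      rw [← cs_bs, Pr_cs]
      have : dd θ b ∘ₗ wedge θ c ∘ₗ ce (R := R) (β := β) = if c = b then ce else 0 := by
        apply ext_bs; intro d
        by_cases h : c = b
        · subst h; simp [wedge_bs, dd_bs, up, Finset.filter_singleton]
        · simp [wedge_bs, dd_bs, up, h]; exact fun e => absurd e.symm h
      have := LinearMap.congr_fun this (Q (bs u))
      simp only [LinearMap.comp_apply] at this
      simp only [Pr, LinearMap.comp_apply, this]
      split_ifs <;> simp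
  | succ a ih =>
    apply ext_bs' (f := Pr θ Q (a + 1) ∘ₗ un b ∘ₗ cc θ (a + 1)) (g := dd θ b ∘ₗ Pr θ Q (a + 2))
    intro u
    cases u with
    | nil => simp [cc, Pr_succ_nil]
    | cons e u =>
      simp only [LinearMap.comp_apply, cc, Module.End.one_apply, LinearMap.add_apply,
        LinearMap.smul_apply, Module.End.mul_apply, shift_bs_cons]
      simp only [← cs_bs, Pr_cs, map_add, map_smul, un_cs]
      by_cases h : b = e
      · subst h
        rw [un_S0_eq]
        simp only [map_add, map_smul, map_sum, Pr_cs, ih, if_true]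
        exact wedge_dd_self θ b _
      · rw [un_S0_ne θ h, if_neg (Ne.symm h), Pr_cs, ih, map_zero, zero_add]
        exact wedge_dd_ne θ h _

lemma JJ_Pr (Q : FW R n →ₗ[R] (β →₀ R)) (G : (β →₀ R) →ₗ[R] FW R n) (a : ℕ) :
    (JJ θ G (a + 1) ∘ₗ Pr θ Q (a + 1) : Module.End R (FW R n)) =
      shift (JJ θ G a ∘ₗ Pr θ Q a) * cc θ a := by
  apply LinearMap.ext; intro x
  simp only [JJ, shift, LinearMap.comp_apply, LinearMap.sum_apply, Module.End.mul_apply, ← K1]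

/-- functoriality in the second component -/
noncomputable def lft (g : (β →₀ R) →ₗ[R] (γ →₀ R)) :
    (Finset (Fin n) × β →₀ R) →ₗ[R] (Finset (Fin n) × γ →₀ R) :=
  lc fun p => (lc fun c => bs (p.1, c)) (g (bs p.2))

lemma lft_bs (g : (β →₀ R) →ₗ[R] (γ →₀ R)) (X : Finset (Fin n)) (b : β) :
    lft g (bs (X, b)) = (lc fun c => bs (X, c)) (g (bs b)) := by simp [lft]

lemma lft_lc (g : (β →₀ R) →ₗ[R] (γ →₀ R)) (X : Finset (Fin n)) (x : β →₀ R) :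
    lft g ((lc fun c => bs (X, c)) x) = (lc fun c => bs (X, c)) (g x) := by
  apply ext_bs' (f := lft g ∘ₗ (lc fun c => bs (X, c))) (g := (lc fun c => bs (X, c)) ∘ₗ g)
  intro b; simp [lft_bs]

lemma lft_wedge (g : (β →₀ R) →ₗ[R] (γ →₀ R)) (b : Fin n) :
    lft g ∘ₗ wedge θ b = wedge θ b ∘ₗ lft g := by
  apply ext_bs; rintro ⟨X, c⟩
  have h : ∀ y, wedge θ b ((lc fun d => bs (X, d)) y) = if b ∈ X then 0 else
      ((θ : R) ^ up X b) • (lc fun d => bs (insert b X, d)) (y : γ →₀ R) := by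
    intro y
    apply ext_bs' (f := wedge θ b ∘ₗ (lc fun d => bs (X, d))) (g := if b ∈ X then 0 else
      ((θ : R) ^ up X b) • (lc fun d => bs (insert b X, d))) _ y |>.trans
    · split_ifs <;> simp
    · intro d; simp [wedge_bs]; split_ifs <;> simp
  simp only [LinearMap.comp_apply, wedge_bs, lft_bs, h]
  split_ifs <;> simp [lft_bs]

lemma lft_ce (g : (β →₀ R) →ₗ[R] (γ →₀ R)) : lft g ∘ₗ ce (n := n) = ce ∘ₗ g := by
  apply ext_bs; intro c
  simp only [LinearMap.comp_apply, ce_bs, lft_bs]; rfl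

lemma lft_Pr (g : (β →₀ R) →ₗ[R] (γ →₀ R)) (Q : FW R n →ₗ[R] (β →₀ R)) (a : ℕ) :
    lft g ∘ₗ Pr θ Q a = Pr θ (g ∘ₗ Q) a := by
  induction a with
  | zero => rw [Pr, Pr, ← LinearMap.comp_assoc, lft_ce, LinearMap.comp_assoc]
  | succ a ih =>
    apply LinearMap.ext; intro x
    simp only [Pr, ← ih, LinearMap.comp_apply, LinearMap.sum_apply, map_sum]
    apply sum_congr rfl; intro b _
    exact LinearMap.congr_fun (lft_wedge θ g b) _

/-- merging of two rows -/
noncomputable def mu : (Finset (Fin n) × (Finset (Fin n) × β) →₀ R) →ₗ[R] (Finset (Fin n) × β →₀ R) :=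
  lc fun p => if Disjoint p.1 p.2.1 then ((θ : R) ^ inv p.1 p.2.1) • bs (p.1 ∪ p.2.1, p.2.2) else 0

lemma mu_bs (T B : Finset (Fin n)) (c : β) : mu θ (bs (T, (B, c))) =
    if Disjoint T B then ((θ : R) ^ inv T B) • bs (T ∪ B, c) else 0 := by simp [mu]

lemma mu_wedge (b : Fin n) : mu θ ∘ₗ wedge (β := Finset (Fin n) × β) θ b = wedge θ b ∘ₗ mu θ := by
  apply ext_bs; rintro ⟨T, B, c⟩
  simp only [LinearMap.comp_apply, wedge_bs, mu_bs]
  by_cases hT : b ∈ T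
  · simp only [hT, if_true, map_zero]; split_ifs <;> simp [wedge_bs, hT]
  by_cases hB : b ∈ B
  · simp only [hT, if_false, map_smul, mu_bs]
    rw [if_neg]
    · split_ifs <;> simp [wedge_bs, hB]
    · rw [disjoint_insert_left]; simp [hB]
  by_cases hd : Disjoint T B
  · simp only [hT, hd, if_true, if_false, map_smul, mu_bs, wedge_bs, disjoint_insert_left, hB,
      not_false_eq_true, and_self, mem_union, or_self, smul_smul, insert_union]
    congr 1
    rw [← pow_add, ← pow_add, up_union hd]
    congr 1
    simp only [inv]; rw [sum_insert hT]; ring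
  · simp only [hT, hd, if_false, map_smul, mu_bs, disjoint_insert_left, and_false, map_zero,
      smul_zero]

lemma mu_Pr (Q : FW R n →ₗ[R] (β →₀ R)) (a b : ℕ) :
    Pr θ Q (a + b) = mu θ ∘ₗ Pr θ (Pr θ Q b) a := by
  induction a with
  | zero =>
    have : mu θ ∘ₗ ce (n := n) (β := Finset (Fin n) × β) = LinearMap.id := by
      apply ext_bs; rintro ⟨B, c⟩; simp [mu_bs, inv]
    simp [Pr, ← LinearMap.comp_assoc, this]
  | succ a ih =>
    rw [Nat.add_right_comm]
    apply LinearMap.ext; intro x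
    simp only [Pr, ih, LinearMap.comp_apply, LinearMap.sum_apply, map_sum]
    apply sum_congr rfl; intro b _
    exact (LinearMap.congr_fun (mu_wedge θ b) _).symm

end rows
end RS

namespace RS
open Finset

section lists
variable {R : Type*} [CommRing R] (θ : Rˣ) {n : ℕ}

/-- cons a row -/
noncomputable def consM : (Finset (Fin n) × RL n →₀ R) →ₗ[R] (RL n →₀ R) := lc fun p => bs (p.1 :: p.2)
/-- uncons a row -/
noncomputable def unconsM : (RL n →₀ R) →ₗ[R] (Finset (Fin n) × RL n →₀ R) := lc fun L =>
  match L with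
  | [] => 0
  | X :: L => bs (X, L)

@[simp] lemma consM_bs (X : Finset (Fin n)) (L : RL n) : consM (R := R) (bs (X, L)) = bs (X :: L) := by
  simp [consM]
@[simp] lemma unconsM_nil : unconsM (R := R) (bs ([] : RL n)) = 0 := by simp [unconsM]
@[simp] lemma unconsM_cons (X : Finset (Fin n)) (L : RL n) : unconsM (R := R) (bs (X :: L)) = bs (X, L) := by
  simp [unconsM]
lemma unconsM_consM (x : Finset (Fin n) × RL n →₀ R) : unconsM (consM x) = x := by
  apply ext_bs' (f := unconsM ∘ₗ consM) (g := LinearMap.id)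
  rintro ⟨X, L⟩; simp

lemma adj_consM : Adj (consM (R := R) (n := n)) unconsM := by
  apply Adj.of
  rintro ⟨X, L⟩ M
  cases M with
  | nil => simp [bs_apply]
  | cons Y M => simp [bs_apply, eq_comm]

/-- projection onto row lists of given shape -/
noncomputable def PP : List ℕ → (FW R n →ₗ[R] (RL n →₀ R))
  | [] => lc fun u => if u = [] then bs [] else 0
  | a :: l => consM ∘ₗ Pr θ (PP l) a

/-- injection from row lists of given shape -/
noncomputable def Js : List ℕ → ((RL n →₀ R) →ₗ[R] FW R n)
  | [] => lc fun u => if u = [] then bs [] else 0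
  | a :: l => JJ θ (Js l) a ∘ₗ unconsM

lemma adj_PP (l : List ℕ) : Adj (PP (n := n) θ l) (Js θ l) := by
  induction l with
  | nil =>
    apply Adj.of; intro a b; simp only [PP, Js, lc_bs]
    by_cases ha : a = [] <;> by_cases hb : b = [] <;> simp [ha, hb, bs_apply, eq_comm]
  | cons a l ih => exact (adj_Pr θ ih a).comp adj_consM

/-- Young symmetrizer like operator -/
noncomputable def YY (l : List ℕ) : Module.End R (FW R n) := Js θ l ∘ₗ PP θ l

lemma YY_mem (l : List ℕ) : YY (n := n) θ l ∈ HH θ := by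
  induction l with
  | nil =>
    have : YY (n := n) θ [] = pr 0 := by
      apply ext_bs; intro u
      by_cases h : u = [] <;> simp [YY, PP, Js, h]
    rw [this]; exact pr_mem θ 0
  | cons a l ih =>
    have h0 : ∀ a, YY (n := n) θ (a :: l) = JJ θ (Js θ l) a ∘ₗ Pr θ (PP θ l) a := by
      intro a
      apply LinearMap.ext; intro x
      simp [YY, PP, Js, unconsM_consM]
    induction a with
    | zero =>
      have : YY (n := n) θ (0 :: l) = YY θ l := by
        rw [h0]
        apply LinearMap.ext; intro x
        simp only [JJ, Pr, LinearMap.comp_apply, YY]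
        congr 1
        apply ext_bs' (f := ce' ∘ₗ ce) (g := LinearMap.id)
        intro b; simp
      rw [this]; exact ih
    | succ a iha =>
      rw [h0, JJ_Pr, ← h0]
      exact mul_mem (shift_mem θ iha) (cc_mem θ a)

/-- row operator -/
noncomputable def Jr : ℕ → Finset (Fin n) → Module.End R (FW R n)
  | 0, X => if X = ∅ then 1 else 0
  | a + 1, X => ∑ b ∈ X, ((θ : R) ^ up X b) • (cs b * Jr a (X.erase b))

lemma JJ_bs {β : Type*} (G : (β →₀ R) →ₗ[R] FW R n) (a : ℕ) (X : Finset (Fin n)) (c : β) :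
    JJ θ G a (bs (X, c)) = Jr θ a X (G (bs c)) := by
  induction a generalizing X with
  | zero =>
    simp only [JJ, Jr, LinearMap.comp_apply, ce'_bs]
    split_ifs <;> simp
  | succ a ih =>
    simp only [JJ, Jr, LinearMap.comp_apply, LinearMap.sum_apply, dd_bs]
    rw [← Finset.sum_subset (Finset.subset_univ X)]
    · apply sum_congr rfl; intro b hb
      simp [hb, ih]
    · intro b _ hb; simp [hb]

lemma Jr_ne {a : ℕ} {X : Finset (Fin n)} (h : X.card ≠ a) : Jr θ a X = 0 := by
  induction a generalizing X with
  | zero => simp only [Jr]; rw [if_neg]; simpa using h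
  | succ a ih =>
    simp only [Jr]; apply sum_eq_zero; intro b hb
    rw [ih]
    · simp
    · rw [card_erase_of_mem hb]
      have := card_pos.2 ⟨b, hb⟩
      omega

/-- shape -/
def shp (L : RL n) : List ℕ := L.map Finset.card

@[simp] lemma shp_nil : shp ([] : RL n) = [] := rfl
@[simp] lemma shp_cons (X : Finset (Fin n)) (L : RL n) : shp (X :: L) = X.card :: shp L := rfl
@[simp] lemma shp_append (L M : RL n) : shp (L ++ M) = shp L ++ shp M := by simp [shp]
@[simp] lemma shp_length (L : RL n) : (shp L).length = L.length := by simp [shp]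

/-- the vector of a row list -/
noncomputable def J : RL n → FW R n
  | [] => bs []
  | X :: L => Jr θ X.card X (J L)

lemma Js_bs (l : List ℕ) (L : RL n) : Js θ l (bs L) = if shp L = l then J θ L else 0 := by
  induction l generalizing L with
  | nil => cases L <;> simp [Js, J]
  | cons a l ih =>
    cases L with
    | nil => simp [Js]
    | cons X L =>
      simp only [Js, LinearMap.comp_apply, unconsM_cons, JJ_bs, ih, shp_cons, List.cons.injEq]
      by_cases hX : X.card = a
      · subst hX
        by_cases hL : shp L = l <;> simp [hL, J]
      · simp [hX, Jr_ne]

/-- initial-part operator -/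
noncomputable def Jp : RL n → Module.End R (FW R n)
  | [] => 1
  | X :: L => Jr θ X.card X * Jp L

lemma J_append (L M : RL n) : J θ (L ++ M) = Jp θ L (J θ M) := by
  induction L with
  | nil => simp [Jp]
  | cons X L ih => simp [J, Jp, ih]

lemma Jr_add (a b : ℕ) (Z : Finset (Fin n)) : Jr θ (a + b) Z =
    ∑ T ∈ Z.powerset, ((θ : R) ^ inv (Z \ T) T) • (Jr θ a (Z \ T) * Jr θ b T) := by
  induction a generalizing Z with
  | zero =>
    rw [sum_eq_single Z]
    · simp [Jr, inv]
    · intro T hT hne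
      rw [mem_powerset] at hT
      simp only [Jr]; rw [if_neg]; · simp
      rw [sdiff_eq_empty_iff_subset]; intro h; exact hne (hT.antisymm h)
    · simp
  | succ a ih =>
    rw [Nat.add_right_comm]
    simp only [Jr, ih, mul_sum, smul_sum, sum_mul]
    rw [sum_comm' (t' := Z.powerset) (s' := fun T => Z \ T)]
    · apply sum_congr rfl; intro T hT
      rw [mem_powerset] at hT
      apply sum_congr rfl; intro c hc
      rw [mem_sdiff] at hc
      have h1 : Z.erase c \ T = (Z \ T).erase c := by ext z; simp; tauto
      have h2 : inv (Z \ T) T = up T c + inv ((Z \ T).erase c) T := by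
        unfold inv; rw [← add_sum_erase _ _ (mem_sdiff.2 hc)]
      have h3 : up Z c = up (Z \ T) c + up T c := by
        rw [← up_union sdiff_disjoint, sdiff_union_of_subset hT]
      simp only [h1, h2, h3, mul_smul_comm, smul_mul_assoc, smul_smul, mul_assoc, ← pow_add]
      congr 2; ring
    · intro c T; simp only [mem_powerset, mem_sdiff]
      constructor
      · rintro ⟨h1, h2⟩
        exact ⟨⟨h1, fun h => by simpa using h2 h⟩, h2.trans (erase_subset _ _)⟩
      · rintro ⟨⟨h1, h3⟩, h2⟩
        exact ⟨h1, fun z hz => mem_erase.2 ⟨fun e => h3 (e ▸ hz), h2 hz⟩⟩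

lemma J_split (pre suf : RL n) (Z : Finset (Fin n)) (t : ℕ) (ht : t ≤ Z.card) :
    J θ (pre ++ Z :: suf) = ∑ T ∈ Z.powersetCard t, ((θ : R) ^ inv (Z \ T) T) •
      J θ (pre ++ (Z \ T) :: T :: suf) := by
  simp only [J_append, J]
  rw [show Z.card = (Z.card - t) + t by omega, Jr_add]
  simp only [LinearMap.sum_apply, map_sum, LinearMap.smul_apply, map_smul]
  rw [← sum_subset (s₁ := Z.powersetCard t)]
  · apply sum_congr rfl; intro T hT
    rw [mem_powersetCard] at hT
    rw [card_sdiff_of_subset hT.1, hT.2]; rfl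
  · intro T hT; rw [mem_powersetCard] at hT; exact mem_powerset.2 hT.1
  · intro T hT hT'
    rw [mem_powersetCard] at hT'; rw [mem_powerset] at hT
    rw [Jr_ne θ (a := t)]
    · simp
    · intro h; exact hT' ⟨hT, h⟩

lemma row_word (X : Finset (Fin n)) : ∃ w : W n, w.length = X.card ∧
    ∀ {β : Type} (Q : FW R n →ₗ[R] (β →₀ R)) (u : W n),
      Pr θ Q X.card (bs (w ++ u)) = (lc fun c => bs (X, c)) (Q (bs u)) := by
  induction X using Finset.induction_on_max with
  | empty => exact ⟨[], by simp, fun Q u => by simp only [Pr, card_empty, List.nil_append]; rfl⟩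
  | insert a s ha ih =>
    obtain ⟨w, hw, h⟩ := ih
    have ha' : a ∉ s := fun h => lt_irrefl _ (ha a h)
    refine ⟨a :: w, by simp [hw, ha'], fun {β} Q u => ?_⟩
    rw [card_insert_of_notMem ha', List.cons_append, ← cs_bs, Pr_cs, h]
    have hup : up s a = 0 := by
      unfold up; rw [card_eq_zero, filter_eq_empty_iff]
      intro x hx; exact not_lt_of_gt (ha x hx)
    apply ext_bs' (f := wedge θ a ∘ₗ (lc fun c => bs (s, c))) (g := lc fun c => bs (insert a s, c))
    intro c; simp [wedge_bs, ha', hup]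

lemma exists_wd (L : RL n) : ∃ w : W n, w.length = (shp L).sum ∧ PP θ (shp L) (bs w) = bs L := by
  induction L with
  | nil => exact ⟨[], by simp, by simp [PP]⟩
  | cons X L ih =>
    obtain ⟨w, hw, h⟩ := ih
    obtain ⟨v, hv, h'⟩ := row_word θ X
    refine ⟨v ++ w, by simp [hv, hw], ?_⟩
    simp only [shp_cons, PP, LinearMap.comp_apply]
    rw [h', h]; simp

/-- word detecting a row list -/
noncomputable def wd (L : RL n) : W n := (exists_wd θ L).choose
lemma wd_length (L : RL n) : (wd θ L).length = (shp L).sum := (exists_wd θ L).choose_spec.1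
lemma PP_wd (L : RL n) : PP θ (shp L) (bs (wd θ L)) = bs L := (exists_wd θ L).choose_spec.2

/-- all row lists of a given shape -/
def rlOf (n : ℕ) : List ℕ → Finset (RL n)
  | [] => {[]}
  | a :: l => image₂ List.cons (powersetCard a univ) (rlOf n l)

lemma mem_rlOf {l : List ℕ} {L : RL n} : L ∈ rlOf n l ↔ shp L = l := by
  induction l generalizing L with
  | nil => cases L <;> simp [rlOf]
  | cons a l ih =>
    cases L with
    | nil => simp [rlOf]
    | cons X L => simp [rlOf, mem_image₂, ih, mem_powersetCard]

lemma PP_apply (l : List ℕ) (x : FW R n) (L : RL n) :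
    PP θ l x L = if shp L = l then dot x (J θ L) else 0 := by
  rw [← dot_bs', adj_PP, Js_bs]; split_ifs <;> simp

lemma PP_sum (l : List ℕ) (x : FW R n) :
    ∑ L ∈ rlOf n l, (PP θ l x L) • (bs L : RL n →₀ R) = PP θ l x := by
  ext M
  simp only [Finsupp.coe_finsetSum, Finset.sum_apply, Finsupp.smul_apply, bs_apply]
  simp only [smul_eq_mul, mul_ite, mul_one, mul_zero, Finset.sum_ite_eq', mem_rlOf]
  split_ifs with h
  · rfl
  · rw [PP_apply, if_neg h]

/-- left inverse of `Js` -/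
noncomputable def ell (l : List ℕ) : FW R n →ₗ[R] (RL n →₀ R) :=
  ∑ L ∈ rlOf n l, (LinearMap.toSpanSingleton R _ (bs L)) ∘ₗ Finsupp.lapply (wd θ L)

lemma ell_apply (l : List ℕ) (x : FW R n) :
    ell θ l x = ∑ L ∈ rlOf n l, (x (wd θ L)) • (bs L : RL n →₀ R) := by
  simp [ell]

lemma ell_YY (l : List ℕ) (x : FW R n) : ell θ l (YY θ l x) = PP θ l x := by
  rw [ell_apply, ← PP_sum θ l x]
  apply sum_congr rfl; intro L hL
  rw [mem_rlOf] at hL; subst hL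
  congr 1
  rw [YY, LinearMap.comp_apply, ← dot_bs', (adj_PP θ _).symm, PP_wd, dot_bs']

lemma YY_wd (L : RL n) : YY θ (shp L) (bs (wd θ L)) = J θ L := by
  rw [YY, LinearMap.comp_apply, PP_wd, Js_bs, if_pos rfl]

/-- merging at depth -/
noncomputable def mul : ℕ → ((RL n →₀ R) →ₗ[R] (RL n →₀ R))
  | 0 => consM ∘ₗ mu θ ∘ₗ lft unconsM ∘ₗ unconsM
  | k + 1 => consM ∘ₗ lft (mul k) ∘ₗ unconsM

lemma mul_bs (pre suf : RL n) (A B : Finset (Fin n)) :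
    mul θ pre.length (bs (pre ++ A :: B :: suf)) =
      if Disjoint A B then ((θ : R) ^ inv A B) • bs (pre ++ (A ∪ B) :: suf) else 0 := by
  induction pre with
  | nil =>
    simp only [List.length_nil, mul, List.nil_append, LinearMap.comp_apply, unconsM_cons, lft_bs,
      lc_bs, mu_bs]
    split_ifs <;> simp
  | cons X pre ih =>
    simp only [List.length_cons, mul, List.cons_append, LinearMap.comp_apply, unconsM_cons, lft_bs,
      ih]
    split_ifs <;> simp

lemma mul_PP (pre suf : List ℕ) (a b : ℕ) :
    PP (n := n) θ (pre ++ (a + b) :: suf) = mul θ pre.length ∘ₗ PP θ (pre ++ a :: b :: suf) := by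
  induction pre with
  | nil =>
    simp only [List.length_nil, mul, List.nil_append, PP, mu_Pr]
    apply LinearMap.ext; intro x
    simp only [LinearMap.comp_apply, unconsM_consM]
    congr 2
    symm
    rw [← LinearMap.comp_apply, lft_Pr]
    congr 2
    apply LinearMap.ext; intro y
    simp [unconsM_consM]
  | cons c pre ih =>
    simp only [List.length_cons, mul, List.cons_append, PP, ih]
    apply LinearMap.ext; intro x
    simp only [LinearMap.comp_apply, unconsM_consM]
    congr 1
    rw [← LinearMap.comp_apply, lft_Pr]

end lists
end RS

namespace RS
open Finset TensorProduct

section tens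
variable {R : Type*} [CommRing R] (θ : Rˣ) {n : ℕ}

/-- mixed tensor words -/
abbrev TT (R : Type*) [CommRing R] (n : ℕ) := FW R n ⊗[R] FW R n

/-- operator on the first factor -/
noncomputable def lx (A : Module.End R (FW R n)) : Module.End R (TT R n) := TensorProduct.map A LinearMap.id
/-- operator on the second factor -/
noncomputable def ly (A : Module.End R (FW R n)) : Module.End R (TT R n) := TensorProduct.map LinearMap.id A

@[simp] lemma lx_tmul (A : Module.End R (FW R n)) (x y : FW R n) : lx A (x ⊗ₜ y) = A x ⊗ₜ y := rfl
@[simp] lemma ly_tmul (A : Module.End R (FW R n)) (x y : FW R n) : ly A (x ⊗ₜ y) = x ⊗ₜ A y := rfl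

lemma lx_mul (A B : Module.End R (FW R n)) : lx (A * B) = lx A * lx B := by
  apply TensorProduct.ext'; intro x y; simp
lemma ly_mul (A B : Module.End R (FW R n)) : ly (A * B) = ly A * ly B := by
  apply TensorProduct.ext'; intro x y; simp
lemma lx_add (A B : Module.End R (FW R n)) : lx (A + B) = lx A + lx B := by
  apply TensorProduct.ext'; intro x y; simp [add_tmul]
lemma ly_add (A B : Module.End R (FW R n)) : ly (A + B) = ly A + ly B := by
  apply TensorProduct.ext'; intro x y; simp [tmul_add]
lemma lx_ly (A B : Module.End R (FW R n)) : lx A * ly B = TensorProduct.map A B := by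
  apply TensorProduct.ext'; intro x y; simp
lemma ly_lx (A B : Module.End R (FW R n)) : ly B * lx A = TensorProduct.map A B := by
  apply TensorProduct.ext'; intro x y; simp

lemma ext_tt {M : Type*} [AddCommMonoid M] [Module R M] {f g : TT R n →ₗ[R] M}
    (h : ∀ u v, f (bs u ⊗ₜ bs v) = g (bs u ⊗ₜ bs v)) : f = g := by
  apply TensorProduct.ext
  apply ext_bs; intro u; apply ext_bs; intro v
  exact h u v

/-- cup -/
noncomputable def io : Module.End R (TT R n) := ∑ t : Fin n, ((θ : R) ^ (t : ℕ)) • TensorProduct.map (cs t) (cs t)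
/-- cap -/
noncomputable def po : Module.End R (TT R n) := ∑ t : Fin n, ((θ : R) ^ (t : ℕ)) • TensorProduct.map (un t) (un t)

lemma io_tmul (x y : FW R n) : io θ (x ⊗ₜ y) = ∑ t : Fin n, ((θ : R) ^ (t : ℕ)) • (cs t x ⊗ₜ[R] cs t y) := by
  simp [io]
lemma po_tmul (x y : FW R n) : po θ (x ⊗ₜ y) = ∑ t : Fin n, ((θ : R) ^ (t : ℕ)) • (un t x ⊗ₜ[R] un t y) := by
  simp [po]

/-- generators whose centralizer is studied -/
def gens : Set (Module.End R (TT R n)) :=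
  {g | (∃ t, g = lx (SS θ t)) ∨ (∃ t, g = ly (SS θ t)) ∨ (∃ t, g = lx (pr t)) ∨ (∃ t, g = ly (pr t)) ∨
    g = io θ * po θ}

/-- the big centralizer -/
noncomputable def CB : Subalgebra R (Module.End R (TT R n)) := Subalgebra.centralizer R (gens θ)

lemma mem_CB {φ : Module.End R (TT R n)} : φ ∈ CB θ ↔
    (∀ t, lx (SS θ t) * φ = φ * lx (SS θ t)) ∧ (∀ t, ly (SS θ t) * φ = φ * ly (SS θ t)) ∧
    (∀ t, lx (pr t) * φ = φ * lx (pr t)) ∧ (∀ t, ly (pr t) * φ = φ * ly (pr t)) ∧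
    io θ * po θ * φ = φ * (io θ * po θ) := by
  unfold CB; rw [Subalgebra.mem_centralizer_iff]
  constructor
  · intro h
    exact ⟨fun t => h _ (Or.inl ⟨t, rfl⟩), fun t => h _ (Or.inr (Or.inl ⟨t, rfl⟩)),
      fun t => h _ (Or.inr (Or.inr (Or.inl ⟨t, rfl⟩))),
      fun t => h _ (Or.inr (Or.inr (Or.inr (Or.inl ⟨t, rfl⟩)))),
      h _ (Or.inr (Or.inr (Or.inr (Or.inr rfl))))⟩
  · rintro ⟨h1, h2, h3, h4, h5⟩ g (⟨t, rfl⟩ | ⟨t, rfl⟩ | ⟨t, rfl⟩ | ⟨t, rfl⟩ | rfl)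
    · exact h1 t
    · exact h2 t
    · exact h3 t
    · exact h4 t
    · exact h5

lemma CB_lx {φ : Module.End R (TT R n)} (hφ : φ ∈ CB θ) {A : Module.End R (FW R n)} (hA : A ∈ HH θ) :
    lx A * φ = φ * lx A := by
  rw [mem_CB] at hφ
  induction hA using Algebra.adjoin_induction with
  | mem x hx =>
    rcases hx with ⟨t, rfl⟩ | ⟨t, rfl⟩
    · exact hφ.1 t
    · exact hφ.2.2.1 t
  | algebraMap r =>
    have : lx (algebraMap R (Module.End R (FW R n)) r) = r • 1 := by
      apply TensorProduct.ext'; intro x y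
      simp [smul_tmul']
    rw [this]; simp
  | add x y _ _ hx hy => rw [lx_add, add_mul, mul_add, hx, hy]
  | mul x y _ _ hx hy => rw [lx_mul, mul_assoc, hy, ← mul_assoc, hx, mul_assoc]

lemma CB_ly {φ : Module.End R (TT R n)} (hφ : φ ∈ CB θ) {A : Module.End R (FW R n)} (hA : A ∈ HH θ) :
    ly A * φ = φ * ly A := by
  rw [mem_CB] at hφ
  induction hA using Algebra.adjoin_induction with
  | mem x hx =>
    rcases hx with ⟨t, rfl⟩ | ⟨t, rfl⟩
    · exact hφ.2.1 t
    · exact hφ.2.2.2.1 t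
  | algebraMap r =>
    have : ly (algebraMap R (Module.End R (FW R n)) r) = r • 1 := by
      apply TensorProduct.ext'; intro x y
      simp
    rw [this]; simp
  | add x y _ _ hx hy => rw [ly_add, add_mul, mul_add, hx, hy]
  | mul x y _ _ hx hy => rw [ly_mul, mul_assoc, hy, ← mul_assoc, hx, mul_assoc]

/-- swap of tensor factors -/
noncomputable def cm : Module.End R (TT R n) := (TensorProduct.comm R (FW R n) (FW R n)).toLinearMap
@[simp] lemma cm_tmul (x y : FW R n) : cm (x ⊗ₜ[R] y) = y ⊗ₜ x := rfl
lemma cm_cm : (cm : Module.End R (TT R n)) * cm = 1 := by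
  apply TensorProduct.ext'; intro x y; simp
lemma cm_lx (A : Module.End R (FW R n)) : cm * lx A = ly A * cm := by
  apply TensorProduct.ext'; intro x y; simp
lemma cm_ly (A : Module.End R (FW R n)) : cm * ly A = lx A * cm := by
  apply TensorProduct.ext'; intro x y; simp
lemma cm_io : cm * io θ (n := n) = io θ * cm := by
  apply TensorProduct.ext'; intro x y; simp [io]
lemma cm_po : cm * po θ (n := n) = po θ * cm := by
  apply TensorProduct.ext'; intro x y; simp [po]

lemma conj_comm {A : Type*} [Monoid A] {c g g' φ : A} (hc : c * c = 1) (h : c * g = g' * c)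
    (h' : g' * φ = φ * g') : g * (c * φ * c) = (c * φ * c) * g := by
  have e : g * c = c * g' := by
    calc g * c = c * c * (g * c) := by rw [hc, one_mul]
      _ = c * (c * g) * c := by simp only [mul_assoc]
      _ = c * g' * (c * c) := by rw [h]; simp only [mul_assoc]
      _ = c * g' := by rw [hc, mul_one]
  calc g * (c * φ * c) = (g * c) * φ * c := by simp only [mul_assoc]
    _ = c * (g' * φ) * c := by rw [e]; simp only [mul_assoc]
    _ = c * φ * (g' * c) := by rw [h']; simp only [mul_assoc]
    _ = c * φ * c * g := by rw [← h]; simp only [mul_assoc]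

lemma CB_cm {φ : Module.End R (TT R n)} (hφ : φ ∈ CB θ) : cm * φ * cm ∈ CB θ := by
  rw [mem_CB] at *
  refine ⟨fun t => conj_comm cm_cm (cm_lx _) (hφ.2.1 t), fun t => conj_comm cm_cm (cm_ly _) (hφ.1 t),
    fun t => conj_comm cm_cm (cm_lx _) (hφ.2.2.2.1 t), fun t => conj_comm cm_cm (cm_ly _) (hφ.2.2.1 t),
    conj_comm cm_cm ?_ hφ.2.2.2.2⟩
  rw [← mul_assoc, cm_io, mul_assoc, cm_po, mul_assoc]

lemma TLx {φ : Module.End R (TT R n)} (hφ : φ ∈ CB θ) (pre suf : List ℕ) (a b : ℕ) (m : TT R n)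
    (h : φ (lx (YY θ (pre ++ a :: b :: suf)) m) = 0) :
    φ (lx (YY θ (pre ++ (a + b) :: suf)) m) = 0 := by
  have h1 : ∀ l, φ (lx (YY θ l) m) = lx (YY θ l) (φ m) := fun l =>
    (LinearMap.congr_fun (CB_lx θ hφ (YY_mem θ l)) m).symm
  rw [h1] at *
  have h2 : ∀ z : TT R n, lx (YY θ (pre ++ (a + b) :: suf)) z =
      LinearMap.rTensor _ (Js θ (pre ++ (a + b) :: suf) ∘ₗ mul θ pre.length ∘ₗ ell θ (pre ++ a :: b :: suf))
        (lx (YY θ (pre ++ a :: b :: suf)) z) := by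
    intro z
    induction z using TensorProduct.induction_on with
    | zero => simp
    | tmul x y =>
      simp only [LinearMap.comp_apply, lx_tmul, LinearMap.rTensor_tmul, ell_YY]
      rw [YY, mul_PP]; rfl
    | add z z' hz hz' => simp only [map_add, hz, hz']
  rw [h2, h, map_zero]

lemma YY_mul_wd (pre suf : RL n) (A B : Finset (Fin n)) :
    YY θ (shp pre ++ (A.card + B.card) :: shp suf) (bs (wd θ (pre ++ A :: B :: suf))) =
      if Disjoint A B then ((θ : R) ^ inv A B) • J θ (pre ++ (A ∪ B) :: suf) else 0 := by
  have h := PP_wd θ (pre ++ A :: B :: suf)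
  rw [YY, LinearMap.comp_apply, mul_PP, LinearMap.comp_apply]
  rw [shp_append, shp_cons, shp_cons] at h
  rw [h, shp_length, mul_bs]
  split_ifs with hd
  · rw [map_smul, Js_bs, if_pos]
    rw [shp_append, shp_cons, card_union_of_disjoint hd]
  · simp

lemma TLsum {φ : Module.End R (TT R n)} (hφ : φ ∈ CB θ) {ι : Type*} (s : Finset ι) (c : ι → R)
    (pre suf : ι → RL n) (A B : ι → Finset (Fin n)) (y : ι → FW R n)
    (lp ls : List ℕ) (a b : ℕ)
    (h1 : ∀ i ∈ s, shp (pre i) = lp) (h2 : ∀ i ∈ s, shp (suf i) = ls)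
    (h3 : ∀ i ∈ s, (A i).card = a) (h4 : ∀ i ∈ s, (B i).card = b)
    (h : ∑ i ∈ s, c i • φ (J θ (pre i ++ A i :: B i :: suf i) ⊗ₜ y i) = 0) :
    ∑ i ∈ s, (if Disjoint (A i) (B i) then (c i * (θ : R) ^ inv (A i) (B i)) else 0) •
      φ (J θ (pre i ++ (A i ∪ B i) :: suf i) ⊗ₜ y i) = 0 := by
  have := TLx θ hφ lp ls a b (∑ i ∈ s, c i • (bs (wd θ (pre i ++ A i :: B i :: suf i)) ⊗ₜ[R] y i)) (by
    rw [← h]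
    simp only [map_sum, map_smul, lx_tmul]
    apply sum_congr rfl; intro i hi
    rw [← h1 i hi, ← h2 i hi, ← h3 i hi, ← h4 i hi, ← YY_wd]
    simp)
  rw [← this]
  simp only [map_sum, map_smul, lx_tmul]
  apply sum_congr rfl; intro i hi
  rw [← h1 i hi, ← h2 i hi, ← h3 i hi, ← h4 i hi, YY_mul_wd]
  split_ifs with hd
  · rw [← smul_tmul', map_smul, smul_smul]
  · simp

lemma GR {φ : Module.End R (TT R n)} (hφ : φ ∈ CB θ) (pre suf : RL n) (A B : Finset (Fin n))
    (y : FW R n) (t : ℕ) (h : φ (J θ (pre ++ A :: B :: suf) ⊗ₜ y) = 0) :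
    ∑ T ∈ (A \ B).powersetCard t, ((θ : R) ^ (inv (A \ T) T + inv T B)) •
      φ (J θ (pre ++ (A \ T) :: (B ∪ T) :: suf) ⊗ₜ y) = 0 := by
  by_cases ht : t ≤ A.card
  swap
  · rw [powersetCard_eq_empty.2, sum_empty]
    exact lt_of_le_of_lt (card_le_card sdiff_subset) (not_le.1 ht)
  rw [J_split θ pre _ A t ht] at h
  have := TLsum θ hφ (A.powersetCard t) (fun T => (θ : R) ^ inv (A \ T) T) (fun T => pre ++ [A \ T])
    (fun _ => suf) (fun T => T) (fun _ => B) (fun _ => y) (shp pre ++ [A.card - t]) (shp suf) t B.card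
    (fun T hT => by
      rw [mem_powersetCard] at hT
      simp [card_sdiff_of_subset hT.1, hT.2]) (fun _ _ => rfl)
    (fun T hT => (mem_powersetCard.1 hT).2) (fun _ _ => rfl) (by
      rw [← h, sum_tmul, map_sum]
      apply sum_congr rfl; intro T _
      rw [← smul_tmul', map_smul]; simp)
  rw [← this]
  rw [← sum_subset (s₁ := (A \ B).powersetCard t) (s₂ := A.powersetCard t)]
  · apply sum_congr rfl; intro T hT
    rw [mem_powersetCard] at hT
    have hd : Disjoint T B := by
      rw [disjoint_left]; intro x hx; exact (mem_sdiff.1 (hT.1 hx)).2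
    rw [if_pos hd, pow_add, union_comm]; simp
  · exact powersetCard_mono sdiff_subset
  · intro T hT hT'
    rw [mem_powersetCard] at hT hT'
    rw [if_neg, zero_smul]
    intro hd; apply hT'; refine ⟨fun x hx => mem_sdiff.2 ⟨hT.1 hx, disjoint_left.1 hd hx⟩, hT.2⟩

/-- sum of elements -/
def sm (T : Finset (Fin n)) : ℕ := ∑ i ∈ T, (i : ℕ)

lemma CO {β : Type} (Q : FW R n →ₗ[R] (β →₀ R)) (t : ℕ) (x u : FW R n) :
    LinearMap.lTensor (FW R n) (Pr θ Q t) ((io θ ^ t) (x ⊗ₜ u)) =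
      ∑ T : Finset (Fin n), ((θ : R) ^ sm T) • (Jr θ t T x ⊗ₜ (lc fun c => bs (T, c)) (Q u)) := by
  induction t with
  | zero =>
    rw [sum_eq_single ∅]
    · simp only [pow_zero, Module.End.one_apply, LinearMap.lTensor_tmul, Pr, Jr, if_true, sm,
        sum_empty, one_smul]; rfl
    · intro T _ hT; simp [Jr, hT]
    · simp
  | succ t ih =>
    have key : ∀ z : TT R n, LinearMap.lTensor (FW R n) (Pr θ Q (t + 1)) (io θ z) =
        ∑ b : Fin n, ((θ : R) ^ (b : ℕ)) • TensorProduct.map (cs b) (wedge θ b)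
          (LinearMap.lTensor (FW R n) (Pr θ Q t) z) := by
      intro z
      induction z using TensorProduct.induction_on with
      | zero => simp
      | tmul x y => simp [io_tmul, Pr_cs]
      | add z z' hz hz' => simp only [map_add, hz, hz', smul_add, sum_add_distrib]
    rw [pow_succ', Module.End.mul_apply, key, ih]
    have hw : ∀ (b : Fin n) (T : Finset (Fin n)) (y : β →₀ R),
        wedge θ b ((lc fun c => bs (T, c)) y) = if b ∈ T then 0 else
          ((θ : R) ^ up T b) • (lc fun c => bs (insert b T, c)) y := by
      intro b T y
      apply ext_bs' (f := wedge θ b ∘ₗ (lc fun d => bs (T, d))) (g := if b ∈ T then 0 else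
        ((θ : R) ^ up T b) • (lc fun d => bs (insert b T, d))) _ y |>.trans
      · split_ifs <;> simp
      · intro d; simp [wedge_bs]; split_ifs <;> simp
    simp only [map_sum, map_smul, map_tmul, hw]
    have h1 : ∀ b : Fin n, ∑ T : Finset (Fin n), ((θ : R) ^ sm T) • (cs b (Jr θ t T x) ⊗ₜ[R]
        (if b ∈ T then 0 else ((θ : R) ^ up T b) • (lc (R := R) fun c => (bs (insert b T, c) : Finset (Fin n) × β →₀ R)) (Q u))) =
        ∑ T ∈ univ.filter (b ∈ ·), ((θ : R) ^ (sm (T.erase b) + up T b)) •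
          (cs b (Jr θ t (T.erase b) x) ⊗ₜ[R] (lc (R := R) fun c => (bs (T, c) : Finset (Fin n) × β →₀ R)) (Q u)) := by
      intro b
      rw [← sum_filter_add_sum_filter_not univ (b ∈ ·)]
      rw [sum_eq_zero, zero_add]
      · apply sum_nbij' (fun T => insert b T) (fun T => T.erase b)
        · intro T _; simp
        · intro T _; simp
        · intro T hT; simp at hT; exact erase_insert hT
        · intro T hT; simp at hT; exact insert_erase hT
        · intro T hT; simp at hT
          simp only [hT, if_false, erase_insert hT, up_insert_self, tmul_smul, smul_smul, pow_add]
      · intro T hT; simp at hT; simp [hT]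
    simp only [h1, smul_sum]
    rw [sum_comm' (t' := univ) (s' := fun T => T) (by simp)]
    apply sum_congr rfl; intro T _
    simp only [Jr, LinearMap.sum_apply, sum_tmul, smul_sum]
    apply sum_congr rfl; intro b hb
    simp only [LinearMap.smul_apply, Module.End.mul_apply, ← smul_tmul', smul_smul, ← pow_add]
    congr 2
    unfold sm; rw [← add_sum_erase _ _ hb]; ring

lemma WR0 {φ : Module.End R (TT R n)} (hφ : φ ∈ CB θ) (hio : φ * io θ = 0) {t : ℕ} (ht : 1 ≤ t)
    (L M : RL n) :
    ∑ T ∈ (univ : Finset (Fin n)).powersetCard t, ((θ : R) ^ sm T) • φ (J θ (T :: L) ⊗ₜ J θ (T :: M)) = 0 := by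
  have h1 : φ ((io θ ^ t) (J θ L ⊗ₜ bs (wd θ M))) = 0 := by
    obtain ⟨k, rfl⟩ : ∃ k, t = k + 1 := ⟨t - 1, by omega⟩
    rw [pow_succ', Module.End.mul_apply, ← Module.End.mul_apply, hio]; rfl
  have h2 := LinearMap.congr_fun (CB_ly θ hφ (YY_mem θ (t :: shp M))) ((io θ ^ t) (J θ L ⊗ₜ bs (wd θ M)))
  simp only [Module.End.mul_apply] at h2
  rw [h1, map_zero] at h2
  have h3 : ∀ z : TT R n, ly (YY θ (t :: shp M)) z = LinearMap.lTensor (FW R n)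
      (Js θ (t :: shp M) ∘ₗ consM) (LinearMap.lTensor (FW R n) (Pr θ (PP θ (shp M)) t) z) := by
    intro z
    induction z using TensorProduct.induction_on with
    | zero => simp
    | tmul x y => simp [YY, PP]
    | add z z' hz hz' => simp only [map_add, hz, hz']
  rw [h3, CO] at h2
  rw [h2]
  simp only [map_sum, map_smul, LinearMap.lTensor_tmul, PP_wd, lc_bs, LinearMap.comp_apply, consM_bs,
    Js_bs, shp_cons, List.cons.injEq, and_true]
  rw [← sum_subset (s₁ := (univ : Finset (Fin n)).powersetCard t) (subset_univ _)]
  · apply sum_congr rfl; intro T hT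
    rw [mem_powersetCard] at hT
    rw [if_pos hT.2, J, hT.2]
  · intro T _ hT
    rw [if_neg]; · simp
    intro h; exact hT (mem_powersetCard.2 ⟨subset_univ _, h⟩)

lemma WR {φ : Module.End R (TT R n)} (hφ : φ ∈ CB θ) (hio : φ * io θ = 0) {t : ℕ} (ht : 1 ≤ t)
    (K K' : Finset (Fin n)) (L M : RL n) :
    ∑ T ∈ ((univ \ K') \ K).powersetCard t, ((θ : R) ^ (sm T + inv T K + inv T K')) •
      φ (J θ ((T ∪ K) :: L) ⊗ₜ J θ ((T ∪ K') :: M)) = 0 := by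
  have h := WR0 θ hφ hio ht (K :: L) (K' :: M)
  have h1 := TLsum θ hφ _ _ (fun _ => []) (fun _ => L) (fun T => T) (fun _ => K) _ [] (shp L) t K.card
    (fun _ _ => rfl) (fun _ _ => rfl) (fun T hT => (mem_powersetCard.1 hT).2) (fun _ _ => rfl) h
  have h2 := congrArg (cm (R := R)) h1
  simp only [map_sum, map_smul, map_zero] at h2
  have h3 := TLsum θ (CB_cm θ hφ) ((univ : Finset (Fin n)).powersetCard t)
    (fun T => if Disjoint T K then (θ : R) ^ sm T * (θ : R) ^ inv T K else 0)
    (fun _ => []) (fun _ => M) (fun T => T) (fun _ => K') (fun T => J θ ((T ∪ K) :: L)) [] (shp M) t K'.card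
    (fun _ _ => rfl) (fun _ _ => rfl) (fun T hT => (mem_powersetCard.1 hT).2) (fun _ _ => rfl) h2
  have h4 := congrArg (cm (R := R)) h3
  have hc : ∀ x : TT R n, cm (cm x) = x := fun x => LinearMap.congr_fun cm_cm x
  simp only [map_sum, map_smul, map_zero, Module.End.mul_apply, hc, cm_tmul, List.nil_append] at h4
  rw [← h4]
  rw [← sum_subset (s₁ := ((univ \ K') \ K).powersetCard t) (s₂ := (univ : Finset (Fin n)).powersetCard t)]
  · apply sum_congr rfl; intro T hT
    rw [mem_powersetCard] at hT
    have hd : Disjoint T K := by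
      rw [disjoint_left]; intro x hx; exact (mem_sdiff.1 (hT.1 hx)).2
    have hd' : Disjoint T K' := by
      rw [disjoint_left]; intro x hx; exact (mem_sdiff.1 (mem_sdiff.1 (hT.1 hx)).1).2
    rw [if_pos hd', if_pos hd, pow_add, pow_add]
  · exact powersetCard_mono (subset_univ _)
  · intro T hT hT'
    rw [mem_powersetCard] at hT hT'
    by_cases hd : Disjoint T K
    · rw [if_neg, zero_smul]
      intro hd'; apply hT'
      refine ⟨fun x hx => mem_sdiff.2 ⟨mem_sdiff.2 ⟨mem_univ _, disjoint_left.1 hd' hx⟩, disjoint_left.1 hd hx⟩, hT.2⟩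
    · simp [hd]

end tens
end RS

namespace RS
open Finset

section sr
variable {R : Type*} [CommRing R] (θ : Rˣ) {n : ℕ}

lemma inv_union_left {X Y : Finset (Fin n)} (h : Disjoint X Y) (Z : Finset (Fin n)) :
    inv (X ∪ Y) Z = inv X Z + inv Y Z := sum_union h

lemma inv_union_right {X Y : Finset (Fin n)} (h : Disjoint X Y) (Z : Finset (Fin n)) :
    inv Z (X ∪ Y) = inv Z X + inv Z Y := by
  unfold inv; rw [← sum_add_distrib]; apply sum_congr rfl; intro p _; exact up_union h p

/-- number of elements below `v` -/
def dn (Y : Finset (Fin n)) (v : Fin n) : ℕ := (Y.filter (· < v)).card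

lemma inv_eq_dn (Y V : Finset (Fin n)) : inv Y V = ∑ v ∈ V, dn Y v := by
  unfold inv up dn
  simp only [card_filter]
  rw [sum_comm]

/-- binary value of a set -/
def val (Y : Finset (Fin n)) : ℕ := ∑ e ∈ Y, 2 ^ (n - 1 - (e : ℕ))

lemma val_lt {Y Y' : Finset (Fin n)} {z : Fin n} (hz : z ∈ Y) (hz' : z ∉ Y')
    (h : ∀ e < z, e ∈ Y' → e ∈ Y) : val Y' < val Y := by
  have h1 : val Y' = ∑ e ∈ Y'.filter (· < z), 2 ^ (n - 1 - (e : ℕ)) +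
      ∑ e ∈ Y'.filter (fun e => ¬ e < z), 2 ^ (n - 1 - (e : ℕ)) := by
    unfold val; rw [sum_filter_add_sum_filter_not]
  have h2 : ∑ e ∈ Y'.filter (fun e => ¬ e < z), 2 ^ (n - 1 - (e : ℕ)) < 2 ^ (n - 1 - (z : ℕ)) := by
    rw [← sum_image (f := fun k => 2 ^ k) (g := fun e : Fin n => n - 1 - (e : ℕ))]
    · apply Nat.geomSum_lt le_rfl
      intro k hk
      simp only [mem_image, mem_filter] at hk
      obtain ⟨e, ⟨he, he'⟩, rfl⟩ := hk
      have : z ≠ e := fun h => hz' (h ▸ he)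
      have : (z : ℕ) ≠ e := fun h => this (Fin.ext h)
      have h3 : (z : ℕ) ≤ e := not_lt.1 he'
      have := e.2
      omega
    · intro a _ b _ hab
      have := a.2; have := b.2
      simp only at hab
      exact Fin.ext (by omega)
  have h3 : ∑ e ∈ Y'.filter (· < z), 2 ^ (n - 1 - (e : ℕ)) + 2 ^ (n - 1 - (z : ℕ)) ≤ val Y := by
    rw [add_comm, ← sum_insert (f := fun e : Fin n => 2 ^ (n - 1 - (e : ℕ))) (by simp)]
    apply sum_le_sum_of_subset
    intro e he
    rw [mem_insert, mem_filter] at he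
    rcases he with rfl | ⟨h4, h5⟩
    · exact hz
    · exact h e h5 h4
  omega

lemma SR {N : Type*} [AddCommGroup N] [Module R N] (w : Finset (Fin n) → Finset (Fin n) → N)
    (X Y : Finset (Fin n)) (x : Fin n)
    (hx : (X.filter (· ≤ x)).card < (Y.filter (· ≤ x)).card)
    (HG : ∀ A B, A ∪ B = X ∪ Y → A ∩ B = X ∩ Y → B.card < Y.card →
      ∑ T ∈ (A \ B).powersetCard (Y.card - B.card), ((θ : R) ^ (inv (A \ T) T + inv T B)) •
        w (A \ T) (B ∪ T) = 0) :
    w X Y ∈ Submodule.span R {v | ∃ X' Y', X' ∪ Y' = X ∪ Y ∧ X' ∩ Y' = X ∩ Y ∧ Y'.card = Y.card ∧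
      val Y' < val Y ∧ v = w X' Y'} := by
  set U := X ∪ Y with hU
  set I := X ∩ Y with hI
  set C := (X \ Y).filter (· ≤ x) with hC
  set G := I ∪ (Y \ X).filter (x < ·) with hG
  set Z : Finset (Fin n) → Finset (Fin n) := fun Y' => I ∪ (U \ Y') with hZ
  have hIY : I ⊆ Y := inter_subset_right
  have hIU : I ⊆ U := hIY.trans subset_union_right
  have hGY : G ⊆ Y := union_subset hIY ((filter_subset _ _).trans sdiff_subset)
  have hCX : ∀ v ∈ C, v ∈ X ∧ v ∉ Y ∧ v ≤ x := by intro v hv; simp [hC] at hv; tauto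
  have hGC : ∀ V ⊆ C, Disjoint G V := by
    intro V hV; rw [disjoint_left]; intro g hg hg'
    exact (hCX g (hV hg')).2.1 (hGY hg)
  -- cardinality
  have hcard : ∀ V ⊆ C, (G ∪ V).card < Y.card := by
    intro V hV
    have e1 : (X.filter (· ≤ x)).card = (I.filter (· ≤ x)).card + C.card := by
      rw [← card_union_of_disjoint]
      · congr 1; ext z; simp [hI, hC]; tauto
      · rw [disjoint_left]; intro g; simp [hI, hC]; tauto
    have e2 : (Y.filter (· ≤ x)).card = (I.filter (· ≤ x)).card + ((Y \ X).filter (· ≤ x)).card := by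
      rw [← card_union_of_disjoint]
      · congr 1; ext z; simp [hI]; tauto
      · rw [disjoint_left]; intro g; simp [hI]; tauto
    have e3 : Y.card = G.card + ((Y \ X).filter (· ≤ x)).card := by
      rw [← card_union_of_disjoint]
      · congr 1; ext z; simp only [hG, hI, mem_union, mem_inter, mem_filter, mem_sdiff]
        have := le_or_gt z x
        tauto
      · rw [disjoint_left]; intro g; simp only [hG, hI, mem_union, mem_inter, mem_filter, mem_sdiff]
        rintro (h | h) h'
        · tauto
        · exact absurd h.2 (not_lt.2 h'.2)
    have e4 := card_le_card hV
    rw [card_union_of_disjoint (hGC V hV)]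
    omega
  have step1 : ∀ V ∈ C.powerset, ∑ Y' ∈ (U.powersetCard Y.card).filter (G ∪ V ⊆ ·),
      ((θ : R) ^ (inv (Z Y') Y' + 2 * inv Y' (G ∪ V))) • w (Z Y') Y' = 0 := by
    intro V hV
    rw [mem_powerset] at hV
    set B := G ∪ V with hB
    have hIB : I ⊆ B := subset_union_left.trans subset_union_left
    have hBU : B ⊆ U := union_subset (hGY.trans subset_union_right)
      (fun v hv => mem_union_left _ (hCX v (hV hv)).1)
    have h := HG (I ∪ (U \ B)) B (by
        rw [union_assoc, sdiff_union_of_subset hBU, union_eq_right.2 hIU]) (by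
        rw [union_inter_distrib_right, sdiff_inter_self, union_empty, inter_eq_left.2 hIB]) (hcard V hV)
    have h0 : (I ∪ (U \ B)) \ B = U \ B := by
      rw [union_sdiff_distrib, sdiff_eq_empty_iff_subset.2 hIB, empty_union, sdiff_sdiff_left,
        sup_eq_union, union_self]
    rw [h0] at h
    have h' := congrArg (fun v => ((θ : R) ^ (inv U B + inv I B + inv B B)) • v) h
    simp only [smul_zero, smul_sum, smul_smul, ← pow_add] at h'
    rw [← h']
    symm
    apply sum_nbij' (fun T => B ∪ T) (fun Y' => Y' \ B)
    · intro T hT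
      rw [mem_powersetCard] at hT
      have hd : Disjoint B T := by
        rw [disjoint_right]; intro a ha; exact (mem_sdiff.1 (hT.1 ha)).2
      rw [mem_filter, mem_powersetCard]
      refine ⟨⟨union_subset hBU (hT.1.trans sdiff_subset), ?_⟩, subset_union_left⟩
      rw [card_union_of_disjoint hd, hT.2]; have : B.card < Y.card := hcard V hV; omega
    · intro Y' hY'
      rw [mem_filter, mem_powersetCard] at hY'
      rw [mem_powersetCard]
      refine ⟨sdiff_subset_sdiff hY'.1.1 le_rfl, ?_⟩
      rw [card_sdiff_of_subset hY'.2, hY'.1.2]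
    · intro T hT
      rw [mem_powersetCard] at hT
      rw [union_sdiff_left]; apply sdiff_eq_self_of_disjoint
      rw [disjoint_left]; intro a ha; exact (mem_sdiff.1 (hT.1 ha)).2
    · intro Y' hY'
      rw [mem_filter, mem_powersetCard] at hY'
      exact union_sdiff_of_subset hY'.2
    · intro T hT
      rw [mem_powersetCard] at hT
      have hd : Disjoint B T := by
        rw [disjoint_right]; intro a ha; exact (mem_sdiff.1 (hT.1 ha)).2
      have hA : (I ∪ (U \ B)) \ T = Z (B ∪ T) := by
        simp only [hZ]; ext a
        simp only [mem_sdiff, mem_union, not_or]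
        have h1 : a ∈ I → a ∉ T := fun h1 h2 => disjoint_left.1 hd (hIB h1) h2
        tauto
      have hBT : B ∪ T ⊆ U := union_subset hBU (hT.1.trans sdiff_subset)
      rw [hA]
      congr 2
      have d1 : Disjoint I (U \ (B ∪ T)) := by
        rw [disjoint_left]; intro a ha ha'
        exact (mem_sdiff.1 ha').2 (mem_union_left _ (hIB ha))
      have i1 : inv U B = inv (B ∪ T) B + inv (U \ (B ∪ T)) B := by
        rw [← inv_union_left disjoint_sdiff, union_sdiff_of_subset hBT]
      have i2 : inv (Z (B ∪ T)) B = inv I B + inv (U \ (B ∪ T)) B := inv_union_left d1 B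
      have i3 : inv (B ∪ T) B = inv B B + inv T B := inv_union_left hd B
      have i4 : inv (Z (B ∪ T)) (B ∪ T) = inv (Z (B ∪ T)) B + inv (Z (B ∪ T)) T := inv_union_right hd _
      omega
  set ti : R := ((θ⁻¹ : Rˣ) : R) with hti
  set cf : Finset (Fin n) → R := fun Y' => (θ : R) ^ (inv (Z Y') Y' + 2 * inv Y' G) *
    ∏ v ∈ C ∩ Y', (1 + -(ti ^ (2 * dn Y v) * (θ : R) ^ (2 * dn Y' v))) with hcf
  have step2 : ∑ Y' ∈ (U.powersetCard Y.card).filter (G ⊆ ·), cf Y' • w (Z Y') Y' = 0 := by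
    have h : ∑ V ∈ C.powerset, (∏ v ∈ V, -(ti ^ (2 * dn Y v))) •
        ∑ Y' ∈ (U.powersetCard Y.card).filter (G ∪ V ⊆ ·),
          ((θ : R) ^ (inv (Z Y') Y' + 2 * inv Y' (G ∪ V))) • w (Z Y') Y' = 0 :=
      sum_eq_zero fun V hV => by rw [step1 V hV, smul_zero]
    rw [← h]
    simp only [smul_sum]
    rw [sum_comm' (t' := (U.powersetCard Y.card).filter (G ⊆ ·)) (s' := fun Y' => (C ∩ Y').powerset)]
    · apply sum_congr rfl; intro Y' _
      simp only [hcf, smul_smul, prod_one_add, mul_sum, sum_smul]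
      apply sum_congr rfl; intro V hV
      rw [mem_powerset] at hV
      have hVC : V ⊆ C := hV.trans inter_subset_left
      congr 1
      rw [inv_union_right (hGC V hVC), inv_eq_dn Y' V, prod_neg, prod_neg, prod_mul_distrib,
        mul_add, ← add_assoc, pow_add _ _ (2 * ∑ v ∈ V, dn Y' v), mul_sum,
        ← prod_pow_eq_pow_sum (s := V) (f := fun v => 2 * dn Y' v) (a := (θ : R))]
      ring
    · intro V Y'
      simp only [mem_powerset, mem_filter, union_subset_iff, subset_inter_iff]
      tauto
  have hY : Y ∈ (U.powersetCard Y.card).filter (G ⊆ ·) := by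
    rw [mem_filter, mem_powersetCard]; exact ⟨⟨subset_union_right, rfl⟩, hGY⟩
  have hZY : Z Y = X := by
    simp only [hZ, hU, hI]; ext a; simp only [mem_union, mem_inter, mem_sdiff]; tauto
  have hcfY : cf Y = ((θ ^ (inv (Z Y) Y + 2 * inv Y G) : Rˣ) : R) := by
    have : C ∩ Y = ∅ := by
      rw [← disjoint_iff_inter_eq_empty, disjoint_left]; intro v hv; exact (hCX v hv).2.1
    simp [hcf, this]
  rw [← add_sum_erase _ _ hY, hcfY, hZY] at step2
  have h5 : ((θ ^ (inv X Y + 2 * inv Y G) : Rˣ) : R) • w X Y ∈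
      Submodule.span R {v | ∃ X' Y', X' ∪ Y' = U ∧ X' ∩ Y' = I ∧ Y'.card = Y.card ∧
      val Y' < val Y ∧ v = w X' Y'} := by
    rw [eq_neg_of_add_eq_zero_left step2]
    apply Submodule.neg_mem
    apply Submodule.sum_mem
    intro Y' hY'
    rw [mem_erase, mem_filter, mem_powersetCard] at hY'
    obtain ⟨hne, ⟨hYU, hYc⟩, hGY'⟩ := hY'
    have hne' : (symmDiff Y' Y).Nonempty := by
      rw [nonempty_iff_ne_empty]; intro h; apply hne
      rwa [← bot_eq_empty, symmDiff_eq_bot] at h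
    have hIY' : I ⊆ Y' := subset_union_left.trans hGY'
    set z := (symmDiff Y' Y).min' hne' with hz
    have hzm : z ∈ symmDiff Y' Y := min'_mem _ _
    have hlt : ∀ e < z, (e ∈ Y' ↔ e ∈ Y) := by
      intro e he
      by_contra hc
      have : e ∈ symmDiff Y' Y := by rw [mem_symmDiff]; tauto
      exact absurd (min'_le _ _ this) (not_le.2 he)
    rw [mem_symmDiff] at hzm
    rcases hzm with ⟨h1, h2⟩ | ⟨h1, h2⟩
    · have hzX : z ∈ X := by
        have := hYU h1; rw [hU, mem_union] at this; tauto
      rcases le_or_gt z x with hzx | hzx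
      · have hzC : z ∈ C ∩ Y' := by
          rw [mem_inter, hC, mem_filter, mem_sdiff]; exact ⟨⟨⟨hzX, h2⟩, hzx⟩, h1⟩
        have : cf Y' = 0 := by
          simp only [hcf]
          rw [prod_eq_zero hzC, mul_zero]
          have : dn Y' z = dn Y z := by
            unfold dn; congr 1; ext e; simp only [mem_filter]
            constructor
            · rintro ⟨a, b⟩; exact ⟨(hlt e b).1 a, b⟩
            · rintro ⟨a, b⟩; exact ⟨(hlt e b).2 a, b⟩
          rw [this, ← mul_pow]; simp [hti]
        rw [this, zero_smul]; exact Submodule.zero_mem _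
      · exfalso; apply hne
        symm
        apply eq_of_subset_of_card_le _ hYc.le
        intro e he
        rcases le_or_gt e x with hex | hex
        · exact (hlt e (hex.trans_lt hzx)).2 he
        · by_cases heX : e ∈ X
          · exact hIY' (mem_inter.2 ⟨heX, he⟩)
          · apply hGY'; rw [hG, mem_union, mem_filter, mem_sdiff]; tauto
    · apply Submodule.smul_mem
      apply Submodule.subset_span
      refine ⟨Z Y', Y', ?_, ?_, hYc, val_lt h1 h2 (fun e he => (hlt e he).1), rfl⟩
      · simp only [hZ]; ext a; simp only [mem_union, mem_sdiff]
        have := @hIU a; have := @hYU a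
        tauto
      · simp only [hZ]; ext a; simp only [mem_union, mem_sdiff, mem_inter]
        have := @hIY' a
        tauto
  have h6 := Submodule.smul_mem _ (((θ ^ (inv X Y + 2 * inv Y G))⁻¹ : Rˣ) : R) h5
  rwa [smul_smul, Units.inv_mul, one_smul] at h6

end sr
end RS

namespace RS
open Finset TensorProduct

section dts
variable {R : Type*} [CommRing R] (θ : Rˣ) {n : ℕ}

/-- identification of tensors of words with functions on pairs -/
noncomputable def et : TT R n ≃ₗ[R] (W n × W n →₀ R) := finsuppTensorFinsupp' R (W n) (W n)

@[simp] lemma et_bs (u v : W n) : et (bs u ⊗ₜ bs v : TT R n) = bs (u, v) := by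
  simp [et, bs]

/-- the standard bilinear form -/
noncomputable def dt : TT R n →ₗ[R] TT R n →ₗ[R] R := dot.compl₁₂ et.toLinearMap et.toLinearMap

lemma dt_bs_bs (u v u' v' : W n) : dt (bs u ⊗ₜ bs v : TT R n) (bs u' ⊗ₜ bs v') =
    dot (R := R) (bs u) (bs u') * dot (bs v) (bs v') := by
  classical
  simp only [dt, LinearMap.compl₁₂_apply, LinearEquiv.coe_coe, et_bs, dot_bs, bs_apply, Prod.mk.injEq]
  by_cases h1 : u' = u <;> by_cases h2 : v' = v <;> simp [h1, h2]

lemma dt_tmul (x y x' y' : FW R n) : dt (x ⊗ₜ y : TT R n) (x' ⊗ₜ y') = dot x x' * dot y y' := by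
  have h1 : ∀ u v, dt (bs u ⊗ₜ bs v : TT R n) (x' ⊗ₜ y') = dot (bs u) x' * dot (bs v) y' := by
    intro u v
    have : dt (bs u ⊗ₜ bs v : TT R n) = LinearMap.mul' R R ∘ₗ TensorProduct.map (dot (bs u)) (dot (bs v)) := by
      apply ext_tt; intro u' v'
      rw [dt_bs_bs]; simp
    rw [this]; simp
  have : dt.flip (x' ⊗ₜ y' : TT R n) = LinearMap.mul' R R ∘ₗ TensorProduct.map (dot.flip x') (dot.flip y') := by
    apply ext_tt; intro u v
    rw [LinearMap.flip_apply, h1]; simp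
  have h2 := LinearMap.congr_fun this (x ⊗ₜ y)
  simpa using h2

lemma dt_comm (x y : TT R n) : dt x y = dt y x := by
  simp only [dt, LinearMap.compl₁₂_apply, LinearEquiv.coe_coe]; exact dot_comm _ _

lemma dt_nondeg {x y : TT R n} (h : ∀ u v, dt (bs u ⊗ₜ bs v) x = dt (bs u ⊗ₜ bs v) y) : x = y := by
  apply et.injective
  ext p
  have := h p.1 p.2
  simpa [dt] using this

/-- adjoint pairs on tensors -/
def AdjT (A B : Module.End R (TT R n)) : Prop := ∀ x y, dt (A x) y = dt x (B y)

lemma AdjT.of {A B : Module.End R (TT R n)}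
    (h : ∀ u v u' v', dt (A (bs u ⊗ₜ bs v)) (bs u' ⊗ₜ bs v') = dt (bs u ⊗ₜ bs v) (B (bs u' ⊗ₜ bs v'))) :
    AdjT A B := by
  have : dt ∘ₗ A = dt.compl₂ B := by
    apply ext_tt; intro u v
    apply ext_tt; intro u' v'
    simpa using h u v u' v'
  intro x y
  have := LinearMap.congr_fun (LinearMap.congr_fun this x) y
  simpa using this

lemma AdjT.symm {A B : Module.End R (TT R n)} (h : AdjT A B) : AdjT B A := by
  intro x y; rw [dt_comm, ← h, dt_comm]

lemma AdjT.mul {A B A' B' : Module.End R (TT R n)} (h : AdjT A B) (h' : AdjT A' B') :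
    AdjT (A * A') (B' * B) := by
  intro x y; rw [Module.End.mul_apply, h, h', Module.End.mul_apply]

lemma AdjT.unique {A B B' : Module.End R (TT R n)} (h : AdjT A B) (h' : AdjT A B') : B = B' := by
  apply LinearMap.ext; intro y
  apply dt_nondeg; intro u v
  rw [← h, ← h']

lemma AdjT.map {A A' B B' : Module.End R (FW R n)} (h : Adj A B) (h' : Adj A' B') :
    AdjT (TensorProduct.map A A') (TensorProduct.map B B') := by
  apply AdjT.of; intro u v u' v'
  simp only [map_tmul, dt_tmul, h _ _, h' _ _]

lemma AdjT.lx {A B : Module.End R (FW R n)} (h : Adj A B) : AdjT (lx A) (lx B) := AdjT.map h Adj.id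
lemma AdjT.ly {A B : Module.End R (FW R n)} (h : Adj A B) : AdjT (ly A) (ly B) := AdjT.map Adj.id h

end dts
end RS

namespace RS
open Finset TensorProduct

section lev
variable {R : Type*} [CommRing R] (θ : Rˣ) {n : ℕ}

lemma adj_io : AdjT (io (n := n) θ) (po θ) := by
  intro x y
  simp only [io, po, LinearMap.sum_apply, map_sum, LinearMap.smul_apply, map_smul]
  apply sum_congr rfl; intro t _
  rw [AdjT.map (adj_cs t) (adj_cs t)]

lemma adj_E : AdjT (io (n := n) θ * po θ) (io θ * po θ) := (adj_io θ).mul (adj_io θ).symm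

/-- projection to words of given lengths -/
noncomputable def prs (r s : ℕ) : Module.End R (TT R n) := TensorProduct.map (pr r) (pr s)

lemma prs_eq (r s : ℕ) : prs (R := R) (n := n) r s = lx (pr r) * ly (pr s) := (lx_ly _ _).symm

lemma prs_bs (r s : ℕ) (u v : W n) : prs r s (bs u ⊗ₜ bs v : TT R n) =
    if u.length = r ∧ v.length = s then bs u ⊗ₜ bs v else 0 := by
  simp only [prs, map_tmul, pr_bs]
  by_cases h1 : u.length = r <;> by_cases h2 : v.length = s <;> simp [h1, h2]

lemma adj_prs (r s : ℕ) : AdjT (prs (R := R) (n := n) r s) (prs r s) := AdjT.map (adj_pr r) (adj_pr s)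

/-- the centralizer in bidegree `(r,s)` -/
noncomputable def CR (r s : ℕ) : Submodule R (Module.End R (TT R n)) where
  carrier := {φ | φ ∈ CB θ ∧ φ * prs r s = φ}
  add_mem' := by
    rintro a b ⟨h1, h2⟩ ⟨h3, h4⟩
    exact ⟨add_mem h1 h3, by rw [add_mul, h2, h4]⟩
  zero_mem' := ⟨zero_mem _, zero_mul _⟩
  smul_mem' := by
    rintro c a ⟨h1, h2⟩
    exact ⟨Subalgebra.smul_mem _ h1 c, by rw [smul_mul_assoc, h2]⟩

lemma mem_CR {r s : ℕ} {φ : Module.End R (TT R n)} : φ ∈ CR θ r s ↔ φ ∈ CB θ ∧ φ * prs r s = φ := Iff.rfl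

lemma CB_prs {φ : Module.End R (TT R n)} (hφ : φ ∈ CB θ) (r s : ℕ) : prs r s * φ = φ * prs r s := by
  have h := (mem_CB θ).1 hφ
  rw [prs_eq, mul_assoc, h.2.2.2.1, ← mul_assoc, h.2.2.1, mul_assoc]

lemma exists_adj {r s : ℕ} {φ : Module.End R (TT R n)} (hφ : φ ∈ CR θ r s) :
    ∃ φ' ∈ CR θ r s, AdjT φ φ' := by
  classical
  obtain ⟨hφ, hp⟩ := hφ
  let f : (Fin r → Fin n) × (Fin s → Fin n) → TT R n := fun p => bs (List.ofFn p.1) ⊗ₜ bs (List.ofFn p.2)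
  let φ' : Module.End R (TT R n) := ∑ p, (dt (φ (f p))).smulRight (f p)
  have hadj : AdjT φ φ' := by
    intro x y
    have : dt.flip y ∘ₗ φ = dt.flip (φ' y) := by
      apply ext_tt; intro u v
      rw [LinearMap.comp_apply, LinearMap.flip_apply, LinearMap.flip_apply]
      simp only [φ', LinearMap.sum_apply, map_sum, LinearMap.smulRight_apply, map_smul]
      by_cases hl : u.length = r ∧ v.length = s
      · obtain ⟨rfl, rfl⟩ := hl
        rw [sum_eq_single (u.get, v.get)]
        · simp only [f, List.ofFn_get]
          rw [dt_bs_bs]; simp [bs_apply]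
        · rintro ⟨a, b⟩ _ hne
          have : ¬ (List.ofFn a = u ∧ List.ofFn b = v) := by
            rintro ⟨h1, h2⟩
            apply hne
            have e1 : List.ofFn a = List.ofFn u.get := by rw [h1, List.ofFn_get]
            have e2 : List.ofFn b = List.ofFn v.get := by rw [h2, List.ofFn_get]
            rw [List.ofFn_injective e1, List.ofFn_injective e2]
          simp only [f]; rw [dt_bs_bs]
          simp only [dot_bs, bs_apply, smul_eq_mul]
          by_cases h1 : List.ofFn a = u
          · have h2 : List.ofFn b ≠ v := fun h2 => this ⟨h1, h2⟩
            simp [h2]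
          · simp [h1]
        · simp
      · rw [← hp, Module.End.mul_apply, prs_bs, if_neg hl, map_zero, map_zero, LinearMap.zero_apply]
        rw [sum_eq_zero]
        rintro ⟨a, b⟩ _
        simp only [f]; rw [dt_bs_bs]
        simp only [dot_bs, bs_apply, smul_eq_mul]
        by_cases h1 : List.ofFn a = u
        · have h2 : List.ofFn b ≠ v := fun h2 => hl ⟨by simp [← h1], by simp [← h2]⟩
          simp [h2]
        · simp [h1]
    exact LinearMap.congr_fun this x
  have key : ∀ g : Module.End R (TT R n), AdjT g g → g * φ = φ * g → g * φ' = φ' * g := by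
    intro g hg h
    have h1 := hg.mul hadj
    rw [h] at h1
    exact (hadj.mul hg).unique h1
  refine ⟨φ', ⟨?_, ?_⟩, hadj⟩
  · rw [mem_CB] at hφ ⊢
    exact ⟨fun t => key _ (AdjT.lx (adj_SS θ t)) (hφ.1 t), fun t => key _ (AdjT.ly (adj_SS θ t)) (hφ.2.1 t),
      fun t => key _ (AdjT.lx (adj_pr t)) (hφ.2.2.1 t), fun t => key _ (AdjT.ly (adj_pr t)) (hφ.2.2.2.1 t),
      key _ (adj_E θ) hφ.2.2.2.2⟩
  · have h1 := (adj_prs (R := R) (n := n) r s).mul hadj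
    rw [CB_prs θ hφ, hp] at h1
    exact h1.unique hadj

lemma po_cons (a b : Fin n) (u v : W n) : po θ (bs (a :: u) ⊗ₜ bs (b :: v) : TT R n) =
    if a = b then ((θ : R) ^ (a : ℕ)) • (bs u ⊗ₜ bs v) else 0 := by
  rw [po_tmul, sum_eq_single a]
  · simp only [un_bs_cons]; split_ifs with h1 h2 <;> simp_all
  · intro c _ hc; simp [un_bs_cons, Ne.symm hc]
  · simp
lemma po_nil1 (y : FW R n) : po θ (bs [] ⊗ₜ y : TT R n) = 0 := by simp [po_tmul]
lemma po_nil2 (x : FW R n) : po θ (x ⊗ₜ bs [] : TT R n) = 0 := by simp [po_tmul]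

/-- the inverse of the first Hecke generator (on words of length at least two) -/
noncomputable def S0i : Module.End R (FW R n) := S0 θ + (-((θ : R) - ((θ⁻¹ : Rˣ) : R))) • shift (shift 1)

lemma S0i_mem : S0i (n := n) θ ∈ HH θ :=
  add_mem (SS_mem θ 0) (Subalgebra.smul_mem _ (shift_mem θ (shift_mem θ (one_mem _))) _)

@[simp] lemma S0i_one (a : Fin n) : S0i θ (bs [a]) = 0 := by simp [S0i]
lemma S0i_cons (a b : Fin n) (u : W n) : S0i θ (bs (a :: b :: u)) =
    if a = b then (-(θ : R)) • bs (a :: b :: u)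
      else if a < b then bs (b :: a :: u)
      else bs (b :: a :: u) + (-((θ : R) - ((θ⁻¹ : Rˣ) : R))) • bs (a :: b :: u) := by
  have h1 : shift (shift 1) (bs (a :: b :: u) : FW R n) = bs (a :: b :: u) := by simp
  rw [S0i, LinearMap.add_apply, LinearMap.smul_apply, h1, S0_cons]
  split_ifs with h1 h2 h3 h3
  · rw [← add_smul]; congr 1; ring
  · exact absurd h3 (lt_asymm h2)
  · rfl
  · rw [add_assoc, ← add_smul]; simp
  · exact absurd (le_antisymm (not_lt.1 h2) (not_lt.1 h3)) h1

lemma E_conj : io (n := n) θ * po θ = po θ * (ly (S0 θ) * lx (S0i θ)) * io θ := by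
  have hz : ((θ⁻¹ : Rˣ) : R) * (θ : R) = 1 := by simp
  set z : R := ((θ⁻¹ : Rˣ) : R) with hzd
  apply ext_tt; intro u v
  match u, v with
  | [], v => simp [po_nil1, io_tmul]
  | a :: u, [] => simp [po_nil2, io_tmul]
  | a :: u, b :: v =>
    simp only [Module.End.mul_apply, io_tmul, cs_bs, po_cons, map_sum, map_smul, lx_tmul, ly_tmul]
    by_cases hab : a = b
    · subst hab
      rw [if_pos rfl, map_smul, io_tmul, smul_sum]
      apply sum_congr rfl; intro t _
      rw [S0i_cons, S0_cons]
      by_cases hta : t = a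
      · subst hta
        simp only [if_true, ← smul_tmul', tmul_smul, map_smul, po_cons, smul_smul, cs_bs]
        congr 1
        rw [← hzd]; linear_combination (-(θ : R) ^ (t : ℕ) * (θ : R) ^ (t : ℕ)) * hz
      · rcases lt_or_gt_of_ne hta with h | h
        · rw [if_neg hta, if_neg hta, if_pos h, if_neg (lt_asymm h)]
          simp [tmul_add, po_cons, Ne.symm hta, smul_smul, mul_comm]
        · rw [if_neg hta, if_neg hta, if_pos h, if_neg (lt_asymm h)]
          simp only [add_tmul, ← smul_tmul', map_add, map_smul, po_cons, hta, if_true, if_false, smul_zero, add_zero,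
            smul_smul, cs_bs]
          rw [mul_comm]
    · rw [if_neg hab, map_zero]
      let G : ℕ → R := fun k => if (a : ℕ) < k ∧ k ≤ b then -((θ : R) ^ (2 * k) * z) else 0
      have hc : ∀ t : Fin n, ((θ : R) ^ (t : ℕ)) • po θ (S0i θ (bs (t :: a :: u)) ⊗ₜ S0 θ (bs (t :: b :: v))) =
          (((θ : R) - z) * (G (t + 1) - G t)) • (bs (a :: u) ⊗ₜ[R] bs (b :: v)) := by
        intro t
        rw [S0i_cons, S0_cons, ← hzd]
        by_cases hta : t = a
        · subst hta
          rw [if_pos rfl, if_neg hab]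
          have g1 : G t = 0 := by simp [G]
          rw [g1]
          by_cases htb : b < t
          · have g2 : G (t + 1) = 0 := by
              simp only [G]; rw [if_neg]
              have : (b : ℕ) < t := htb
              omega
            rw [if_pos htb, g2]
            simp only [← smul_tmul', map_smul, po_cons, hab, if_false]; simp
          · have htb' : (t : ℕ) < b := lt_of_le_of_ne (not_lt.1 htb) (fun h => hab (Fin.ext h))
            have g2 : G (t + 1) = -((θ : R) ^ (2 * ((t : ℕ) + 1)) * z) := by
              simp only [G]; rw [if_pos]; omega
            rw [if_neg htb, g2]
            simp only [← smul_tmul', tmul_add, tmul_smul, map_add, map_smul, po_cons, hab, if_true, if_false, zero_add, smul_zero, smul_smul]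
            congr 1
            linear_combination ((θ : R) ^ (2 * (t : ℕ)) * (θ : R) * ((θ : R) - z)) * hz
        · rw [if_neg hta]
          have hta' : (t : ℕ) ≠ a := fun h => hta (Fin.ext h)
          by_cases htb : t = b
          · subst htb
            rw [if_pos rfl]
            have g2 : G (t + 1) = 0 := by simp [G]
            rw [g2]
            by_cases h : t < a
            · have g1 : G t = 0 := by
                simp only [G]; rw [if_neg]
                have : (t : ℕ) < a := h
                omega
              rw [if_pos h, g1]
              simp only [tmul_smul, map_smul, po_cons, hab, if_false]; simp
            · have h' : (a : ℕ) < t := by have : (a : ℕ) ≤ t := not_lt.1 h; omega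
              have g1 : G t = -((θ : R) ^ (2 * (t : ℕ)) * z) := by
                simp only [G]; rw [if_pos]; omega
              rw [if_neg h, g1]
              simp only [add_tmul, ← smul_tmul', tmul_smul, map_add, map_smul, po_cons, hab, if_true, if_false, zero_add, smul_zero, smul_smul]
              congr 1
              ring
          · rw [if_neg htb]
            have htb' : (t : ℕ) ≠ b := fun h => htb (Fin.ext h)
            by_cases h1 : t < a <;> by_cases h2 : b < t
            · have g2 : G (t + 1) = 0 := by simp only [G]; rw [if_neg]; have : (t : ℕ) < a := h1; omega
              have g1 : G t = 0 := by simp only [G]; rw [if_neg]; have : (t : ℕ) < a := h1; omega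
              rw [if_pos h1, if_pos h2, g1, g2]
              simp [po_cons, hab]
            · have g2 : G (t + 1) = 0 := by simp only [G]; rw [if_neg]; have : (t : ℕ) < a := h1; omega
              have g1 : G t = 0 := by simp only [G]; rw [if_neg]; have : (t : ℕ) < a := h1; omega
              rw [if_pos h1, if_neg h2, g1, g2]
              simp [tmul_add, po_cons, hab, Ne.symm hta]
            · have g2 : G (t + 1) = 0 := by simp only [G]; rw [if_neg]; have : (b : ℕ) < t := h2; omega
              have g1 : G t = 0 := by simp only [G]; rw [if_neg]; have : (b : ℕ) < t := h2; omega
              rw [if_neg h1, if_pos h2, g1, g2]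
              simp only [add_tmul, ← smul_tmul', map_add, map_smul, po_cons, hab, htb, if_false]; simp
            · have h1' : (a : ℕ) ≤ t := not_lt.1 h1
              have h2' : (t : ℕ) ≤ b := not_lt.1 h2
              have g1 : G t = -((θ : R) ^ (2 * (t : ℕ)) * z) := by
                simp only [G]; rw [if_pos]; omega
              have g2 : G (t + 1) = -((θ : R) ^ (2 * ((t : ℕ) + 1)) * z) := by
                simp only [G]; rw [if_pos]; omega
              rw [if_neg h1, if_neg h2, g1, g2]
              simp only [add_tmul, tmul_add, ← smul_tmul', tmul_smul, map_add, map_smul, po_cons, hab, htb, Ne.symm hta,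
                if_true, if_false, zero_add, smul_zero, smul_smul]
              congr 1
              linear_combination ((θ : R) ^ (2 * (t : ℕ)) * ((θ : R) - z) * (θ : R)) * hz
      rw [sum_congr rfl (fun t _ => hc t), ← sum_smul, ← mul_sum,
        Fin.sum_univ_eq_sum_range (fun t => G (t + 1) - G t), sum_range_sub]
      have g1 : G n = 0 := by simp only [G]; rw [if_neg]; have := b.2; omega
      have g2 : G 0 = 0 := by simp [G]
      rw [g1, g2]; simp

end lev
end RS

namespace RS
open Finset TensorProduct

section phi
variable {R : Type*} [CommRing R] (θ : Rˣ) {n : ℕ}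

lemma po_lx (A : Module.End R (FW R n)) : lx A * po θ = po θ * lx (shift A) := by
  apply TensorProduct.ext'; intro x y
  simp [po_tmul, un_shift]
lemma po_ly (A : Module.End R (FW R n)) : ly A * po θ = po θ * ly (shift A) := by
  apply TensorProduct.ext'; intro x y
  simp [po_tmul, un_shift]
lemma io_lx (A : Module.End R (FW R n)) : io θ * lx A = lx (shift A) * io θ := by
  apply TensorProduct.ext'; intro x y
  simp [io_tmul, shift_cs]
lemma io_ly (A : Module.End R (FW R n)) : io θ * ly A = ly (shift A) * io θ := by
  apply TensorProduct.ext'; intro x y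
  simp [io_tmul, shift_cs]

variable [NeZero n]

/-- left section of the cap -/
noncomputable def io0 : Module.End R (TT R n) := TensorProduct.map (cs 0) (cs 0)
/-- left inverse of the cup -/
noncomputable def po0 : Module.End R (TT R n) := TensorProduct.map (un 0) (un 0)

lemma po_io0 : po (n := n) θ * io0 = 1 := by
  apply TensorProduct.ext'; intro x y
  simp only [Module.End.mul_apply, io0, map_tmul, po_tmul, un_cs]
  rw [sum_eq_single 0]
  · simp
  · intro b _ hb; simp [Ne.symm hb]
  · simp
lemma po0_io : po0 * io (n := n) θ = 1 := by
  apply TensorProduct.ext'; intro x y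
  simp only [Module.End.mul_apply, po0, io_tmul, map_sum, map_smul, map_tmul, un_cs]
  rw [sum_eq_single 0]
  · simp
  · intro b _ hb; simp [hb]
  · simp
lemma io0_lx (A : Module.End R (FW R n)) : io0 * lx A = lx (shift A) * io0 := by
  apply TensorProduct.ext'; intro x y
  simp [io0, shift_cs]
lemma io0_ly (A : Module.End R (FW R n)) : io0 * ly A = ly (shift A) * io0 := by
  apply TensorProduct.ext'; intro x y
  simp [io0, shift_cs]

/-- lowering of bidegree -/
noncomputable def Phi : Module.End R (TT R n) →ₗ[R] Module.End R (TT R n) :=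
  LinearMap.mulLeft R (po θ) ∘ₗ LinearMap.mulRight R io0

lemma Phi_apply (φ : Module.End R (TT R n)) : Phi θ φ = po θ * φ * io0 := by
  simp [Phi, mul_assoc]

lemma io_Phi {φ : Module.End R (TT R n)} (hφ : φ ∈ CB θ) : φ * io θ = io θ * Phi θ φ := by
  have h := ((mem_CB θ).1 hφ).2.2.2.2
  calc φ * io θ = φ * (io θ * (po θ * io0)) := by rw [po_io0, mul_one]
    _ = (φ * (io θ * po θ)) * io0 := by simp only [mul_assoc]
    _ = _ := by rw [← h, Phi_apply]; simp only [mul_assoc]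

lemma po_Phi {φ : Module.End R (TT R n)} (hφ : φ ∈ CB θ) : po θ * φ = Phi θ φ * po θ := by
  have h := ((mem_CB θ).1 hφ).2.2.2.2
  calc po θ * φ = po0 * io θ * (po θ * φ) := by rw [po0_io, one_mul]
    _ = po0 * (io θ * po θ * φ) := by simp only [mul_assoc]
    _ = po0 * (φ * io θ * po θ) := by rw [h, mul_assoc]
    _ = (po0 * io θ) * Phi θ φ * po θ := by rw [io_Phi θ hφ]; simp only [mul_assoc]
    _ = _ := by rw [po0_io, one_mul]

lemma Phi_mul {φ ψ : Module.End R (TT R n)} (hφ : φ ∈ CB θ) :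
    Phi θ (φ * ψ) = Phi θ φ * Phi θ ψ := by
  rw [Phi_apply, ← mul_assoc, po_Phi θ hφ, Phi_apply θ ψ]; simp only [mul_assoc]

lemma Phi_comm {φ g h : Module.End R (TT R n)} (e : h * φ = φ * h) (h1 : g * po θ = po θ * h)
    (h2 : io0 * g = h * io0) : g * Phi θ φ = Phi θ φ * g := by
  rw [Phi_apply]
  calc g * (po θ * φ * io0) = (g * po θ) * φ * io0 := by simp only [mul_assoc]
    _ = po θ * (h * φ) * io0 := by rw [h1]; simp only [mul_assoc]
    _ = po θ * φ * (h * io0) := by rw [e]; simp only [mul_assoc]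
    _ = _ := by rw [← h2]; simp only [mul_assoc]

lemma Phi_CB {φ : Module.End R (TT R n)} (hφ : φ ∈ CB θ) : Phi θ φ ∈ CB θ := by
  have h := (mem_CB θ).1 hφ
  rw [mem_CB]
  refine ⟨fun t => Phi_comm θ (h.1 (t + 1)) (po_lx θ _) (io0_lx _),
    fun t => Phi_comm θ (h.2.1 (t + 1)) (po_ly θ _) (io0_ly _),
    fun t => Phi_comm θ (h.2.2.1 (t + 1)) ?_ ?_, fun t => Phi_comm θ (h.2.2.2.1 (t + 1)) ?_ ?_, ?_⟩
  · rw [← shift_pr]; exact po_lx θ _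
  · rw [← shift_pr]; exact io0_lx _
  · rw [← shift_pr]; exact po_ly θ _
  · rw [← shift_pr]; exact io0_ly _
  · have hA : (ly (S0 θ) * lx (S0i θ)) * φ = φ * (ly (S0 θ) * lx (S0i θ)) := by
      have e1 : ly (S0 θ) * φ = φ * ly (S0 θ) := h.2.1 0
      rw [mul_assoc, CB_lx θ hφ (S0i_mem θ), ← mul_assoc, e1, mul_assoc]
    rw [E_conj]
    set A := ly (S0 (n := n) θ) * lx (S0i θ)
    calc po θ * A * io θ * Phi θ φ = po θ * A * (io θ * Phi θ φ) := by simp only [mul_assoc]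
      _ = po θ * (A * φ) * io θ := by rw [← io_Phi θ hφ]; simp only [mul_assoc]
      _ = (po θ * φ) * A * io θ := by rw [hA]; simp only [mul_assoc]
      _ = _ := by rw [po_Phi θ hφ]; simp only [mul_assoc]

lemma io0_prs (r s : ℕ) : io0 * prs (R := R) (n := n) r s = prs (r + 1) (s + 1) * io0 := by
  rw [prs_eq, ← mul_assoc, io0_lx, mul_assoc, io0_ly, prs_eq, shift_pr, shift_pr, mul_assoc]

lemma Phi_CR {r s : ℕ} {φ : Module.End R (TT R n)} (hφ : φ ∈ CR θ (r + 1) (s + 1)) : Phi θ φ ∈ CR θ r s := by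
  refine ⟨Phi_CB θ hφ.1, ?_⟩
  rw [Phi_apply, mul_assoc, io0_prs, ← mul_assoc, mul_assoc (po θ), hφ.2]

lemma io_CR0 {r s : ℕ} (h : r = 0 ∨ s = 0) {φ : Module.End R (TT R n)} (hφ : φ ∈ CR θ r s) : φ * io θ = 0 := by
  rw [← hφ.2, mul_assoc]
  have : prs (R := R) (n := n) r s * io θ = 0 := by
    apply ext_tt; intro u v
    simp only [Module.End.mul_apply, io_tmul, cs_bs, map_sum, map_smul, prs_bs]
    rw [sum_eq_zero]; · rfl
    intro t _
    rw [if_neg, smul_zero]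
    simp only [List.length_cons]; omega
  rw [this, mul_zero]

end phi
end RS

namespace RS
open Finset TensorProduct

section strn
variable {R : Type*} [CommRing R] (θ : Rˣ) {n : ℕ}

/-- number of elements at most `x` -/
def cnt (X : Finset (Fin n)) (x : Fin n) : ℕ := (X.filter (· ≤ x)).card

/-- standardness of a list of rows -/
def RowStd (L : RL n) : Prop := L.IsChain (fun X Y => ∀ x, cnt Y x ≤ cnt X x)

/-- standardness of a pair of lists of rows -/
def Std (L L' : RL n) : Prop := RowStd L ∧ RowStd L' ∧ ∀ x : Fin n, cnt (L.headD ∅) x + cnt (L'.headD ∅) x ≤ x + 1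

/-- potential -/
def pot : ℕ → RL n → ℕ
  | _, [] => 0
  | k, X :: L => (k + 1) * val X + pot (k + 1) L

lemma pot_append (k : ℕ) (L M : RL n) : pot k (L ++ M) = pot k L + pot (k + L.length) M := by
  induction L generalizing k with
  | nil => simp [pot]
  | cons X L ih => simp only [List.cons_append, pot, ih, List.length_cons]; rw [show k + 1 + L.length = k + (L.length + 1) by omega, add_assoc]

/-- measure of shapes -/
def ms : ℕ → List ℕ → ℕ
  | _, [] => 0
  | k, a :: l => k * a + ms (k + 1) l

lemma ms_append (k : ℕ) (L M : List ℕ) : ms k (L ++ M) = ms k L + ms (k + L.length) M := by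
  induction L generalizing k with
  | nil => simp [ms]
  | cons X L ih => simp only [List.cons_append, ms, ih, List.length_cons]; rw [show k + 1 + L.length = k + (L.length + 1) by omega, add_assoc]

lemma val_union_inter (X Y : Finset (Fin n)) : val (X ∪ Y) + val (X ∩ Y) = val X + val Y := sum_union_inter

lemma row_step {φ : Module.End R (TT R n)} (hφ : φ ∈ CB θ) (pre suf : RL n) (X Y : Finset (Fin n)) (y : FW R n)
    (x : Fin n) (hx : cnt X x < cnt Y x)
    (hk : ∀ A B : Finset (Fin n), A.card + B.card = X.card + Y.card → B.card < Y.card →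
      φ (J θ (pre ++ A :: B :: suf) ⊗ₜ y) = 0) :
    φ (J θ (pre ++ X :: Y :: suf) ⊗ₜ y) ∈ Submodule.span R {v | ∃ M, shp M = shp (pre ++ X :: Y :: suf) ∧
      pot 0 M < pot 0 (pre ++ X :: Y :: suf) ∧ v = φ (J θ M ⊗ₜ y)} := by
  have := SR θ (fun X' Y' => φ (J θ (pre ++ X' :: Y' :: suf) ⊗ₜ y)) X Y x hx (by
    intro A B h1 h2 h3
    apply GR θ hφ
    apply hk A B _ h3
    rw [← card_union_add_card_inter A B, h1, h2, card_union_add_card_inter])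
  refine Submodule.span_mono ?_ this
  rintro v ⟨X', Y', h1, h2, h3, h4, rfl⟩
  have hc : X'.card = X.card := by
    have := card_union_add_card_inter X' Y'
    rw [h1, h2, card_union_add_card_inter] at this
    omega
  have hv := val_union_inter X' Y'
  rw [h1, h2, val_union_inter] at hv
  refine ⟨_, ?_, ?_, rfl⟩
  · simp [hc, h3]
  · rw [pot_append, pot_append]
    simp only [pot]
    have : ∀ k : ℕ, (k + 1) * val X' + (k + 1 + 1) * val Y' = (k + 1) * (val X' + val Y') + val Y' := by
      intro k; ring
    have h5 : ∀ k : ℕ, (k + 1) * val X + (k + 1 + 1) * val Y = (k + 1) * (val X + val Y) + val Y := by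
      intro k; ring
    have e1 := this (0 + pre.length)
    have e2 := h5 (0 + pre.length)
    rw [← hv] at e1
    omega

lemma inv_self (T : Finset (Fin n)) : 2 * inv T T + T.card = T.card * T.card := by
  have h1 : inv T T = ∑ v ∈ T, dn T v := inv_eq_dn T T
  have h2 : inv T T = ∑ v ∈ T, up T v := rfl
  have h3 : ∑ v ∈ T, (up T v + dn T v + 1) = ∑ v ∈ T, T.card := by
    apply sum_congr rfl; intro v hv
    unfold up dn
    have : T = T.filter (v < ·) ∪ T.filter (· < v) ∪ {v} := by
      ext a; simp only [mem_union, mem_filter, mem_singleton]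
      constructor
      · intro ha; rcases lt_trichotomy a v with h | h | h <;> tauto
      · rintro ((h | h) | h); exacts [h.1, h.1, h ▸ hv]
    conv_rhs => rw [this]
    rw [card_union_of_disjoint, card_union_of_disjoint, card_singleton]
    · rw [disjoint_left]; intro a ha hb; simp at ha hb; exact lt_asymm ha.2 hb.2
    · rw [disjoint_left]; intro a ha hb; simp at ha hb; subst hb; simp at ha
  rw [sum_add_distrib, sum_add_distrib] at h3
  simp only [sum_const, smul_eq_mul, mul_one] at h3
  omega

lemma wall_exp {A T : Finset (Fin n)} (hT : T ⊆ A) :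
    sm T + inv T Aᶜ = T.card * (n - A.card) + inv (A \ T) T + inv T T := by
  have h1 : inv T Aᶜ = ∑ v ∈ T, up Aᶜ v := rfl
  rw [inv_eq_dn (A \ T) T, inv_eq_dn T T, add_assoc, ← sum_add_distrib, h1, sm, ← sum_add_distrib,
    ← smul_eq_mul, ← sum_const, ← sum_add_distrib]
  apply sum_congr rfl; intro v hv
  have hA : A.card ≤ n := by simpa using card_le_univ A
  have e1 : dn (A \ T) v + dn T v = dn A v := by
    unfold dn; rw [← card_union_of_disjoint, ← filter_union, sdiff_union_of_subset hT]
    apply disjoint_filter_filter; exact sdiff_disjoint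
  have e2 : up Aᶜ v + up A v = n - 1 - v := by
    unfold up; rw [← card_union_of_disjoint, ← filter_union, union_comm, union_compl]
    · have : univ.filter (v < ·) = Finset.Ioi v := by ext; simp
      rw [this]; simp
    · apply disjoint_filter_filter; exact disjoint_compl_left
  have e3 : up A v + dn A v + 1 = A.card := by
    unfold up dn
    have : A = A.filter (v < ·) ∪ A.filter (· < v) ∪ {v} := by
      ext a; simp only [mem_union, mem_filter, mem_singleton]
      constructor
      · intro ha; rcases lt_trichotomy a v with h | h | h <;> tauto
      · rintro ((h | h) | h); exacts [h.1, h.1, h ▸ hT hv]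
    conv_rhs => rw [this]
    rw [card_union_of_disjoint, card_union_of_disjoint, card_singleton]
    · rw [disjoint_left]; intro a ha hb; simp at ha hb; exact lt_asymm ha.2 hb.2
    · rw [disjoint_left]; intro a ha hb; simp at ha hb; subst hb; simp at ha
  have := v.2
  omega

lemma cnt_compl (Y : Finset (Fin n)) (x : Fin n) : cnt Yᶜ x + cnt Y x = x + 1 := by
  unfold cnt; rw [← card_union_of_disjoint, ← filter_union, union_comm, union_compl]
  · have : univ.filter (· ≤ x) = Finset.Iic x := by ext; simp
    rw [this]; simp
  · apply disjoint_filter_filter; exact disjoint_compl_left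

lemma val_compl (Y : Finset (Fin n)) : val Yᶜ + val Y = val (univ : Finset (Fin n)) := sum_compl_add_sum _ _

lemma wall_step {φ : Module.End R (TT R n)} (hφ : φ ∈ CB θ) (hio : φ * io θ = 0) (xs ys : RL n)
    (X Y : Finset (Fin n)) (x : Fin n) (hx : (x : ℕ) + 1 < cnt X x + cnt Y x) :
    φ (J θ (X :: xs) ⊗ₜ J θ (Y :: ys)) ∈ Submodule.span R {v | ∃ X' Y', X'.card = X.card ∧ Y'.card = Y.card ∧
      val X' < val X ∧ val Y' < val Y ∧ v = φ (J θ (X' :: xs) ⊗ₜ J θ (Y' :: ys))} := by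
  have := SR θ (fun Z' X' => φ (J θ (X' :: xs) ⊗ₜ J θ (Z'ᶜ :: ys))) Yᶜ X x
    (by have := cnt_compl Y x; unfold cnt at *; omega) (by
    intro A B h1 h2 h3
    have h := WR θ hφ hio (t := X.card - B.card) (by omega) B Aᶜ xs ys
    have hU : (univ \ Aᶜ : Finset (Fin n)) = A := by ext; simp
    rw [hU] at h
    have hu : IsUnit ((θ : R) ^ ((X.card - B.card) * (n - A.card) +
      ((X.card - B.card) * (X.card - B.card) - (X.card - B.card)) / 2)) := (Units.isUnit θ).pow _
    rw [← hu.smul_eq_zero, ← h, smul_sum]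
    apply sum_congr rfl; intro T hT
    rw [mem_powersetCard] at hT
    have hTA : T ⊆ A := hT.1.trans sdiff_subset
    rw [smul_smul, ← pow_add]
    have e := wall_exp hTA
    have e' := inv_self T
    rw [hT.2] at e e'
    have e2 : (A \ T)ᶜ = T ∪ Aᶜ := by ext a; simp only [mem_compl, mem_sdiff, mem_union]; tauto
    have e3 : (X.card - B.card) * (X.card - B.card) - (X.card - B.card) = 2 * inv T T := by omega
    rw [e2, union_comm B T, e3, Nat.mul_div_cancel_left _ two_pos]
    congr 2; omega)
  rw [compl_compl] at this
  refine Submodule.span_mono ?_ this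
  rintro v ⟨Z', X', h1, h2, h3, h4, rfl⟩
  have hc := card_union_add_card_inter Z' X'
  rw [h1, h2, card_union_add_card_inter] at hc
  have hv := val_union_inter Z' X'
  rw [h1, h2, val_union_inter] at hv
  have v1 := val_compl Y
  have v2 := val_compl Z'
  have c1 := card_compl Y
  have c2 := card_compl Z'
  have c3 := card_le_univ Y
  have c4 := card_le_univ Z'
  refine ⟨X', Z'ᶜ, h3, by omega, h4, by omega, rfl⟩

lemma row_step' {φ : Module.End R (TT R n)} (hφ : φ ∈ CB θ) (pre suf : RL n) (X Y : Finset (Fin n)) (y : FW R n)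
    (x : Fin n) (hx : cnt X x < cnt Y x)
    (hk : ∀ A B : Finset (Fin n), A.card + B.card = X.card + Y.card → B.card < Y.card →
      φ (y ⊗ₜ J θ (pre ++ A :: B :: suf)) = 0) :
    φ (y ⊗ₜ J θ (pre ++ X :: Y :: suf)) ∈ Submodule.span R {v | ∃ M, shp M = shp (pre ++ X :: Y :: suf) ∧
      pot 0 M < pot 0 (pre ++ X :: Y :: suf) ∧ v = φ (y ⊗ₜ J θ M)} := by
  have h := row_step θ (CB_cm θ hφ) pre suf X Y y x hx (by
    intro A B h1 h2
    simp only [Module.End.mul_apply, cm_tmul, hk A B h1 h2, map_zero])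
  have hc : ∀ x : TT R n, cm (cm x) = x := fun x => LinearMap.congr_fun cm_cm x
  have h2 := Submodule.mem_map_of_mem (f := cm) h
  rw [Submodule.map_span] at h2
  simp only [Module.End.mul_apply, cm_tmul, hc] at h2
  refine Submodule.span_mono ?_ h2
  rintro v ⟨w, ⟨M, h3, h4, rfl⟩, rfl⟩
  exact ⟨M, h3, h4, hc _⟩

lemma not_rowStd {L : RL n} (h : ¬ RowStd L) : ∃ pre X Y suf x, L = pre ++ X :: Y :: suf ∧ cnt X x < cnt Y x := by
  unfold RowStd at h
  rw [List.isChain_iff_forall_rel_of_append_cons_cons] at h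
  push Not at h
  obtain ⟨a, b, l1, l2, h1, x, h2⟩ := h
  exact ⟨l1, a, b, l2, x, h1, h2⟩

theorem straighten {φ : Module.End R (TT R n)} (hφ : φ ∈ CB θ) (hio : φ * io θ = 0) (l l' : List ℕ)
    (hk : ∀ M M' : RL n, M.length = l.length → M'.length = l'.length → (shp M).sum = l.sum →
      (shp M').sum = l'.sum → ms 0 (shp M) + ms 0 (shp M') < ms 0 l + ms 0 l' →
      φ (J θ M ⊗ₜ J θ M') = 0) (L L' : RL n) (hL : shp L = l) (hL' : shp L' = l') :
    φ (J θ L ⊗ₜ J θ L') ∈ Submodule.span R {v | ∃ M M', shp M = l ∧ shp M' = l' ∧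
      Std M M' ∧ v = φ (J θ M ⊗ₜ J θ M')} := by
  induction hN : pot 0 L + pot 0 L' using Nat.strong_induction_on generalizing L L' with
  | _ N ih =>
  by_cases h1 : RowStd L
  swap
  · obtain ⟨pre, X, Y, suf, x, rfl, hx⟩ := not_rowStd h1
    have := row_step θ hφ pre suf X Y (J θ L') x hx (by
      intro A B hc hlt
      subst hL; subst hL'
      apply hk
      · simp
      · simp
      · simp; omega
      · simp
      · rw [shp_append, shp_append, ms_append, ms_append]
        simp only [shp_cons, ms]
        have e1 : ∀ k a b : ℕ, k * a + (k + 1) * b = k * (a + b) + b := by intros; ring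
        have e2 := e1 (0 + (shp pre).length) A.card B.card
        have e3 := e1 (0 + (shp pre).length) X.card Y.card
        rw [hc] at e2
        omega)
    refine Submodule.span_le.2 ?_ this
    rintro v ⟨M, h3, h4, rfl⟩
    exact ih _ (by rw [← hN]; omega) M L' (h3.trans hL) hL' rfl
  by_cases h2 : RowStd L'
  swap
  · obtain ⟨pre, X, Y, suf, x, rfl, hx⟩ := not_rowStd h2
    have := row_step' θ hφ pre suf X Y (J θ L) x hx (by
      intro A B hc hlt
      subst hL; subst hL'
      apply hk
      · simp
      · simp
      · simp
      · simp; omega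
      · rw [shp_append, shp_append, ms_append, ms_append]
        simp only [shp_cons, ms]
        have e1 : ∀ k a b : ℕ, k * a + (k + 1) * b = k * (a + b) + b := by intros; ring
        have e2 := e1 (0 + (shp pre).length) A.card B.card
        have e3 := e1 (0 + (shp pre).length) X.card Y.card
        rw [hc] at e2
        omega)
    refine Submodule.span_le.2 ?_ this
    rintro v ⟨M, h3, h4, rfl⟩
    exact ih _ (by rw [← hN]; omega) L M hL (h3.trans hL') rfl
  by_cases h3 : Std L L'
  · exact Submodule.subset_span ⟨L, L', hL, hL', h3, rfl⟩
  · have h4 : ∃ x : Fin n, (x : ℕ) + 1 < cnt (L.headD ∅) x + cnt (L'.headD ∅) x := by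
      by_contra hc; push Not at hc; exact h3 ⟨h1, h2, hc⟩
    obtain ⟨x, hx⟩ := h4
    have hb : ∀ X : Finset (Fin n), cnt X x ≤ x + 1 := fun X => by have := cnt_compl X x; omega
    have h0 : cnt (∅ : Finset (Fin n)) x = 0 := by simp [cnt]
    match L, L' with
    | [], L' => have := hb (L'.headD ∅); simp only [List.headD_nil, List.headD_cons, h0] at hx; omega
    | X :: xs, [] => have := hb X; simp only [List.headD_nil, List.headD_cons, h0] at hx; omega
    | X :: xs, Y :: ys =>
      have := wall_step θ hφ hio xs ys X Y x hx
      refine Submodule.span_le.2 ?_ this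
      rintro v ⟨X', Y', h5, h6, h7, h8, rfl⟩
      refine ih _ ?_ (X' :: xs) (Y' :: ys) (by simpa [h5] using hL) (by simpa [h6] using hL') rfl
      rw [← hN]; simp only [pot]; omega

/-- lists of rows with `r` rows and `r` entries -/
def Sz (r : ℕ) (L : RL n) : Prop := L.length = r ∧ (shp L).sum = r

lemma adj_YY (l : List ℕ) : Adj (YY (n := n) θ l) (YY θ l) := by
  intro x y
  rw [YY, LinearMap.comp_apply, LinearMap.comp_apply, (adj_PP θ l).symm, adj_PP]

lemma J_singles (u : W n) : J θ (u.map fun a => {a}) = (bs u : FW R n) := by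
  induction u with
  | nil => rfl
  | cons a u ih => simp [J, ih, Jr, up, filter_singleton]

lemma coef {φ : Module.End R (TT R n)} (hφ : φ ∈ CB θ) (S S' T T' : RL n)
    (h : shp S = shp T) (h' : shp S' = shp T') :
    dt (φ (J θ S ⊗ₜ J θ S')) (bs (wd θ T) ⊗ₜ bs (wd θ T')) =
      dt (φ (bs (wd θ S) ⊗ₜ bs (wd θ S'))) (J θ T ⊗ₜ J θ T') := by
  have h1 : (J θ S ⊗ₜ J θ S' : TT R n) = (lx (YY θ (shp S)) * ly (YY θ (shp S')) : Module.End R (TT R n)) (bs (wd θ S) ⊗ₜ bs (wd θ S')) := by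
    simp [YY_wd]
  have h2 : (lx (YY θ (shp S)) * ly (YY θ (shp S'))) * φ = φ * (lx (YY θ (shp S)) * ly (YY θ (shp S'))) := by
    rw [mul_assoc, CB_ly θ hφ (YY_mem θ _), ← mul_assoc, CB_lx θ hφ (YY_mem θ _), mul_assoc]
  rw [h1, ← Module.End.mul_apply, ← h2, Module.End.mul_apply, Module.End.mul_apply,
    (AdjT.lx (adj_YY θ (shp S))), (AdjT.ly (adj_YY θ (shp S'))), h, h']
  simp [YY_wd]

lemma YY_sum (l : List ℕ) (x : FW R n) : YY θ l x = ∑ T ∈ rlOf n l, dot x (J θ T) • J θ T := by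
  rw [YY, LinearMap.comp_apply, ← PP_sum, map_sum]
  apply sum_congr rfl; intro T hT
  rw [map_smul, Js_bs, if_pos (mem_rlOf.1 hT), PP_apply, if_pos (mem_rlOf.1 hT)]

lemma YYT_sum (l l' : List ℕ) (z : TT R n) : (lx (YY θ l) * ly (YY θ l') : Module.End R (TT R n)) z =
    ∑ T ∈ rlOf n l, ∑ T' ∈ rlOf n l', dt z (J θ T ⊗ₜ J θ T') • (J θ T ⊗ₜ[R] J θ T') := by
  induction z using TensorProduct.induction_on with
  | zero => simp
  | tmul x y =>
    rw [Module.End.mul_apply, ly_tmul, lx_tmul, YY_sum, YY_sum]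
    simp only [sum_tmul, tmul_sum, dt_tmul, smul_tmul_smul]
    exact sum_comm
  | add z z' hz hz' => rw [map_add, hz, hz']; simp only [map_add, LinearMap.add_apply, add_smul, sum_add_distrib]

lemma inj_aux {φ φ' : Module.End R (TT R n)} (hφ : φ ∈ CB θ) (hφ' : φ' ∈ CB θ) (hadj : AdjT φ φ')
    (hio : φ * io θ = 0) (hio' : φ' * io θ = 0) (l l' : List ℕ)
    (hk : ∀ M M' : RL n, M.length = l.length → M'.length = l'.length → (shp M).sum = l.sum →
      (shp M').sum = l'.sum → ms 0 (shp M) + ms 0 (shp M') < ms 0 l + ms 0 l' →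
      φ (J θ M ⊗ₜ J θ M') = 0 ∧ φ' (J θ M ⊗ₜ J θ M') = 0)
    (ha : ∀ S S' T T' : RL n, shp S = l → shp S' = l' → shp T = l → shp T' = l' → Std S S' → Std T T' →
      dt (φ (bs (wd θ S) ⊗ₜ bs (wd θ S'))) (J θ T ⊗ₜ J θ T') = 0)
    (L L' : RL n) (hL : shp L = l) (hL' : shp L' = l') : φ (J θ L ⊗ₜ J θ L') = 0 := by
  have h := straighten θ hφ hio l l' (fun M M' h1 h2 h3 h4 h5 => (hk M M' h1 h2 h3 h4 h5).1) L L' hL hL'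
  rw [← Submodule.mem_bot R]
  refine Submodule.span_le.2 ?_ h
  rintro v ⟨S, S', h1, h2, h3, rfl⟩
  rw [SetLike.mem_coe, Submodule.mem_bot]
  have e1 : (J θ S ⊗ₜ J θ S' : TT R n) = (lx (YY θ l) * ly (YY θ l') : Module.End R (TT R n)) (bs (wd θ S) ⊗ₜ bs (wd θ S')) := by
    rw [← h1, ← h2]; simp [YY_wd]
  have e2 : (lx (YY θ l) * ly (YY θ l')) * φ = φ * (lx (YY θ l) * ly (YY θ l')) := by
    rw [mul_assoc, CB_ly θ hφ (YY_mem θ _), ← mul_assoc, CB_lx θ hφ (YY_mem θ _), mul_assoc]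
  rw [e1, ← Module.End.mul_apply, ← e2, Module.End.mul_apply, YYT_sum]
  apply sum_eq_zero; intro T hT; apply sum_eq_zero; intro T' hT'
  rw [mem_rlOf] at hT hT'
  have h4 := straighten θ hφ' hio' l l' (fun M M' h1 h2 h3 h4 h5 => (hk M M' h1 h2 h3 h4 h5).2) T T' hT hT'
  rw [hadj]
  have h5 : Submodule.span R {v | ∃ M M', shp M = l ∧ shp M' = l' ∧ Std M M' ∧ v = φ' (J θ M ⊗ₜ J θ M')} ≤
      LinearMap.ker (dt (bs (wd θ S) ⊗ₜ bs (wd θ S') : TT R n)) := by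
    rw [Submodule.span_le]
    rintro v ⟨M, M', m1, m2, m3, rfl⟩
    rw [SetLike.mem_coe, LinearMap.mem_ker, ← hadj]
    exact ha S S' M M' h1 h2 m1 m2 h3 m3
  rw [LinearMap.mem_ker.1 (h5 h4), zero_smul]

theorem inj_lev {r s : ℕ} {φ φ' : Module.End R (TT R n)} (hφ : φ ∈ CR θ r s) (hφ' : φ' ∈ CR θ r s)
    (hadj : AdjT φ φ') (hio : φ * io θ = 0) (hio' : φ' * io θ = 0)
    (ha : ∀ S S' T T' : RL n, Sz r S → Sz s S' → shp T = shp S → shp T' = shp S' → Std S S' → Std T T' →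
      dt (φ (bs (wd θ S) ⊗ₜ bs (wd θ S'))) (J θ T ⊗ₜ J θ T') = 0) : φ = 0 := by
  have key : ∀ (N : ℕ) (L L' : RL n), ms 0 (shp L) + ms 0 (shp L') = N → Sz r L → Sz s L' →
      φ (J θ L ⊗ₜ J θ L') = 0 ∧ φ' (J θ L ⊗ₜ J θ L') = 0 := by
    intro N
    induction N using Nat.strong_induction_on with
    | _ N ih =>
    intro L L' hN hL hL'
    have hk : ∀ M M' : RL n, M.length = (shp L).length → M'.length = (shp L').length → (shp M).sum = (shp L).sum →
      (shp M').sum = (shp L').sum → ms 0 (shp M) + ms 0 (shp M') < ms 0 (shp L) + ms 0 (shp L') →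
      φ (J θ M ⊗ₜ J θ M') = 0 ∧ φ' (J θ M ⊗ₜ J θ M') = 0 := by
      intro M M' h1 h2 h3 h4 h5
      exact ih _ (hN ▸ h5) M M' rfl ⟨by rw [h1, shp_length, hL.1], by rw [h3, hL.2]⟩
        ⟨by rw [h2, shp_length, hL'.1], by rw [h4, hL'.2]⟩
    have hsz : ∀ S : RL n, shp S = shp L → Sz r S := fun S hS =>
      ⟨by rw [← shp_length, hS, shp_length, hL.1], by rw [hS, hL.2]⟩
    have hsz' : ∀ S : RL n, shp S = shp L' → Sz s S := fun S hS =>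
      ⟨by rw [← shp_length, hS, shp_length, hL'.1], by rw [hS, hL'.2]⟩
    constructor
    · refine inj_aux θ hφ.1 hφ'.1 hadj hio hio' _ _ hk ?_ L L' rfl rfl
      intro S S' T T' h1 h2 h3 h4 h5 h6
      exact ha S S' T T' (hsz S h1) (hsz' S' h2) (h3.trans h1.symm) (h4.trans h2.symm) h5 h6
    · refine inj_aux θ hφ'.1 hφ.1 hadj.symm hio' hio _ _ (fun M M' a b c d e => (hk M M' a b c d e).symm) ?_ L L' rfl rfl
      intro S S' T T' h1 h2 h3 h4 h5 h6
      rw [hadj.symm, dt_comm, coef θ hφ.1 _ _ _ _ (h3.trans h1.symm) (h4.trans h2.symm)]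
      exact ha T T' S S' (hsz T h3) (hsz' T' h4) (h1.trans h3.symm) (h2.trans h4.symm) h6 h5
  apply ext_tt; intro u v
  rw [← hφ.2, Module.End.mul_apply, prs_bs]
  split_ifs with h
  · rw [← J_singles θ u, ← J_singles θ v]
    have hs : ∀ w : W n, (shp (w.map fun a => {a})) = List.replicate w.length 1 := by
      intro w; induction w with
      | nil => rfl
      | cons a w ih => simp [List.replicate_succ, ← ih]
    exact (key _ _ _ rfl ⟨by simpa using h.1, by rw [hs]; simpa using h.1⟩ ⟨by simpa using h.2, by rw [hs]; simpa using h.2⟩).1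
  · simp

theorem inj_main [NeZero n] (r s : ℕ) (φ : Module.End R (TT R n)) (hφ : φ ∈ CR θ r s)
    (ha : ∀ k, k ≤ min r s → ∀ S S' T T' : RL n, Sz (r - k) S → Sz (s - k) S' → shp T = shp S → shp T' = shp S' →
      Std S S' → Std T T' →
      dt (((Phi θ)^[k] φ) (bs (wd θ S) ⊗ₜ bs (wd θ S'))) (J θ T ⊗ₜ J θ T') = 0) : φ = 0 := by
  induction r generalizing s φ with
  | zero =>
    obtain ⟨φ', hφ', hadj⟩ := exists_adj θ hφ
    exact inj_lev θ hφ hφ' hadj (io_CR0 θ (Or.inl rfl) hφ) (io_CR0 θ (Or.inl rfl) hφ') (ha 0 (Nat.zero_le _))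
  | succ r ih =>
    obtain ⟨φ', hφ', hadj⟩ := exists_adj θ hφ
    cases s with
    | zero =>
      exact inj_lev θ hφ hφ' hadj (io_CR0 θ (Or.inr rfl) hφ) (io_CR0 θ (Or.inr rfl) hφ') (ha 0 (Nat.zero_le _))
    | succ s =>
      have h0 : Phi θ φ = 0 := by
        apply ih s _ (Phi_CR θ hφ)
        intro k hk S S' T T' h1 h2
        have := ha (k + 1) (by omega) S S' T T' (by rwa [Nat.add_sub_add_right]) (by rwa [Nat.add_sub_add_right])
        rwa [Function.iterate_succ_apply] at this
      refine inj_lev θ hφ hφ' hadj ?_ ?_ (ha 0 (Nat.zero_le _))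
      · rw [io_Phi θ hφ.1, h0, mul_zero]
      · have h1 : po θ * φ = 0 := by rw [po_Phi θ hφ.1, h0, zero_mul]
        have h2 := hadj.symm.mul (adj_io (n := n) θ)
        rw [h1] at h2
        apply h2.symm.unique
        intro x y; simp

end strn
end RS

namespace RS
open Finset TensorProduct

section qg
variable {R : Type*} [CommRing R] (θ : Rˣ) {n : ℕ}

/-- weight of a letter -/
def sg (a b c : Fin n) : ℤ := if c = a then 1 else if c = b then -1 else 0

/-- divided powers replacing letters `a` by `b`, on words -/
noncomputable def gEw (a b : Fin n) (z : Rˣ) (d : ℤ) : ℤ → W n → FW R n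
  | l, [] => if l = 0 then bs [] else 0
  | l, c :: u => (if c = a then cs b (gEw a b z d (l - 1) u) else 0) +
      ((z ^ ((l + d) * sg a b c) : Rˣ) : R) • cs c (gEw a b z d l u)

/-- divided powers replacing letters `a` by `b` -/
noncomputable def gE (a b : Fin n) (z : Rˣ) (d l : ℤ) : Module.End R (FW R n) := lc (gEw a b z d l)

lemma gE_nil (a b : Fin n) (z : Rˣ) (d l : ℤ) : gE a b z d l (bs []) = if l = 0 then bs [] else 0 := by
  simp [gE, gEw]

lemma gE_cs (a b : Fin n) (z : Rˣ) (d l : ℤ) (c : Fin n) (x : FW R n) : gE a b z d l (cs c x) =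
    (if c = a then cs b (gE a b z d (l - 1) x) else 0) +
      ((z ^ ((l + d) * sg a b c) : Rˣ) : R) • cs c (gE a b z d l x) := by
  have : gE a b z d l * cs c = (if c = a then cs b * (gE a b z d (l - 1)) else 0) +
      ((z ^ ((l + d) * sg a b c) : Rˣ) : R) • (cs c * gE a b z d l) := by
    apply ext_bs; intro u
    by_cases h : c = a <;> simp [gE, gEw, h]
  have h2 := LinearMap.congr_fun this x
  by_cases h : c = a <;> simpa [h] using h2

lemma gE_neg (a b : Fin n) (z : Rˣ) (d : ℤ) {l : ℤ} (hl : l < 0) : gE a b z d l = 0 := by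
  apply ext_bs; intro u
  induction u generalizing l with
  | nil => rw [gE_nil, if_neg hl.ne]; rfl
  | cons c u ih =>
    rw [← cs_bs, gE_cs, ih hl, ih (by omega)]; simp

/-- adjacency of letters with the corresponding scalar -/
def Ad (a b : Fin n) (z : Rˣ) : Prop :=
  (a.val = b.val + 1 ∧ z = -θ) ∨ (b.val = a.val + 1 ∧ z = -θ⁻¹)

lemma S0_cs (a b : Fin n) (x : FW R n) : S0 θ (cs a (cs b x)) =
    if a = b then (-((θ⁻¹ : Rˣ) : R)) • cs a (cs b x)
      else if b < a then cs b (cs a x)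
      else cs b (cs a x) + ((θ : R) - ((θ⁻¹ : Rˣ) : R)) • cs a (cs b x) := by
  have : S0 θ * (cs a * cs b) = (if a = b then (-((θ⁻¹ : Rˣ) : R)) • (cs a * cs b)
      else if b < a then cs b * cs a
      else cs b * cs a + ((θ : R) - ((θ⁻¹ : Rˣ) : R)) • (cs a * cs b) : Module.End R (FW R n)) := by
    apply ext_bs; intro u
    simp only [Module.End.mul_apply, cs_bs, S0_cons]
    split_ifs <;> simp
  have h := LinearMap.congr_fun this x
  simp only [Module.End.mul_apply] at h
  rw [h]
  split_ifs <;> simp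

lemma gE_S0_aux {a b : Fin n} {z : Rˣ} (h : Ad θ a b z) (d l : ℤ) (c c' : Fin n) (x : FW R n) :
    S0 θ (gE a b z d l (cs c (cs c' x))) = gE a b z d l (S0 θ (cs c (cs c' x))) := by
  have e0 : ((θ : Rˣ) : R) * ((θ⁻¹ : Rˣ) : R) = 1 := by simp
  have e1 : ((z ^ (l + d) : Rˣ) : R) * ((z ^ (-(l + d)) : Rˣ) : R) = 1 := by
    rw [← Units.val_mul, ← zpow_add]; simp
  have e2 : ((z ^ (l - 1 + d) : Rˣ) : R) = ((z ^ (l + d) : Rˣ) : R) * ((z⁻¹ : Rˣ) : R) := by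
    rw [← Units.val_mul, ← zpow_neg_one, ← zpow_add]; congr 2; ring
  have e3 : ((z ^ (-(l - 1 + d)) : Rˣ) : R) = ((z ^ (-(l + d)) : Rˣ) : R) * ((z : Rˣ) : R) := by
    rw [← Units.val_mul, ← zpow_add_one]; congr 2; ring
  have f1 : sg a b a = 1 := by simp [sg]
  have hab : a ≠ b := by rintro rfl; rcases h with h | h <;> omega
  have f2 : sg a b b = -1 := by simp [sg, hab.symm]
  have f3 : ∀ e, e ≠ a → e ≠ b → sg a b e = 0 := by intro e h h'; simp [sg, h, h']
  have ho : ∀ e : Fin n, e ≠ a → e ≠ b → (e < a ↔ e < b) ∧ (a < e ↔ b < e) := by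
    intro e h1 h2
    simp only [Fin.lt_def, Ne, Fin.ext_iff] at *
    rcases h with h | h <;> constructor <;> omega
  have hz : (b < a ∧ ¬ a < b ∧ (z : R) = -θ ∧ ((z⁻¹ : Rˣ) : R) = - ((θ⁻¹ : Rˣ) : R)) ∨
      (¬ b < a ∧ a < b ∧ (z : R) = -((θ⁻¹ : Rˣ) : R) ∧ ((z⁻¹ : Rˣ) : R) = - θ) := by
    rcases h with ⟨h, rfl⟩ | ⟨h, rfl⟩
    · left; refine ⟨Fin.lt_def.2 (by omega), by rw [Fin.lt_def]; omega, by simp, by simp⟩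
    · right; refine ⟨by rw [Fin.lt_def]; omega, Fin.lt_def.2 (by omega), by simp, by simp⟩
  clear h
  rcases hz with ⟨h1, h2, h3, h4⟩ | ⟨h1, h2, h3, h4⟩
  all_goals
    by_cases k1 : c = a
    · subst k1
      by_cases k2 : c' = c
      · subst k2
        simp only [gE_cs, S0_cs, map_add, map_smul, f1, f2, if_true, hab, hab.symm, if_false, mul_one, mul_neg, e2, e3, smul_add, h1, h2, h3, h4]
        match_scalars <;> grind
      · by_cases k3 : c' = b
        · subst k3
          simp only [gE_cs, S0_cs, map_add, map_smul, f1, f2, if_true, hab, hab.symm, if_false, mul_one, mul_neg, e2, e3, smul_add, h1, h2, h3, h4, add_zero, zero_add, map_zero]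
          match_scalars <;> grind
        · have o := ho c' k2 k3
          have k2' := Ne.symm k2
          have k3' := Ne.symm k3
          rcases lt_or_gt_of_ne k2 with q | q
          · have q' := not_lt_of_gt q
            have w := o.1.1 q
            have w' := not_lt_of_gt w
            simp only [gE_cs, S0_cs, map_add, map_smul, f1, f2, f3 c' k2 k3, if_true, k2, k3, k2', k3', hab, hab.symm, if_false, mul_one, mul_neg, mul_zero, zpow_zero, Units.val_one, one_smul, e2, e3, smul_add, add_zero, zero_add, map_zero, smul_zero, q, q', w, w']
            try (match_scalars <;> grind)
          · have q' := not_lt_of_gt q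
            have w := o.2.1 q
            have w' := not_lt_of_gt w
            simp only [gE_cs, S0_cs, map_add, map_smul, f1, f2, f3 c' k2 k3, if_true, k2, k3, k2', k3', hab, hab.symm, if_false, mul_one, mul_neg, mul_zero, zpow_zero, Units.val_one, one_smul, e2, e3, smul_add, add_zero, zero_add, map_zero, smul_zero, q, q', w, w']
            try (match_scalars <;> grind)
    · have k1' := Ne.symm k1
      by_cases m1 : c = b
      · subst m1
        by_cases k2 : c' = a
        · subst k2
          simp only [gE_cs, S0_cs, map_add, map_smul, f1, f2, if_true, hab, hab.symm, if_false, mul_one, mul_neg, e2, e3, smul_add, h1, h2, h3, h4, add_zero, zero_add, map_zero]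
          match_scalars <;> grind
        · by_cases k3 : c' = c
          · subst k3
            simp only [gE_cs, S0_cs, map_add, map_smul, f1, f2, if_true, hab, hab.symm, if_false, mul_one, mul_neg, e2, e3, smul_add, h1, h2, h3, h4, add_zero, zero_add, map_zero]
            try (match_scalars <;> grind)
          · have k2' := Ne.symm k2
            have k3' := Ne.symm k3
            simp only [gE_cs, S0_cs, map_add, map_smul, f1, f2, f3 c' k2 k3, if_true, k2, k3, k2', k3', hab, hab.symm, if_false, mul_one, mul_neg, mul_zero, zpow_zero, Units.val_one, one_smul, e2, e3, smul_add, add_zero, zero_add, map_zero, smul_zero]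
            split_ifs <;> simp only [gE_cs, S0_cs, map_add, map_smul, f1, f2, f3 c' k2 k3, if_true, k2, k3, k2', k3', hab, hab.symm, if_false, mul_one, mul_neg, mul_zero, zpow_zero, Units.val_one, one_smul, e2, e3, smul_add, add_zero, zero_add, map_zero, smul_zero] <;> (try (match_scalars <;> grind))
      · have m1' := Ne.symm m1
        by_cases k2 : c' = a
        · subst k2
          have o := ho c k1 m1
          rcases lt_or_gt_of_ne k1 with q | q
          · have q' := not_lt_of_gt q
            have w := o.1.1 q
            have w' := not_lt_of_gt w
            simp only [gE_cs, S0_cs, map_add, map_smul, f1, f2, f3 c k1 m1, if_true, k1, k1', m1, m1', hab, hab.symm, if_false, mul_one, mul_neg, mul_zero, zpow_zero, Units.val_one, one_smul, e2, e3, smul_add, add_zero, zero_add, map_zero, smul_zero, q, q', w, w']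
            try (match_scalars <;> grind)
          · have q' := not_lt_of_gt q
            have w := o.2.1 q
            have w' := not_lt_of_gt w
            simp only [gE_cs, S0_cs, map_add, map_smul, f1, f2, f3 c k1 m1, if_true, k1, k1', m1, m1', hab, hab.symm, if_false, mul_one, mul_neg, mul_zero, zpow_zero, Units.val_one, one_smul, e2, e3, smul_add, add_zero, zero_add, map_zero, smul_zero, q, q', w, w']
            try (match_scalars <;> grind)
        · simp only [S0_cs]
          by_cases m2 : c' = b
          · subst m2
            split_ifs <;> simp only [gE_cs, S0_cs, map_add, map_smul, f1, f2, f3 c k1 m1, if_true, k1, k1', m1, m1', hab, hab.symm, if_false, mul_one, mul_neg, mul_zero, zpow_zero, Units.val_one, one_smul, e2, e3, smul_add, add_zero, zero_add, map_zero, smul_zero] <;> simp only [*, if_true, if_false] <;> (try (match_scalars <;> grind))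
          · split_ifs <;> simp only [gE_cs, S0_cs, map_add, map_smul, f3 c k1 m1, f3 c' k2 m2, k1, m1, k2, m2, if_true, if_false, mul_one, mul_neg, mul_zero, zpow_zero, Units.val_one, one_smul, smul_add, add_zero, zero_add, map_zero, smul_zero] <;> simp only [*, if_true, if_false] <;> (try (match_scalars <;> grind))

end qg
end RS

namespace RS
open Finset TensorProduct

section qg
variable {R : Type*} [CommRing R] (θ : Rˣ) {n : ℕ}

lemma gE_shift {A : Module.End R (FW R n)} (a b : Fin n) (z : Rˣ) (d l : ℤ)
    (h : ∀ l, A * gE a b z d l = gE a b z d l * A) : shift A * gE a b z d l = gE a b z d l * shift A := by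
  apply ext_bs; intro u
  cases u with
  | nil => simp only [Module.End.mul_apply, gE_nil, shift_bs_nil, map_zero]; split_ifs <;> simp
  | cons c u =>
    have h1 := fun l => LinearMap.congr_fun (h l) (bs u)
    simp only [Module.End.mul_apply] at h1
    rw [← cs_bs]
    simp only [Module.End.mul_apply, gE_cs, shift_cs, map_add, map_smul, ← h1]
    split_ifs <;> simp [shift_cs]

lemma gE_S0 {a b : Fin n} {z : Rˣ} (h : Ad θ a b z) (d l : ℤ) :
    S0 θ * gE a b z d l = gE a b z d l * S0 θ := by
  apply ext_bs; intro u
  match u with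
  | [] => simp only [Module.End.mul_apply, gE_nil, S0_nil, map_zero]; split_ifs <;> simp
  | [c] =>
    simp only [Module.End.mul_apply, S0_one, map_zero]
    rw [← cs_bs, gE_cs, gE_nil, gE_nil]
    split_ifs <;> simp
  | c :: c' :: u => 
    rw [← cs_bs, ← cs_bs]; exact gE_S0_aux θ h d l c c' (bs u)

lemma gE_SS {a b : Fin n} {z : Rˣ} (h : Ad θ a b z) (d l : ℤ) (t : ℕ) :
    SS θ t * gE a b z d l = gE a b z d l * SS θ t := by
  induction t generalizing l with
  | zero => exact gE_S0 θ h d l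
  | succ t ih => exact gE_shift a b z d l ih

lemma gE_pr (a b : Fin n) (z : Rˣ) (d l : ℤ) (t : ℕ) :
    pr t * gE a b z d l = gE a b z d l * pr t := by
  induction t generalizing l with
  | zero =>
    apply ext_bs; intro u
    cases u with
    | nil => simp only [Module.End.mul_apply, gE_nil, pr_bs]; split_ifs <;> simp_all [gE_nil]
    | cons c u =>
      have : ∀ c (x : FW R n), pr 0 (cs c x) = 0 := by
        intro c x
        have : pr 0 * cs c = (0 : Module.End R (FW R n)) := by
          apply ext_bs; intro u; simp
        exact LinearMap.congr_fun this x
      rw [← cs_bs, Module.End.mul_apply, gE_cs, Module.End.mul_apply, this]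
      split_ifs <;> simp [this]
  | succ t ih => rw [← shift_pr]; exact gE_shift a b z d l ih

lemma gE_adj {a b : Fin n} (hab : a ≠ b) (z : Rˣ) (d l : ℤ) : Adj (gE a b z d l) (gE b a z⁻¹ d l) := by
  apply Adj.of
  intro u v
  have hc : ∀ (c : Fin n) (x : FW R n) , cs c x [] = 0 := by
    intro c x
    have := adj_cs c x (bs ([] : W n))
    rw [dot_bs', un_bs_nil, map_zero] at this; exact this
  have hc' : ∀ (c e : Fin n) (x : FW R n) w, cs c x (e :: w) = if e = c then x w else 0 := by
    intro c e x w
    have := adj_cs c x (bs (e :: w))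
    rw [dot_bs', un_bs_cons] at this; rw [this]
    split_ifs <;> simp
  have hs : ∀ c, sg b a c = - sg a b c := by
    intro c; simp only [sg]; split_ifs <;> simp_all
  induction u generalizing v l with
  | nil => 
    cases v with
    | nil => simp [gE_nil]
    | cons e v =>
      rw [gE_nil, ← cs_bs e v, gE_cs]
      simp only [Finsupp.add_apply, Finsupp.smul_apply, hc, smul_zero, add_zero]
      split_ifs <;> simp [hc, bs_apply]
  | cons c u ih =>
    cases v with
    | nil =>
      rw [gE_nil, ← cs_bs c u, gE_cs]
      simp only [Finsupp.add_apply, Finsupp.smul_apply, hc, smul_zero, add_zero]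
      split_ifs <;> simp [hc, bs_apply]
    | cons e v =>
      rw [← cs_bs c u, ← cs_bs e v, gE_cs, gE_cs]
      simp only [Finsupp.add_apply, Finsupp.smul_apply, hc', hs, mul_neg, inv_zpow, zpow_neg, inv_inv]
      have e1 : (if c = a then cs b (gE a b z d (l - 1) (bs u)) else 0) (e :: v) =
          (if e = b then cs a (gE b a z⁻¹ d (l - 1) (bs v)) else 0) (c :: u) := by
        split_ifs <;> simp_all
      rw [e1]
      congr 1
      by_cases h : e = c
      · subst h; simp [ih]
      · simp [h, Ne.symm h]

end qg
end RS

namespace RS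
open Finset TensorProduct

section qg
variable {R : Type*} [CommRing R] (θ : Rˣ) {n : ℕ}

/-- weight of a row -/
def sgX (a b : Fin n) (X : Finset (Fin n)) : ℤ := (if a ∈ X then 1 else 0) - (if b ∈ X then 1 else 0)

lemma Jr_insert (m : ℕ) {c : Fin n} {X : Finset (Fin n)} (hc : c ∉ X) (x : FW R n) :
    Jr θ (m + 1) (insert c X) x = ((θ : R) ^ up X c) • cs c (Jr θ m X x) +
      ∑ e ∈ X, ((θ : R) ^ up (insert c X) e) • cs e (Jr θ m (insert c (X.erase e)) x) := by
  simp only [Jr, LinearMap.sum_apply, LinearMap.smul_apply, Module.End.mul_apply]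
  rw [sum_insert hc, up_insert_self, erase_insert hc]
  congr 1
  apply sum_congr rfl; intro e he
  rw [erase_insert_of_ne]; rintro rfl; exact hc he

lemma gE_Jr {a b : Fin n} {z : Rˣ} (h : Ad θ a b z) (d : ℤ) (m : ℕ) (X : Finset (Fin n)) (l : ℤ) (x : FW R n) :
    gE a b z d l (Jr θ m X x) =
      (if a ∈ X ∧ b ∉ X then Jr θ m (insert b (X.erase a)) (gE a b z d (l - 1) x) else 0) +
      ((z ^ ((l + d) * sgX a b X) : Rˣ) : R) • Jr θ m X (gE a b z d l x) := by
  have hab : a ≠ b := by rintro rfl; rcases h with h | h <;> omega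
  have hba := hab.symm
  have f1 : sg a b a = 1 := by simp [sg]
  have f2 : sg a b b = -1 := by simp [sg, hab.symm]
  have f3 : ∀ e, e ≠ a → e ≠ b → sg a b e = 0 := by intro e h h'; simp [sg, h, h']
  have ho : ∀ e : Fin n, e ≠ a → e ≠ b → ((a < e ↔ b < e) ∧ (e < a ↔ e < b)) := by
    intro e h1 h2
    simp only [Fin.lt_def, Ne, Fin.ext_iff] at *
    rcases h with h | h <;> constructor <;> omega
  induction m generalizing X l x with
  | zero =>
    by_cases hX : X = ∅
    · subst hX; simp [Jr, sgX]
    · have : insert b (X.erase a) ≠ ∅ := (insert_nonempty _ _).ne_empty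
      simp [Jr, hX, this]
  | succ m ih =>
    by_cases ha : a ∈ X
    · obtain ⟨X0, ha0, rfl⟩ : ∃ X0, a ∉ X0 ∧ X = insert a X0 := ⟨X.erase a, notMem_erase a X, (insert_erase ha).symm⟩
      by_cases hb : b ∈ X0
      · obtain ⟨X1, hb0, rfl⟩ : ∃ X1, b ∉ X1 ∧ X0 = insert b X1 := ⟨X0.erase b, notMem_erase b X0, (insert_erase hb).symm⟩
        rw [if_neg (by simp), zero_add, Jr_insert θ m ha0, Jr_insert θ m ha0, sum_insert hb0, sum_insert hb0]
        have ha1 : a ∉ X1 := fun h => ha0 (mem_insert_of_mem h)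
        have s0 : sgX a b (insert a (insert b X1)) = 0 := by simp [sgX]
        have s1 : sgX a b (insert b X1) = -1 := by simp [sgX, ha1, hab]
        have s2 : sgX a b (insert a X1) = 1 := by simp [sgX, hb0, hab.symm]
        rw [s0, mul_zero, zpow_zero, Units.val_one, one_smul, map_add, map_add, map_sum, map_smul, map_smul, gE_cs, gE_cs,
          erase_insert hb0, ih (insert b X1) (l - 1), ih (insert b X1) l, ih (insert a X1) l, f1, f2, if_pos rfl, if_neg hab.symm, s1, s2, if_neg (by simp), if_neg (by simp),
          if_pos (by simp [hb0, hab.symm]), erase_insert ha1]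
        have hsum : ∑ e ∈ X1, gE a b z d l (((θ : R) ^ up (insert a (insert b X1)) e) • cs e (Jr θ m (insert a ((insert b X1).erase e)) x)) =
            ∑ e ∈ X1, ((θ : R) ^ up (insert a (insert b X1)) e) • cs e (Jr θ m (insert a ((insert b X1).erase e)) (gE a b z d l x)) := by
          apply sum_congr rfl; intro e he
          have e1 : e ≠ a := by rintro rfl; exact ha1 he
          have e2 : e ≠ b := by rintro rfl; exact hb0 he
          have s3 : sgX a b (insert a ((insert b X1).erase e)) = 0 := by simp [sgX, e2.symm]
          rw [map_smul, gE_cs, if_neg e1, ih, f3 e e1 e2, s3, if_neg (by simp [e2.symm])]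
          simp
        rw [hsum]
        have e0 : ((θ : Rˣ) : R) * ((θ⁻¹ : Rˣ) : R) = 1 := by simp
        have e1 : ((z ^ (l + d) : Rˣ) : R) * ((z ^ (-(l + d)) : Rˣ) : R) = 1 := by
          rw [← Units.val_mul, ← zpow_add]; simp
        have e3 : ((z ^ (-(l - 1 + d)) : Rˣ) : R) = ((z ^ (-(l + d)) : Rˣ) : R) * ((z : Rˣ) : R) := by
          rw [← Units.val_mul, ← zpow_add_one]; congr 2; ring
        have u1 : up (insert b X1) a = up X1 a + if a < b then 1 else 0 := up_insert hb0 a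
        have u2 : up (insert a (insert b X1)) b = up X1 b + if b < a then 1 else 0 := by
          rw [up_insert ha0, up_insert_self]
        have u3 : up X1 a = up X1 b := by
          unfold up; congr 1; apply filter_congr; intro e he
          exact (ho e (by rintro rfl; exact ha1 he) (by rintro rfl; exact hb0 he)).1
        have key : ((θ : R) ^ up (insert b X1) a) * (z : R) + ((θ : R) ^ up (insert a (insert b X1)) b) = 0 := by
          rw [u1, u2, u3]
          rcases h with ⟨h, rfl⟩ | ⟨h, rfl⟩
          · rw [if_neg (by rw [Fin.lt_def]; omega), if_pos (by rw [Fin.lt_def]; omega)]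
            push_cast; ring
          · rw [if_pos (by rw [Fin.lt_def]; omega), if_neg (by rw [Fin.lt_def]; omega)]
            push_cast; linear_combination (-(θ : R) ^ up X1 b) * e0
        simp only [map_add, map_smul, mul_one, mul_neg, e3, zero_add, smul_add]
        match_scalars
        · linear_combination ((z ^ (-(l + d)) : Rˣ) : R) * key
        · linear_combination  ((θ : R) ^ up (insert b X1) a) * e1
        · linear_combination  ((θ : R) ^ up (insert a (insert b X1)) b) * e1
        · rfl
      · rw [if_pos (by simp [hb, hab.symm]), erase_insert ha0, Jr_insert θ m ha0, Jr_insert θ m ha0, Jr_insert θ m hb]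
        have s1 : sgX a b (insert a X0) = 1 := by simp [sgX, hb, hab.symm]
        have s2 : sgX a b X0 = 0 := by simp [sgX, hb, ha0]
        have u3 : up X0 a = up X0 b := by
          unfold up; congr 1; apply filter_congr; intro e he
          exact (ho e (by rintro rfl; exact ha0 he) (by rintro rfl; exact hb he)).1
        rw [s1, map_add, map_sum, map_smul, gE_cs, ih X0 (l - 1), ih X0 l, if_pos rfl, if_neg (by simp [ha0]), if_neg (by simp [ha0]), s2, f1]
        have hsum : ∑ e ∈ X0, gE a b z d l (((θ : R) ^ up (insert a X0) e) • cs e (Jr θ m (insert a (X0.erase e)) x)) =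
            ∑ e ∈ X0, ((θ : R) ^ up (insert b X0) e) • cs e (Jr θ m (insert b (X0.erase e)) (gE a b z d (l - 1) x)) +
            ((z ^ (l + d) : Rˣ) : R) • ∑ e ∈ X0, ((θ : R) ^ up (insert a X0) e) • cs e (Jr θ m (insert a (X0.erase e)) (gE a b z d l x)) := by
          rw [smul_sum, ← sum_add_distrib]
          apply sum_congr rfl; intro e he
          have e1 : e ≠ a := by rintro rfl; exact ha0 he
          have e2 : e ≠ b := by rintro rfl; exact hb he
          have s3 : sgX a b (insert a (X0.erase e)) = 1 := by simp [sgX, hb, hab.symm]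
          have u4 : up (insert b X0) e = up (insert a X0) e := by
            rw [up_insert hb, up_insert ha0]; simp only [(ho e e1 e2).2]
          rw [map_smul, gE_cs, if_neg e1, ih, f3 e e1 e2, s3, if_pos (by simp [hb, hab.symm]), u4, erase_insert (by simp [ha0])]
          simp only [mul_zero, zpow_zero, Units.val_one, one_smul, zero_add, map_add, map_smul, smul_add, mul_one]
          congr 1
          rw [smul_comm]
        rw [hsum, u3]
        simp only [mul_zero, zpow_zero, Units.val_one, one_smul, zero_add, mul_one, smul_add]
        module
    · have s1 : ∀ e ∈ X, e ≠ a → e ≠ b → sgX a b (X.erase e) = sgX a b X := by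
        intro e he h1 h2; simp [sgX, h1.symm, h2.symm]
      rw [if_neg (fun h => ha h.1), zero_add]
      simp only [Jr, LinearMap.sum_apply, LinearMap.smul_apply, Module.End.mul_apply, map_sum, smul_sum]
      apply sum_congr rfl; intro e he
      have e1 : e ≠ a := by rintro rfl; exact ha he
      rw [map_smul, gE_cs, if_neg e1, ih, if_neg (fun h => ha (mem_of_mem_erase h.1)), zero_add, zero_add, map_smul, smul_comm _ ((θ : R) ^ _)]
      congr 1
      rw [smul_smul]
      congr 1
      rw [← Units.val_mul, ← zpow_add, ← mul_add]
      congr 3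
      by_cases e2 : e = b
      · subst e2; rw [f2]; simp [sgX, ha, he]
      · rw [f3 e e1 e2, s1 e he e1 e2, zero_add]

end qg
end RS

namespace RS
open Finset TensorProduct

section qg
variable {R : Type*} [CommRing R] (θ : Rˣ) {n : ℕ}

/-- flip a row -/
def flr (a b : Fin n) (X : Finset (Fin n)) : Finset (Fin n) :=
  if a ∈ X ∧ b ∉ X then insert b (X.erase a) else X

lemma flr_card (a b : Fin n) (X : Finset (Fin n)) : (flr a b X).card = X.card := by
  unfold flr; split_ifs with h
  · rw [card_insert_of_notMem (fun h' => h.2 (mem_of_mem_erase h')), card_erase_of_mem h.1]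
    have := card_pos.2 ⟨a, h.1⟩; omega
  · rfl

lemma shp_flr (a b : Fin n) (L : RL n) : shp (L.map (flr a b)) = shp L := by
  simp [shp, flr_card]

/-- number of flippable rows -/
def fc (a b : Fin n) (L : RL n) : ℕ := (L.map fun X => if a ∈ X ∧ b ∉ X then 1 else 0).sum

lemma gE_J_span {a b : Fin n} {z : Rˣ} (h : Ad θ a b z) (d l : ℤ) (L : RL n) :
    gE a b z d l (J θ L) ∈ Submodule.span R {v | ∃ M, shp M = shp L ∧ v = J θ M} := by
  induction L generalizing l with
  | nil =>
    simp only [J, gE_nil]; split_ifs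
    · exact Submodule.subset_span ⟨[], rfl, rfl⟩
    · exact Submodule.zero_mem _
  | cons X L ih =>
    have key : ∀ Y : Finset (Fin n), Y.card = X.card → ∀ v ∈ Submodule.span R {v | ∃ M, shp M = shp L ∧ v = J θ M},
        Jr θ X.card Y v ∈ Submodule.span R {v | ∃ M, shp M = shp (X :: L) ∧ v = J θ M} := by
      intro Y hY v hv
      refine Submodule.span_le (p := (Submodule.span R {v | ∃ M, shp M = shp (X :: L) ∧ v = J θ M}).comap (Jr θ X.card Y)) |>.2 ?_ hv
      rintro v ⟨M, hM, rfl⟩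
      refine Submodule.subset_span ⟨Y :: M, by simp [hY, hM], ?_⟩
      simp [J, hY]
    simp only [J]
    rw [gE_Jr θ h]
    refine Submodule.add_mem _ ?_ (Submodule.smul_mem _ _ (key _ rfl _ (ih _)))
    split_ifs with hX
    · refine key _ ?_ _ (ih _)
      have := flr_card a b X
      rwa [flr, if_pos hX] at this
    · exact Submodule.zero_mem _

lemma gE_J_zero {a b : Fin n} {z : Rˣ} (h : Ad θ a b z) (d l : ℤ) (L : RL n) (hl : (fc a b L : ℤ) < l) :
    gE a b z d l (J θ L) = 0 := by
  induction L generalizing l with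
  | nil =>
    simp only [J, gE_nil]; rw [if_neg]; simp [fc] at hl; omega
  | cons X L ih =>
    simp only [J]
    have e : fc a b (X :: L) = (if a ∈ X ∧ b ∉ X then 1 else 0) + fc a b L := by simp [fc]
    rw [e] at hl
    rw [gE_Jr θ h]
    split_ifs with hX
    · rw [if_pos hX] at hl; push_cast at hl
      rw [ih _ (by omega), ih _ (by omega)]; simp
    · rw [if_neg hX] at hl; push_cast at hl
      rw [ih _ (by omega)]; simp

lemma gE_J_top {a b : Fin n} {z : Rˣ} (h : Ad θ a b z) (d : ℤ) (L : RL n) :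
    ∃ w : Rˣ, gE a b z d (fc a b L) (J θ L) = (w : R) • J θ (L.map (flr a b)) := by
  induction L with
  | nil => exact ⟨1, by simp [J, gE_nil, fc]⟩
  | cons X L ih =>
    obtain ⟨w, hw⟩ := ih
    have e : fc a b (X :: L) = (if a ∈ X ∧ b ∉ X then 1 else 0) + fc a b L := by simp [fc]
    have hc := flr_card a b X
    by_cases hX : a ∈ X ∧ b ∉ X
    · refine ⟨w, ?_⟩
      simp only [J, List.map_cons]
      have hz0 := gE_J_zero θ h d ((fc a b (X :: L) : ℕ) : ℤ) L (by rw [e, if_pos hX]; push_cast; omega)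
      rw [gE_Jr θ h, if_pos hX, hz0, map_zero, smul_zero, add_zero,
        e, if_pos hX]
      push_cast
      rw [add_sub_cancel_left, hw, map_smul, hc, flr, if_pos hX]
    · refine ⟨z ^ (((fc a b L : ℤ) + d) * sgX a b X) * w, ?_⟩
      simp only [J, List.map_cons]
      rw [gE_Jr θ h, if_neg hX, zero_add, e, if_neg hX, zero_add, hw, map_smul, hc, flr, if_neg hX, smul_smul, Units.val_mul]

lemma Ad.symm {a b : Fin n} {z : Rˣ} (h : Ad θ a b z) : Ad θ b a z⁻¹ := by
  rcases h with ⟨h, rfl⟩ | ⟨h, rfl⟩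
  · right; exact ⟨h, by simp⟩
  · left; exact ⟨h, by simp⟩

lemma Ad.ne {a b : Fin n} {z : Rˣ} (h : Ad θ a b z) : a ≠ b := by
  rintro rfl; rcases h with h | h <;> omega

/-- divided powers on mixed tensors -/
noncomputable def eT (a b : Fin n) (z : Rˣ) (l : ℕ) : Module.End R (TT R n) :=
  ∑ i ∈ range (l + 1), TensorProduct.map (gE a b z 0 i) (gE b a z⁻¹ (-l) (l - i))

lemma eT_tmul (a b : Fin n) (z : Rˣ) (l : ℕ) (x y : FW R n) : eT a b z l (x ⊗ₜ y) =
    ∑ i ∈ range (l + 1), gE a b z 0 i x ⊗ₜ[R] gE b a z⁻¹ (-l) (l - i) y := by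
  simp [eT, LinearMap.sum_apply]

lemma eT_lx {a b : Fin n} {z : Rˣ} (l : ℕ) {A : Module.End R (FW R n)}
    (h : ∀ i, A * gE a b z 0 i = gE a b z 0 i * A) : lx A * eT a b z l = eT a b z l * lx A := by
  rw [eT, mul_sum, sum_mul]; apply sum_congr rfl; intro i _
  rw [← lx_ly, ← mul_assoc, ← lx_mul, h, lx_mul, mul_assoc, mul_assoc, lx_ly, ly_lx]

lemma eT_ly {a b : Fin n} {z : Rˣ} (l : ℕ) {A : Module.End R (FW R n)}
    (h : ∀ i, A * gE b a z⁻¹ (-l) i = gE b a z⁻¹ (-l) i * A) : ly A * eT a b z l = eT a b z l * ly A := by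
  rw [eT, mul_sum, sum_mul]; apply sum_congr rfl; intro i _
  rw [← ly_lx, ← mul_assoc, ← ly_mul, h, ly_mul, mul_assoc, mul_assoc, lx_ly, ly_lx]

lemma eT_adj {a b : Fin n} (hab : a ≠ b) (z : Rˣ) (l : ℕ) : AdjT (eT a b z l) (eT b a z⁻¹ l) := by
  intro x y
  simp only [eT, LinearMap.sum_apply, map_sum]
  apply sum_congr rfl; intro i _
  exact AdjT.map (gE_adj hab z 0 i) (gE_adj hab.symm z⁻¹ (-l) (l - i)) x y

lemma eT_io {a b : Fin n} {z : Rˣ} (h : Ad θ a b z) (l : ℕ) : io θ * eT a b z l = eT a b z l * io θ := by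
  have hab := h.ne
  apply TensorProduct.ext'; intro x y
  have f1 : sg a b a = 1 := by simp [sg]
  have f2 : sg a b b = -1 := by simp [sg, hab.symm]
  have hs : ∀ c, sg b a c = - sg a b c := by
    intro c; simp only [sg]; split_ifs <;> simp_all
  simp only [Module.End.mul_apply, io_tmul, eT_tmul, map_sum, map_smul]
  have key : ∀ t : Fin n, ∑ i ∈ range (l + 1), gE a b z 0 i (cs t x) ⊗ₜ[R] gE b a z⁻¹ (-l) (l - i) (cs t y) =
      ∑ i ∈ range (l + 1), cs t (gE a b z 0 i x) ⊗ₜ[R] cs t (gE b a z⁻¹ (-l) (l - i) y) +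
      ((if t = a then ∑ i ∈ range l, ((z ^ (-(i : ℤ) - 1) : Rˣ) : R) • (cs b (gE a b z 0 i x) ⊗ₜ[R] cs a (gE b a z⁻¹ (-l) (l - i - 1) y)) else 0) +
      (if t = b then ∑ i ∈ range l, ((z ^ (-(i : ℤ)) : Rˣ) : R) • (cs b (gE a b z 0 i x) ⊗ₜ[R] cs a (gE b a z⁻¹ (-l) (l - i - 1) y)) else 0)) := by
    intro t
    have e1 : (if t = a then ∑ i ∈ range l, ((z ^ (-(i : ℤ) - 1) : Rˣ) : R) • (cs b (gE a b z 0 i x) ⊗ₜ[R] cs a (gE b a z⁻¹ (-l) (l - i - 1) y)) else 0) =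
        if t = a then ∑ i ∈ range (l + 1), ((z ^ (-(i : ℤ)) : Rˣ) : R) • (cs b (gE a b z 0 (i - 1) x) ⊗ₜ[R] cs a (gE b a z⁻¹ (-l) (l - i) y)) else 0 := by
      split_ifs
      · rw [sum_range_succ' _ l, gE_neg (l := ((0 : ℕ) : ℤ) - 1) _ _ _ _ (by simp)]
        simp only [LinearMap.zero_apply, map_zero, zero_tmul, smul_zero, add_zero]
        apply sum_congr rfl; intro i _
        push_cast
        rw [show (i : ℤ) + 1 - 1 = i by ring, show -((i : ℤ) + 1) = -i - 1 by ring, show (l : ℤ) - (i + 1) = l - i - 1 by ring]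
      · rfl
    have e2 : (if t = b then ∑ i ∈ range l, ((z ^ (-(i : ℤ)) : Rˣ) : R) • (cs b (gE a b z 0 i x) ⊗ₜ[R] cs a (gE b a z⁻¹ (-l) (l - i - 1) y)) else 0) =
        if t = b then ∑ i ∈ range (l + 1), ((z ^ (-(i : ℤ)) : Rˣ) : R) • (cs b (gE a b z 0 i x) ⊗ₜ[R] cs a (gE b a z⁻¹ (-l) (l - i - 1) y)) else 0 := by
      split_ifs
      · rw [sum_range_succ _ l, gE_neg (l := (l : ℤ) - l - 1) _ _ _ _ (by omega)]
        simp
      · rfl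
    have e3 : ∀ i : ℕ, ((z ^ ((i : ℤ) * sg a b t) : Rˣ) : R) * ((z ^ (-((i : ℤ) * sg a b t)) : Rˣ) : R) = 1 := by
      intro i; rw [← Units.val_mul, ← zpow_add]; simp
    have e3' : ∀ i : ℕ, ((z ^ (-((i : ℤ) * sg a b t)) : Rˣ) : R) * ((z ^ ((i : ℤ) * sg a b t) : Rˣ) : R) = 1 := by
      intro i; rw [mul_comm, e3]
    have e4 : ∀ i : ℕ, ((z⁻¹ ^ (((l : ℤ) - i + -l) * sg b a t) : Rˣ) : R) = ((z ^ (-((i : ℤ) * sg a b t)) : Rˣ) : R) := by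
      intro i; rw [hs, inv_zpow, ← zpow_neg]; congr 2; ring
    rw [e1, e2]
    simp only [gE_cs, e4, add_zero]
    by_cases ha : t = a
    · subst ha
      simp only [if_true, hab, if_false, add_zero, zero_add, ← sum_add_distrib]
      apply sum_congr rfl; intro i _
      rw [tmul_smul, add_tmul, smul_add, ← smul_tmul', smul_smul, e3', one_smul, f1, mul_one, add_comm]
    · by_cases hb : t = b
      · subst hb
        simp only [if_true, hab.symm, if_false, add_zero, zero_add, ← sum_add_distrib]
        apply sum_congr rfl; intro i _
        rw [tmul_add, tmul_smul, ← smul_tmul', ← smul_tmul', smul_smul, e3', one_smul, f2, mul_neg, mul_one, add_comm]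
      · simp only [ha, hb, if_false, add_zero, zero_add]
        apply sum_congr rfl; intro i _
        simp only [tmul_smul, smul_tmul', smul_smul]
        rw [mul_comm, e3, one_smul]
  simp only [key, smul_add, sum_add_distrib, smul_ite, smul_zero, sum_ite_eq', mem_univ, if_true]
  rw [sum_comm]
  simp only [← smul_sum]
  symm
  convert add_zero _ using 2
  rw [smul_sum, smul_sum, ← sum_add_distrib]
  apply sum_eq_zero; intro i _
  rw [smul_smul, smul_smul, ← add_smul]
  have : (θ : R) ^ (a : ℕ) * ((z ^ (-(i : ℤ) - 1) : Rˣ) : R) + (θ : R) ^ (b : ℕ) * ((z ^ (-(i : ℤ)) : Rˣ) : R) = 0 := by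
    rw [zpow_sub_one, Units.val_mul]
    have : (θ : R) ^ (a : ℕ) * ((z⁻¹ : Rˣ) : R) + (θ : R) ^ (b : ℕ) = 0 := by
      have e0 : ((θ : Rˣ) : R) * ((θ⁻¹ : Rˣ) : R) = 1 := by simp
      rcases h with ⟨h, rfl⟩ | ⟨h, rfl⟩
      · rw [h, pow_succ]; simp only [inv_neg, Units.val_neg]; linear_combination (-(θ : R) ^ (b : ℕ)) * e0
      · rw [h, pow_succ]; simp
    linear_combination ((z ^ (-(i : ℤ)) : Rˣ) : R) * this
  rw [this, zero_smul]

lemma eT_po {a b : Fin n} {z : Rˣ} (h : Ad θ a b z) (l : ℕ) : po θ * eT a b z l = eT a b z l * po θ := by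
  have h1 := (adj_io θ).mul (eT_adj h.symm.ne z⁻¹ l)
  have h2 := (eT_adj h.symm.ne z⁻¹ l).mul (adj_io θ)
  rw [eT_io θ h.symm, inv_inv] at h1
  rw [inv_inv] at h2
  exact (h1.unique h2).symm

end qg
end RS

namespace RS
open Finset TensorProduct

section asm
variable {R : Type*} [CommRing R] (θ : Rˣ) {n : ℕ}

/-- operators commuting with the whole diagram category -/
noncomputable def GG : Subalgebra R (Module.End R (TT R n)) := Subalgebra.centralizer R
  {g | (∃ t, g = lx (SS θ t)) ∨ (∃ t, g = ly (SS θ t)) ∨ (∃ t, g = lx (pr t)) ∨ (∃ t, g = ly (pr t)) ∨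
    g = io θ ∨ g = po θ}

lemma mem_GG {φ : Module.End R (TT R n)} : φ ∈ GG θ ↔
    (∀ t, lx (SS θ t) * φ = φ * lx (SS θ t)) ∧ (∀ t, ly (SS θ t) * φ = φ * ly (SS θ t)) ∧
    (∀ t, lx (pr t) * φ = φ * lx (pr t)) ∧ (∀ t, ly (pr t) * φ = φ * ly (pr t)) ∧
    io θ * φ = φ * io θ ∧ po θ * φ = φ * po θ := by
  rw [GG, Subalgebra.mem_centralizer_iff]
  constructor
  · intro h
    exact ⟨fun t => h _ (Or.inl ⟨t, rfl⟩), fun t => h _ (Or.inr (Or.inl ⟨t, rfl⟩)),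
      fun t => h _ (Or.inr (Or.inr (Or.inl ⟨t, rfl⟩))), fun t => h _ (Or.inr (Or.inr (Or.inr (Or.inl ⟨t, rfl⟩)))),
      h _ (Or.inr (Or.inr (Or.inr (Or.inr (Or.inl rfl))))), h _ (Or.inr (Or.inr (Or.inr (Or.inr (Or.inr rfl)))))⟩
  · rintro ⟨h1, h2, h3, h4, h5, h6⟩ g (⟨t, rfl⟩ | ⟨t, rfl⟩ | ⟨t, rfl⟩ | ⟨t, rfl⟩ | rfl | rfl)
    exacts [h1 t, h2 t, h3 t, h4 t, h5, h6]

lemma GG_CB {φ : Module.End R (TT R n)} (h : φ ∈ GG θ) : φ ∈ CB θ := by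
  rw [mem_GG] at h; rw [mem_CB]
  refine ⟨h.1, h.2.1, h.2.2.1, h.2.2.2.1, ?_⟩
  rw [mul_assoc, h.2.2.2.2.2, ← mul_assoc, h.2.2.2.2.1, mul_assoc]

lemma adj_swap {A B g g' : Module.End R (TT R n)} (h : AdjT A B) (hg : AdjT g g') (e : g * A = A * g) :
    g' * B = B * g' := by
  have h1 := hg.mul h
  have h2 := h.mul hg
  rw [e] at h1
  exact h2.unique h1

lemma GG_adj {A B : Module.End R (TT R n)} (h : AdjT A B) (hA : A ∈ GG θ) : B ∈ GG θ := by
  rw [mem_GG] at *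
  obtain ⟨h1, h2, h3, h4, h5, h6⟩ := hA
  exact ⟨fun t => adj_swap h (AdjT.lx (adj_SS θ t)) (h1 t), fun t => adj_swap h (AdjT.ly (adj_SS θ t)) (h2 t),
    fun t => adj_swap h (AdjT.lx (adj_pr t)) (h3 t), fun t => adj_swap h (AdjT.ly (adj_pr t)) (h4 t),
    adj_swap h (adj_io θ).symm h6, adj_swap h (adj_io θ) h5⟩

lemma eT_GG {a b : Fin n} {z : Rˣ} (h : Ad θ a b z) (l : ℕ) : eT a b z l ∈ GG θ := by
  rw [mem_GG]
  refine ⟨fun t => eT_lx l fun i => gE_SS θ h _ _ _, fun t => eT_ly l fun i => gE_SS θ h.symm _ _ _,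
    fun t => eT_lx l fun i => gE_pr _ _ _ _ _ _, fun t => eT_ly l fun i => gE_pr _ _ _ _ _ _,
    eT_io θ h l, eT_po θ h l⟩

lemma Phi_GG [NeZero n] {φ : Module.End R (TT R n)} (h : φ ∈ GG θ) (r s : ℕ) :
    Phi θ (φ * prs (r + 1) (s + 1)) = φ * prs r s := by
  rw [Phi_apply, ← mul_assoc, ((mem_GG θ).1 h).2.2.2.2.2, mul_assoc, mul_assoc, ← io0_prs, ← mul_assoc (po θ),
    po_io0, one_mul]

lemma Phi_GG_iter [NeZero n] {φ : Module.End R (TT R n)} (h : φ ∈ GG θ) (k r s : ℕ) (hk : k ≤ min r s) :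
    (Phi θ)^[k] (φ * prs r s) = φ * prs (r - k) (s - k) := by
  induction k with
  | zero => rfl
  | succ k ih =>
    rw [Function.iterate_succ_apply', ih (by omega)]
    have := Phi_GG θ h (r - (k + 1)) (s - (k + 1))
    rw [← this]; congr 3 <;> omega

lemma pr_shift_zero (A : Module.End R (FW R n)) : pr 0 * shift A = 0 ∧ shift A * pr 0 = 0 := by
  constructor
  · apply ext_bs; intro u
    cases u with
    | nil => simp
    | cons a u =>
      simp only [Module.End.mul_apply, shift_bs_cons, LinearMap.zero_apply]
      refine ext_bs' (f := pr 0 ∘ₗ cs a) (g := 0) ?_ _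
      intro v; simp
  · apply ext_bs; intro u
    cases u <;> simp

lemma SS_pr (t r : ℕ) : SS (n := n) θ t * pr r = pr r * SS θ t := by
  induction t generalizing r with
  | zero =>
    apply ext_bs; intro u
    rw [SS]
    match u with
    | [] => simp only [Module.End.mul_apply, pr_bs, S0_nil, map_zero]; split_ifs <;> simp
    | [a] => simp only [Module.End.mul_apply, pr_bs, S0_one, map_zero]; split_ifs <;> simp
    | a :: b :: u =>
      simp only [Module.End.mul_apply, pr_bs, S0_cons, List.length_cons]
      by_cases h : u.length + 1 + 1 = r
      · rw [if_pos h, S0_cons]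
        split_ifs <;> simp [h]
      · rw [if_neg h, map_zero]
        split_ifs <;> simp [h]
  | succ t ih =>
    cases r with
    | zero => rw [SS, (pr_shift_zero _).1, (pr_shift_zero _).2]
    | succ r => rw [SS, ← shift_pr, ← shift_mul, ih, shift_mul]

lemma pr_pr (t r : ℕ) : pr (R := R) (n := n) t * pr r = pr r * pr t := by
  apply ext_bs; intro u
  simp only [Module.End.mul_apply, pr_bs]
  split_ifs <;> simp_all

lemma prs_lx {A : Module.End R (FW R n)} {r : ℕ} (h : A * pr r = pr r * A) (s : ℕ) :
    lx A * prs r s = prs r s * lx A := by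
  rw [prs_eq, ← mul_assoc, ← lx_mul, h, lx_mul, mul_assoc, mul_assoc, lx_ly, ly_lx]
lemma prs_ly {A : Module.End R (FW R n)} {s : ℕ} (h : A * pr s = pr s * A) (r : ℕ) :
    ly A * prs r s = prs r s * ly A := by
  rw [prs_eq, lx_ly, ← ly_lx, ← mul_assoc, ← ly_mul, h, ly_mul, mul_assoc, mul_assoc, lx_ly, ly_lx]

lemma prs_CB (r s : ℕ) : prs (n := n) r s ∈ CB θ := by
  rw [mem_CB]
  refine ⟨fun t => prs_lx (SS_pr θ t r) s, fun t => prs_ly (SS_pr θ t s) r, fun t => prs_lx (pr_pr t r) s,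
    fun t => prs_ly (pr_pr t s) r, ?_⟩
  apply ext_tt; intro u v
  match u, v with
  | [], v => simp only [Module.End.mul_apply, prs_bs, po_nil1, map_zero]; split_ifs <;> simp [po_nil1]
  | u, [] => simp only [Module.End.mul_apply, prs_bs, po_nil2, map_zero]; split_ifs <;> simp [po_nil2]
  | a :: u, b :: v =>
    simp only [Module.End.mul_apply, prs_bs, po_cons]
    by_cases hab : a = b
    · subst hab
      simp only [if_true, map_smul, io_tmul, map_sum, cs_bs, prs_bs, List.length_cons]
      split_ifs with h
      · rw [po_cons, if_pos rfl, map_smul, io_tmul]; simp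
      · simp
    · simp only [hab, if_false, map_zero]
      split_ifs
      · rw [po_cons, if_neg hab, map_zero]
      · simp

lemma prs_prs (r s : ℕ) : prs (R := R) (n := n) r s * prs r s = prs r s := by
  apply ext_tt; intro u v
  simp only [Module.End.mul_apply, prs_bs]
  split_ifs with h <;> simp [prs_bs, h]

lemma GG_CR {φ : Module.End R (TT R n)} (h : φ ∈ GG θ) (r s : ℕ) : φ * prs r s ∈ CR θ r s :=
  ⟨mul_mem (GG_CB θ h) (prs_CB θ r s), by rw [mul_assoc, prs_prs]⟩

/-- span of J's of given shapes -/
noncomputable def SP (l l' : List ℕ) : Submodule R (TT R n) :=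
  Submodule.span R {v | ∃ M M', shp M = l ∧ shp M' = l' ∧ v = J θ M ⊗ₜ[R] J θ M'}

lemma tmul_SP {l l' : List ℕ} {x y : FW R n} (hx : x ∈ Submodule.span R {v | ∃ M, shp M = l ∧ v = J θ M})
    (hy : y ∈ Submodule.span R {v | ∃ M, shp M = l' ∧ v = J θ M}) : x ⊗ₜ y ∈ SP θ l l' := by
  induction hx using Submodule.span_induction with
  | zero => simp
  | add x x' _ _ h h' => rw [add_tmul]; exact add_mem h h'
  | smul c x _ h => rw [← smul_tmul']; exact Submodule.smul_mem _ _ h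
  | mem x hx =>
    obtain ⟨M, hM, rfl⟩ := hx
    induction hy using Submodule.span_induction with
    | zero => simp
    | add x x' _ _ h h' => rw [tmul_add]; exact add_mem h h'
    | smul c x _ h => rw [tmul_smul]; exact Submodule.smul_mem _ _ h
    | mem y hy =>
      obtain ⟨M', hM', rfl⟩ := hy
      exact Submodule.subset_span ⟨M, M', hM, hM', rfl⟩

lemma eT_SP {a b : Fin n} {z : Rˣ} (h : Ad θ a b z) (k : ℕ) {l l' : List ℕ} {x : TT R n} (hx : x ∈ SP θ l l') :
    eT a b z k x ∈ SP θ l l' := by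
  refine Submodule.span_le (p := (SP θ l l').comap (eT a b z k)) |>.2 ?_ hx
  rintro _ ⟨M, M', rfl, rfl, rfl⟩
  rw [SetLike.mem_coe, Submodule.mem_comap, eT_tmul]
  exact Submodule.sum_mem _ fun i _ => tmul_SP θ (gE_J_span θ h _ _ _) (gE_J_span θ h.symm _ _ _)

lemma eT_zero {a b : Fin n} {z : Rˣ} (h : Ad θ a b z) (k : ℕ) (L L' : RL n) (hk : fc a b L + fc b a L' < k) :
    eT a b z k (J θ L ⊗ₜ J θ L') = 0 := by
  rw [eT_tmul]
  apply sum_eq_zero; intro i hi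
  by_cases h1 : fc a b L < i
  · rw [gE_J_zero θ h _ _ _ (by omega), zero_tmul]
  · rw [gE_J_zero θ h.symm _ _ L' (by omega), tmul_zero]

lemma eT_top {a b : Fin n} {z : Rˣ} (h : Ad θ a b z) (L L' : RL n) :
    ∃ w : Rˣ, eT a b z (fc a b L + fc b a L') (J θ L ⊗ₜ J θ L') =
      (w : R) • (J θ (L.map (flr a b)) ⊗ₜ[R] J θ (L'.map (flr b a))) := by
  obtain ⟨w, hw⟩ := gE_J_top θ h 0 L
  obtain ⟨w', hw'⟩ := gE_J_top θ h.symm (-((fc a b L + fc b a L' : ℕ) : ℤ)) L'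
  refine ⟨w * w', ?_⟩
  rw [eT_tmul, sum_eq_single (fc a b L)]
  · rw [hw, show (((fc a b L + fc b a L' : ℕ) : ℤ) - (fc a b L : ℤ)) = fc b a L' by push_cast; ring, hw', smul_tmul_smul,
      Units.val_mul]
  · intro i hi hne
    by_cases h1 : fc a b L < i
    · rw [gE_J_zero θ h _ _ _ (by omega), zero_tmul]
    · rw [gE_J_zero θ h.symm _ _ L' (by omega), tmul_zero]
  · intro h; simp at h

/-- raising operators indexed by natural numbers -/
noncomputable def eI (i l : ℕ) : Module.End R (TT R n) :=
  if h : i + 1 < n then eT ⟨i + 1, h⟩ ⟨i, by omega⟩ (-θ) l else if l = 0 then 1 else 0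

/-- flip of pairs -/
def flP (i : ℕ) (P : RL n × RL n) : RL n × RL n :=
  if h : i + 1 < n then (P.1.map (flr ⟨i + 1, h⟩ ⟨i, by omega⟩), P.2.map (flr ⟨i, by omega⟩ ⟨i + 1, h⟩)) else P

/-- number of flips of pairs -/
def fcP (i : ℕ) (P : RL n × RL n) : ℕ :=
  if h : i + 1 < n then fc ⟨i + 1, h⟩ ⟨i, by omega⟩ P.1 + fc ⟨i, by omega⟩ ⟨i + 1, h⟩ P.2 else 0

/-- string -/
def str : List ℕ → RL n × RL n → List ℕ
  | [], _ => []
  | i :: is, P => fcP i P :: str is (flP i P)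

/-- final state -/
def fin : List ℕ → RL n × RL n → RL n × RL n
  | [], P => P
  | i :: is, P => fin is (flP i P)

/-- product of raising operators -/
noncomputable def EE : List ℕ → List ℕ → Module.End R (TT R n)
  | i :: is, a :: as => EE is as * eI θ i a
  | _, _ => 1

/-- tensor of J's -/
noncomputable def JP (P : RL n × RL n) : TT R n := J θ P.1 ⊗ₜ J θ P.2

lemma Ad0 {i : ℕ} (h : i + 1 < n) : Ad θ (⟨i + 1, h⟩ : Fin n) ⟨i, by omega⟩ (-θ) := Or.inl ⟨rfl, rfl⟩

lemma eI_GG (i l : ℕ) : eI (n := n) θ i l ∈ GG θ := by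
  unfold eI; split_ifs with h
  · exact eT_GG θ (Ad0 θ h) l
  · exact one_mem _
  · exact zero_mem _

lemma eI_adj (i l : ℕ) : ∃ B, AdjT (eI (n := n) θ i l) B := by
  unfold eI; split_ifs with h
  · exact ⟨_, eT_adj (Ad0 θ h).ne _ _⟩
  · exact ⟨1, fun x y => rfl⟩
  · exact ⟨0, fun x y => by simp⟩

lemma eI_SP (i k : ℕ) {l l' : List ℕ} {x : TT R n} (hx : x ∈ SP θ l l') : eI θ i k x ∈ SP θ l l' := by
  unfold eI; split_ifs with h
  · exact eT_SP θ (Ad0 θ h) k hx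
  · exact hx
  · exact zero_mem _

lemma eI_zero (i k : ℕ) (P : RL n × RL n) (h : fcP i P < k) : eI θ i k (JP θ P) = 0 := by
  unfold eI; unfold fcP at h; split_ifs with h1 h2
  · rw [dif_pos h1] at h; exact eT_zero θ (Ad0 θ h1) k _ _ h
  · omega
  · rfl

lemma eI_top (i : ℕ) (P : RL n × RL n) : ∃ w : Rˣ, eI θ i (fcP i P) (JP θ P) = (w : R) • JP θ (flP i P) := by
  unfold eI fcP flP; split_ifs with h1 h2
  · exact eT_top θ (Ad0 θ h1) _ _
  · exact ⟨1, by simp⟩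
  · omega

lemma EE_GG (is as : List ℕ) : EE (n := n) θ is as ∈ GG θ := by
  induction is generalizing as with
  | nil => unfold EE; exact one_mem _
  | cons i is ih => cases as with
    | nil => unfold EE; exact one_mem _
    | cons a as => unfold EE; exact mul_mem (ih as) (eI_GG θ i a)

lemma EE_adj (is as : List ℕ) : ∃ B, AdjT (EE (n := n) θ is as) B := by
  induction is generalizing as with
  | nil => unfold EE; exact ⟨1, fun x y => rfl⟩
  | cons i is ih => cases as with
    | nil => unfold EE; exact ⟨1, fun x y => rfl⟩
    | cons a as =>
      unfold EE
      obtain ⟨B, hB⟩ := ih as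
      obtain ⟨C, hC⟩ := eI_adj (n := n) θ i a
      exact ⟨_, hB.mul hC⟩

lemma EE_SP (is as : List ℕ) {l l' : List ℕ} {x : TT R n} (hx : x ∈ SP θ l l') : EE θ is as x ∈ SP θ l l' := by
  induction is generalizing as x with
  | nil => unfold EE; exact hx
  | cons i is ih => cases as with
    | nil => unfold EE; exact hx
    | cons a as => unfold EE; exact ih as (eI_SP θ i a hx)

lemma EE_lt (is as : List ℕ) (hl : as.length = is.length) (P : RL n × RL n) (h : str is P < as) :
    EE θ is as (JP θ P) = 0 := by
  induction is generalizing as P with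
  | nil =>
    rw [List.length_nil, List.length_eq_zero_iff] at hl; subst hl
    simp [str] at h
  | cons i is ih => cases as with
    | nil => simp at hl
    | cons a as =>
      unfold EE
      rw [str, List.cons_lt_cons_iff] at h
      rw [Module.End.mul_apply]
      rcases h with h | ⟨rfl, h⟩
      · rw [eI_zero θ _ _ _ h, map_zero]
      · obtain ⟨w, hw⟩ := eI_top θ i P
        rw [hw, map_smul, ih as (by simpa using hl) _ h, smul_zero]

lemma EE_top (is : List ℕ) (P : RL n × RL n) : ∃ w : Rˣ, EE θ is (str is P) (JP θ P) = (w : R) • JP θ (fin is P) := by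
  induction is generalizing P with
  | nil => exact ⟨1, by simp [EE, fin]⟩
  | cons i is ih =>
    unfold EE str fin
    obtain ⟨w, hw⟩ := eI_top θ i P
    obtain ⟨w', hw'⟩ := ih (flP i P)
    refine ⟨w * w', ?_⟩
    rw [Module.End.mul_apply, hw, map_smul, hw', smul_smul, Units.val_mul]

lemma str_length (is : List ℕ) (P : RL n × RL n) : (str is P).length = is.length := by
  induction is generalizing P with
  | nil => rfl
  | cons i is ih => simp [str, ih]

lemma shp_flP (i : ℕ) (P : RL n × RL n) : shp (flP i P).1 = shp P.1 ∧ shp (flP i P).2 = shp P.2 := by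
  unfold flP; split_ifs
  · simp [shp_flr]
  · simp

lemma shp_fin (is : List ℕ) (P : RL n × RL n) : shp (fin is P).1 = shp P.1 ∧ shp (fin is P).2 = shp P.2 := by
  induction is generalizing P with
  | nil => simp [fin]
  | cons i is ih =>
    rw [fin, (ih _).1, (ih _).2]; exact shp_flP i P

end asm
end RS

namespace RS
open Finset TensorProduct

section wts
variable {R : Type*} [CommRing R] (θ : Rˣ) {n : ℕ}

/-- number of elements below `x` -/
def pp (X : Finset (Fin n)) (x : ℕ) : ℕ := (X.filter fun a : Fin n => (a : ℕ) < x).card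

/-- indicator -/
def ib (b : Fin n) (x : ℕ) : ℤ := if (b : ℕ) < x then 1 else 0

/-- cumulative weight of a word -/
def prew (u : W n) : ℕ → ℤ := (u.map ib).sum

/-- cumulative weight of a list of rows -/
def pw (L : RL n) : ℕ → ℤ := (L.map fun X x => (pp X x : ℤ)).sum

@[simp] lemma prew_cons (b : Fin n) (u : W n) : prew (b :: u) = ib b + prew u := by simp [prew]

lemma prew_sub (b : Fin n) (u v : W n) : prew (b :: u) - prew (b :: v) = prew u - prew v := by
  simp

/-- weight spaces -/
noncomputable def Hm (ν : ℕ → ℤ) : Submodule R (FW R n) := Submodule.span R {v | ∃ u, prew u = ν ∧ v = bs u}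

lemma bs_Hm (u : W n) : (bs u : FW R n) ∈ Hm (prew u) := Submodule.subset_span ⟨u, rfl, rfl⟩

lemma Hm_le {ν ν' : ℕ → ℤ} {A : Module.End R (FW R n)} (h : ∀ u, prew u = ν → A (bs u) ∈ Hm ν') {v : FW R n}
    (hv : v ∈ Hm ν) : A v ∈ Hm ν' := by
  refine Submodule.span_le (p := (Hm ν').comap A) |>.2 ?_ hv
  rintro _ ⟨u, hu, rfl⟩
  exact h u hu

lemma cs_Hm (b : Fin n) {ν : ℕ → ℤ} {v : FW R n} (hv : v ∈ Hm ν) : cs b v ∈ Hm (ib b + ν) := by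
  refine Hm_le ?_ hv
  rintro u rfl
  rw [cs_bs, ← prew_cons]; exact bs_Hm _

lemma pp_erase {X : Finset (Fin n)} {b : Fin n} (hb : b ∈ X) :
    (fun x => (pp X x : ℤ)) = ib b + fun x => (pp (X.erase b) x : ℤ) := by
  funext x
  simp only [pp, ib, Pi.add_apply, filter_erase]
  split_ifs with h
  · rw [card_erase_of_mem (by simp [hb, h])]
    have : 0 < (X.filter fun a : Fin n => (a : ℕ) < x).card := card_pos.2 ⟨b, by simp [hb, h]⟩
    omega
  · rw [erase_eq_of_notMem (by simp [h])]; simp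

lemma Jr_Hm (a : ℕ) (X : Finset (Fin n)) {ν : ℕ → ℤ} {v : FW R n} (hv : v ∈ Hm ν) :
    Jr θ a X v ∈ Hm ((fun x => (pp X x : ℤ)) + ν) := by
  induction a generalizing X with
  | zero =>
    rw [Jr]; split_ifs with h
    · subst h
      have : ((fun x => ((pp (∅ : Finset (Fin n)) x : ℕ) : ℤ)) + ν) = ν := by funext x; simp [pp]
      rw [this]; exact hv
    · exact zero_mem _
  | succ a ih =>
    rw [Jr, LinearMap.sum_apply]
    refine Submodule.sum_mem _ fun b hb => Submodule.smul_mem _ _ ?_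
    rw [pp_erase hb, add_assoc]
    exact cs_Hm b (ih _)

lemma J_Hm (L : RL n) : (J θ L : FW R n) ∈ Hm (pw L) := by
  induction L with
  | nil => rw [J]; exact bs_Hm []
  | cons X L ih =>
    rw [J]
    have : pw (X :: L) = (fun x => (pp X x : ℤ)) + pw L := by simp [pw]
    rw [this]; exact Jr_Hm θ _ _ ih

open Classical in
/-- weight projector -/
noncomputable def Wt (μ : ℕ → ℤ) : Module.End R (TT R n) :=
  et.symm.toLinearMap ∘ₗ (lc fun p => if prew p.1 - prew p.2 = μ then bs p else 0) ∘ₗ et.toLinearMap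

open Classical in
lemma Wt_bs (μ : ℕ → ℤ) (u v : W n) : Wt μ (bs u ⊗ₜ bs v : TT R n) =
    if prew u - prew v = μ then bs u ⊗ₜ bs v else 0 := by
  simp only [Wt, LinearMap.comp_apply, LinearEquiv.coe_coe, et_bs, lc_bs]
  split_ifs
  · rw [← et_bs, LinearEquiv.symm_apply_apply]
  · simp

open Classical in
lemma Wt_cons (μ : ℕ → ℤ) (b : Fin n) (u v : W n) : Wt μ (bs (b :: u) ⊗ₜ bs (b :: v) : TT R n) =
    if prew u - prew v = μ then bs (b :: u) ⊗ₜ bs (b :: v) else 0 := by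
  rw [Wt_bs, prew_sub]

open Classical in
lemma Wt_tmul {μ ν ν' : ℕ → ℤ} {x y : FW R n} (hx : x ∈ Hm ν) (hy : y ∈ Hm ν') :
    Wt μ (x ⊗ₜ[R] y) = if ν - ν' = μ then x ⊗ₜ[R] y else 0 := by
  induction hx using Submodule.span_induction with
  | zero => simp
  | add x x' _ _ h h' => rw [add_tmul, map_add, h, h']; split_ifs <;> simp
  | smul c x _ h => rw [← smul_tmul', map_smul, h]; split_ifs <;> simp
  | mem x hx =>
    obtain ⟨u, hu, rfl⟩ := hx
    induction hy using Submodule.span_induction with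
    | zero => simp
    | add x x' _ _ h h' => rw [tmul_add, map_add, h, h']; split_ifs <;> simp
    | smul c x _ h => rw [tmul_smul, map_smul, h]; split_ifs <;> simp
    | mem y hy =>
      obtain ⟨v, hv, rfl⟩ := hy
      rw [Wt_bs, hu, hv]

/-- weight preserving operators -/
def WP (A : Module.End R (FW R n)) : Prop := ∀ u, A (bs u) ∈ Hm (R := R) (prew u)

lemma WP.lx {A : Module.End R (FW R n)} (h : WP A) (μ : ℕ → ℤ) : lx A * Wt μ = Wt μ * lx A := by
  apply ext_tt; intro u v
  simp only [Module.End.mul_apply, Wt_bs, lx_tmul]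
  rw [Wt_tmul (h u) (bs_Hm v)]; split_ifs <;> simp

lemma WP.ly {A : Module.End R (FW R n)} (h : WP A) (μ : ℕ → ℤ) : ly A * Wt μ = Wt μ * ly A := by
  apply ext_tt; intro u v
  simp only [Module.End.mul_apply, Wt_bs, ly_tmul]
  rw [Wt_tmul (bs_Hm u) (h v)]; split_ifs <;> simp

lemma WP_pr (k : ℕ) : WP (pr (R := R) (n := n) k) := by
  intro u; rw [pr_bs]; split_ifs
  · exact bs_Hm u
  · exact zero_mem _

lemma WP_SS (t : ℕ) : WP (SS (n := n) θ t) := by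
  induction t with
  | zero =>
    intro u
    rw [SS]
    match u with
    | [] => simp
    | [a] => simp
    | a :: b :: u =>
      have e : prew (a :: b :: u) = prew (b :: a :: u) := by simp; ring
      have h1 : (bs (b :: a :: u) : FW R n) ∈ Hm (R := R) (prew (a :: b :: u)) := by rw [e]; exact bs_Hm _
      rw [S0_cons]; split_ifs
      · exact Submodule.smul_mem _ _ (bs_Hm _)
      · exact h1
      · exact add_mem h1 (Submodule.smul_mem _ _ (bs_Hm _))
  | succ t ih =>
    intro u
    rw [SS]
    cases u with
    | nil => simp
    | cons a u => rw [shift_bs_cons, prew_cons]; exact cs_Hm a (ih u)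

lemma Wt_GG (μ : ℕ → ℤ) : Wt (n := n) μ ∈ GG θ := by
  rw [mem_GG]
  refine ⟨fun t => (WP_SS θ t).lx μ, fun t => (WP_SS θ t).ly μ, fun t => (WP_pr t).lx μ, fun t => (WP_pr t).ly μ, ?_, ?_⟩
  · apply ext_tt; intro u v
    simp only [Module.End.mul_apply, Wt_bs μ u v, io_tmul, map_sum, map_smul, cs_bs, Wt_cons]
    split_ifs
    · simp [io_tmul]
    · simp
  · apply ext_tt; intro u v
    match u, v with
    | [], v => simp only [Module.End.mul_apply, Wt_bs, po_nil1, map_zero]; split_ifs <;> simp [po_nil1]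
    | u, [] => simp only [Module.End.mul_apply, Wt_bs, po_nil2, map_zero]; split_ifs <;> simp [po_nil2]
    | a :: u, b :: v =>
      simp only [Module.End.mul_apply, po_cons]
      by_cases hab : a = b
      · subst hab
        simp only [if_true, map_smul, Wt_cons, Wt_bs μ u v]
        split_ifs
        · rw [po_cons, if_pos rfl]
        · simp
      · simp only [hab, if_false, map_zero, Wt_bs]
        split_ifs
        · rw [po_cons, if_neg hab]
        · simp

open Classical in
lemma Wt_JP (μ : ℕ → ℤ) (P : RL n × RL n) : Wt μ (JP θ P) = if pw P.1 - pw P.2 = μ then JP θ P else 0 :=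
  Wt_tmul (J_Hm θ _) (J_Hm θ _)

lemma Wt_SP {μ : ℕ → ℤ} {l l' : List ℕ} {x : TT R n} (hx : x ∈ SP θ l l') (h : Wt μ x ≠ 0) :
    ∃ P : RL n × RL n, shp P.1 = l ∧ shp P.2 = l' ∧ pw P.1 - pw P.2 = μ := by
  by_contra hc
  apply h
  refine Submodule.span_le (p := LinearMap.ker (Wt μ)) |>.2 ?_ hx
  rintro _ ⟨M, M', h1, h2, rfl⟩
  have := Wt_JP θ μ (M, M')
  rw [if_neg (fun h3 => hc ⟨(M, M'), h1, h2, h3⟩)] at this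
  exact this

/-- the maximal weight of a shape -/
def top (n : ℕ) (l l' : List ℕ) (x : ℕ) : ℤ :=
  (l.map fun a => ((min x a : ℕ) : ℤ)).sum - (l'.map fun b => ((min x n : ℕ) : ℤ) - (min x (n - b) : ℕ)).sum

lemma pp_le (X : Finset (Fin n)) (x : ℕ) : pp X x ≤ min x X.card := by
  apply le_min
  · calc pp X x ≤ ((range x)).card := by
          apply card_le_card_of_injOn (fun a : Fin n => (a : ℕ))
          · intro a ha; simp at ha ⊢; exact ha.2
          · intro a _ b _ h; exact Fin.ext h
      _ = x := card_range x
  · exact card_le_card (filter_subset _ _)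

lemma pp_univ (x : ℕ) : pp (univ : Finset (Fin n)) x = min x n := by
  unfold pp
  rw [Fin.card_filter_val_lt]; exact min_comm _ _

lemma pp_compl (Y : Finset (Fin n)) (x : ℕ) : pp Yᶜ x + pp Y x = min x n := by
  rw [← pp_univ, pp, pp, pp, ← card_union_of_disjoint, ← filter_union, union_comm, union_compl]
  exact disjoint_filter_filter (disjoint_compl_left)

lemma pw_apply (L : RL n) (x : ℕ) : pw L x = (L.map fun X => (pp X x : ℤ)).sum := by
  induction L with
  | nil => rfl
  | cons X L ih => simp [pw] at *; exact ih

lemma pw_le_top (P : RL n × RL n) (x : ℕ) : (pw P.1 - pw P.2) x ≤ top n (shp P.1) (shp P.2) x := by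
  rw [Pi.sub_apply, pw_apply, pw_apply, top, shp, shp, List.map_map, List.map_map]
  apply sub_le_sub
  · apply List.sum_le_sum
    intro X _
    have := pp_le X x
    simp only [Function.comp]; exact_mod_cast this
  · apply List.sum_le_sum
    intro Y _
    have := pp_le Yᶜ x
    rw [card_compl, Fintype.card_fin] at this
    have := pp_compl Y x
    simp only [Function.comp]; omega

/-- the testing operators -/
noncomputable def ad (A : Module.End R (TT R n)) : Module.End R (TT R n) :=
  open Classical in if h : ∃ B, AdjT A B then h.choose else 0

lemma ad_spec {A : Module.End R (TT R n)} (h : ∃ B, AdjT A B) : AdjT A (ad A) := by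
  rw [ad, dif_pos h]; exact h.choose_spec

/-- triangular family -/
noncomputable def psi (is : List ℕ) (S T : RL n × RL n) : Module.End R (TT R n) :=
  ad (EE θ is (str is T)) * (Wt (top n (shp S.1) (shp S.2)) * EE θ is (str is S))

lemma psi_GG (is : List ℕ) (S T : RL n × RL n) : psi θ is S T ∈ GG θ :=
  mul_mem (GG_adj θ (ad_spec (EE_adj θ _ _)) (EE_GG θ _ _)) (mul_mem (Wt_GG θ _) (EE_GG θ _ _))

/-- entries of the test matrix -/
noncomputable def NN (φ : Module.End R (TT R n)) (S T : RL n × RL n) : R :=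
  dt (φ (bs (wd θ S.1) ⊗ₜ bs (wd θ S.2))) (JP θ T)

lemma NN_coef {φ : Module.End R (TT R n)} (hφ : φ ∈ CB θ) (S T : RL n × RL n) (h : shp S.1 = shp T.1)
    (h' : shp S.2 = shp T.2) : NN θ φ S T = dt (φ (JP θ S)) (bs (wd θ T.1) ⊗ₜ bs (wd θ T.2)) :=
  (coef θ hφ S.1 S.2 T.1 T.2 h h').symm

lemma NN_ne (is : List ℕ) (S T S' T' : RL n × RL n) (h : shp S.1 = shp T.1) (h' : shp S.2 = shp T.2)
    (hne : NN θ (psi θ is S' T') S T ≠ 0) :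
    top n (shp S'.1) (shp S'.2) ≤ top n (shp S.1) (shp S.2) ∧ str is S' ≤ str is S ∧ str is T' ≤ str is T := by
  refine ⟨?_, ?_, ?_⟩
  · rw [NN_coef θ (GG_CB θ (psi_GG θ is S' T')) _ _ h h'] at hne
    have h1 : Wt (top n (shp S'.1) (shp S'.2)) (EE θ is (str is S') (JP θ S)) ≠ 0 := by
      intro h0; apply hne; rw [psi, Module.End.mul_apply, Module.End.mul_apply, h0]; simp
    obtain ⟨P, h1, h2, h3⟩ := Wt_SP θ (EE_SP θ is _ (Submodule.subset_span ⟨S.1, S.2, rfl, rfl, rfl⟩)) h1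
    intro x
    rw [← h3, ← h1, ← h2]; exact pw_le_top P x
  · rw [NN_coef θ (GG_CB θ (psi_GG θ is S' T')) _ _ h h'] at hne
    by_contra hc
    apply hne
    rw [psi, Module.End.mul_apply, Module.End.mul_apply, EE_lt θ is _ (str_length _ _) S (not_le.1 hc)]; simp
  · by_contra hc
    apply hne
    rw [NN, psi, Module.End.mul_apply, (ad_spec (EE_adj θ _ _)).symm, EE_lt θ is _ (str_length _ _) T (not_le.1 hc)]; simp

lemma dot_wd (L : RL n) : dot (bs (wd θ L)) (J θ L) = (1 : R) := by
  have h := PP_apply θ (shp L) (bs (wd θ L)) L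
  rw [if_pos rfl, PP_wd] at h
  rw [← h]; simp [bs]

lemma NN_diag (is : List ℕ) (S T : RL n × RL n) (h : shp S.1 = shp T.1) (h' : shp S.2 = shp T.2)
    (hf : fin is S = fin is T) (ht : pw (fin is S).1 - pw (fin is S).2 = top n (shp S.1) (shp S.2)) :
    IsUnit (NN θ (psi θ is S T) S T) := by
  rw [NN_coef θ (GG_CB θ (psi_GG θ is S T)) _ _ h h']
  obtain ⟨w, hw⟩ := EE_top θ is S
  obtain ⟨w', hw'⟩ := EE_top θ is T
  have hA : ad (EE (n := n) θ is (str is T)) ∈ GG θ := GG_adj θ (ad_spec (EE_adj θ _ _)) (EE_GG θ _ _)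
  have h3 := NN_coef θ (GG_CB θ hA) (fin is T) T (shp_fin is T).1 (shp_fin is T).2
  rw [psi, Module.End.mul_apply, Module.End.mul_apply, hw, map_smul, Wt_JP, if_pos ht, map_smul, map_smul, hf,
    LinearMap.smul_apply, ← h3, NN, (ad_spec (EE_adj θ _ _)).symm, hw', map_smul, JP, dt_tmul, dot_wd, dot_wd]
  simp

end wts
end RS

namespace RS
open Finset

section comb
variable {n : ℕ}

lemma perm_of_min (l m : List ℕ) (hl : l.length = m.length)
    (h : ∀ j, (l.map (min j)).sum = (m.map (min j)).sum) : l.Perm m := by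
  rw [List.perm_iff_count]
  have key : ∀ (l : List ℕ) (a : ℕ), l.count (a + 1) + (l.map (min a)).sum + (l.map (min (a + 2))).sum =
      2 * (l.map (min (a + 1))).sum := by
    intro l a
    induction l with
    | nil => simp
    | cons p l ih =>
      simp only [List.count_cons, List.map_cons, List.sum_cons]
      by_cases hp : p = a + 1
      · simp [hp]; omega
      · simp [hp]; omega
  have key0 : ∀ (l : List ℕ), l.count 0 + (l.map (min 1)).sum = l.length := by
    intro l
    induction l with
    | nil => simp
    | cons p l ih =>
      simp only [List.count_cons, List.map_cons, List.sum_cons, List.length_cons]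
      by_cases hp : p = 0
      · simp [hp]; omega
      · simp [hp]; omega
  intro a
  cases a with
  | zero => have := key0 l; have := key0 m; have := h 1; omega
  | succ a =>
    have := key l a; have := key m a; have := h a; have := h (a + 1); have := h (a + 2); omega

/-- flip of a row -/
def fl (i : ℕ) (X : Finset (Fin n)) : Finset (Fin n) :=
  if h : i + 1 < n then flr ⟨i + 1, h⟩ ⟨i, by omega⟩ X else X

/-- flippability indicator -/
def ind (i : ℕ) (X : Finset (Fin n)) : ℕ :=
  if h : i + 1 < n then (if (⟨i + 1, h⟩ : Fin n) ∈ X ∧ (⟨i, by omega⟩ : Fin n) ∉ X then 1 else 0) else 0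

lemma pp_insert {X : Finset (Fin n)} {b : Fin n} (hb : b ∉ X) (x : ℕ) :
    pp (insert b X) x = (if (b : ℕ) < x then 1 else 0) + pp X x := by
  have := congrFun (pp_erase (mem_insert_self b X)) x
  rw [erase_insert hb, Pi.add_apply, ib] at this
  split_ifs at this ⊢ with h
  · exact_mod_cast this
  · simp at this ⊢; exact this

lemma pp_erase' {X : Finset (Fin n)} {b : Fin n} (hb : b ∈ X) (x : ℕ) :
    pp X x = (if (b : ℕ) < x then 1 else 0) + pp (X.erase b) x := by
  have := pp_insert (notMem_erase b X) x
  rwa [insert_erase hb] at this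

lemma pp_succ (X : Finset (Fin n)) (x : ℕ) (h : x < n) :
    pp X (x + 1) = pp X x + if (⟨x, h⟩ : Fin n) ∈ X then 1 else 0 := by
  unfold pp
  have : X.filter (fun a : Fin n => (a : ℕ) < x + 1) = X.filter (fun a : Fin n => (a : ℕ) < x) ∪
      X.filter (fun a => a = ⟨x, h⟩) := by
    ext a; simp only [mem_filter, mem_union, Fin.ext_iff, ← and_or_left]
    constructor <;> rintro ⟨h1, h2⟩ <;> exact ⟨h1, by omega⟩
  rw [this, card_union_of_disjoint, filter_eq']
  · split_ifs <;> simp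
  · rw [disjoint_filter]; rintro a _ h1 rfl; simp at h1

lemma pp_zero (X : Finset (Fin n)) : pp X 0 = 0 := by simp [pp]

lemma pp_n (X : Finset (Fin n)) {x : ℕ} (h : n ≤ x) : pp X x = X.card := by
  unfold pp; rw [filter_true_of_mem]; intro a _; omega

lemma pp_ext {X Y : Finset (Fin n)} (h : ∀ x ≤ n, pp X x = pp Y x) : X = Y := by
  ext a
  have h1 := pp_succ X a a.2
  have h2 := pp_succ Y a a.2
  rw [h _ (by omega), h _ (by omega)] at h1
  rw [h1] at h2
  simp only [Fin.eta] at h2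
  by_cases hX : a ∈ X <;> by_cases hY : a ∈ Y <;> simp [hX, hY] at h2 ⊢

lemma pp_step (X : Finset (Fin n)) (x : ℕ) : pp X x ≤ pp X (x + 1) ∧ pp X (x + 1) ≤ pp X x + 1 := by
  by_cases h : x < n
  · rw [pp_succ X x h]; split_ifs <;> omega
  · rw [pp_n X (by omega), pp_n X (by omega)]; omega

lemma pp_fl (i : ℕ) (X : Finset (Fin n)) (h : i + 1 < n) (x : ℕ) :
    pp (fl i X) x = if x = i + 1 then min (pp X i + 1) (pp X (i + 2)) else pp X x := by
  have h1 := pp_succ X i (by omega)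
  have h2 : pp X (i + 2) = _ := pp_succ X (i + 1) h
  rw [fl, dif_pos h, flr]
  split_ifs with hX hx hx
  · subst hx
    have e := pp_erase' hX.1 (i + 1)
    rw [pp_insert (fun h' => hX.2 (mem_of_mem_erase h'))]
    rw [if_pos hX.1] at h2; rw [if_neg hX.2] at h1
    simp only [lt_irrefl, if_false, Nat.lt_succ_self, if_true, zero_add] at e ⊢
    rw [h2, ← e, h1, min_eq_left (by omega)]; omega
  · have e := pp_erase' hX.1 x
    rw [pp_insert (fun h' => hX.2 (mem_of_mem_erase h')), e]
    congr 1
    simp only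
    split_ifs <;> omega
  · subst hx
    by_cases h3 : (⟨i + 1, h⟩ : Fin n) ∈ X
    · have h4 : (⟨i, by omega⟩ : Fin n) ∈ X := by by_contra h4; exact hX ⟨h3, h4⟩
      rw [if_pos h3] at h2; rw [if_pos h4] at h1; rw [min_eq_left (by omega)]; omega
    · rw [if_neg h3] at h2; rw [min_eq_right (by split_ifs at h1 <;> omega)]; omega
  · rfl

lemma ind_fl (i : ℕ) (X : Finset (Fin n)) (h : i + 1 < n) : ind i X + pp X (i + 1) = pp (fl i X) (i + 1) := by
  have h1 := pp_succ X i (by omega)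
  have h2 : pp X (i + 2) = _ := pp_succ X (i + 1) h
  rw [pp_fl i X h, if_pos rfl, ind, dif_pos h]
  by_cases h3 : (⟨i + 1, h⟩ : Fin n) ∈ X <;> by_cases h4 : (⟨i, by omega⟩ : Fin n) ∈ X <;>
    simp only [h3, h4, if_true, if_false, not_true, not_false_iff, and_true, and_false] at h1 h2 ⊢ <;>
    rw [h2, h1] <;> rcases min_cases (pp X i + 1) (pp X i) with hh | hh <;> omega

/-- iterated flips -/
def run : List ℕ → Finset (Fin n) → Finset (Fin n)
  | [], X => X
  | i :: is, X => run is (fl i X)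

lemma run_append (l m : List ℕ) (X : Finset (Fin n)) : run (l ++ m) X = run m (run l X) := by
  induction l generalizing X with
  | nil => rfl
  | cons i l ih => simp [run, ih]

/-- descending initial part -/
def pf (N m : ℕ) : List ℕ := (List.range m).map (N - ·)

/-- full flip sequence -/
def stg : ℕ → List ℕ
  | 0 => []
  | N + 1 => stg N ++ pf N (N + 1)

lemma run_pf (N : ℕ) (hN : N + 1 < n) (X : Finset (Fin n))
    (h : ∀ x, pp (run (stg N) X) x = if x ≤ N + 1 then min x (pp X (N + 1)) else pp X x) (m : ℕ) (hm : m ≤ N + 1) (x : ℕ) :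
    pp (run (stg N ++ pf N m) X) x = if x ≤ N + 1 - m then min x (pp X (N + 1)) else
      if x ≤ N + 1 then min x (pp X (N + 2)) else pp X x := by
  induction m generalizing x with
  | zero =>
    simp only [pf, List.range_zero, List.map_nil, List.append_nil, Nat.sub_zero]
    rw [h]; split_ifs <;> rfl
  | succ m ih =>
    have e : stg N ++ pf N (m + 1) = (stg N ++ pf N m) ++ [N - m] := by
      simp [pf, List.range_succ]
    rw [e, run_append, run, run, pp_fl _ _ (by omega)]
    have hs : pp X (N + 1) ≤ pp X (N + 2) ∧ pp X (N + 2) ≤ pp X (N + 1) + 1 := pp_step X (N + 1)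
    have h1 := ih (by omega) (N - m)
    have h2 := ih (by omega) (N - m + 2)
    have h3 := ih (by omega) x
    rw [if_pos (by omega)] at h1
    rw [if_neg (by omega)] at h2
    split_ifs with c1 c2 c3 c4 c5
    all_goals try omega
    · rw [h1]
      by_cases hm0 : m = 0
      · rw [if_neg (by omega)] at h2
        rw [h2, show N - m + 2 = N + 2 by omega]; omega
      · rw [if_pos (by omega)] at h2
        rw [h2]; omega
    · rw [h3, if_pos (by omega)]
    all_goals first
      | rw [h3, if_neg (show ¬ (x ≤ N + 1 - m) by omega), if_pos (show x ≤ N + 1 by omega)]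
      | rw [h3, if_neg (show ¬ (x ≤ N + 1 - m) by omega), if_neg (show ¬ x ≤ N + 1 by omega)]

lemma run_stg (N : ℕ) (hN : N + 1 ≤ n) (X : Finset (Fin n)) (x : ℕ) :
    pp (run (stg N) X) x = if x ≤ N + 1 then min x (pp X (N + 1)) else pp X x := by
  induction N generalizing x with
  | zero =>
    simp only [stg, run]
    have := pp_step X 0
    rw [pp_zero, zero_add] at this
    rw [zero_add]
    split_ifs with h
    · interval_cases x
      · simp [pp_zero]
      · simp; omega
    · rfl
  | succ N ih =>
    rw [stg, run_pf N (by omega) X (ih (by omega)) _ le_rfl]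
    have := pp_le X (N + 2)
    split_ifs with h1 h2 h3 h4 <;> try omega
    · rfl
    · have h0 : x = N + 2 := by omega
      subst h0; exact (min_eq_right (by omega)).symm

/-- all rows of a pair as one list -/
def ZZ (P : RL n × RL n) : RL n := P.1.reverse ++ P.2.map compl

lemma flr_compl (a b : Fin n) (hab : a ≠ b) (Y : Finset (Fin n)) : (flr a b Y)ᶜ = flr b a Yᶜ := by
  unfold flr
  by_cases h1 : a ∈ Y <;> by_cases h2 : b ∈ Y <;> simp [h1, h2]
  ext c; simp only [mem_compl, mem_insert, mem_erase]
  by_cases hc : c = a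
  · subst hc; simp [hab]
  · simp [hc]

lemma ZZ_flP (i : ℕ) (P : RL n × RL n) : ZZ (flP i P) = (ZZ P).map (fl i) := by
  unfold flP ZZ fl; split_ifs with h
  · simp only [List.map_append, List.map_reverse, List.map_map]
    congr 2
    funext Y; simp only [Function.comp]
    exact flr_compl _ _ (by simp) Y
  · simp

lemma fcP_ZZ (i : ℕ) (P : RL n × RL n) : fcP i P = ((ZZ P).map (ind i)).sum := by
  unfold fcP ZZ ind; split_ifs with h
  · simp only [List.map_append, List.map_reverse, List.map_map, List.sum_append, List.sum_reverse, fc]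
    congr 2
    apply List.map_congr_left; intro Y _
    simp only [Function.comp, mem_compl, not_not]
    congr 1; rw [and_comm]
  · simp [Function.comp_def]

/-- final state in terms of all rows -/
lemma ZZ_fin (is : List ℕ) (P : RL n × RL n) : ZZ (fin is P) = (ZZ P).map (run is) := by
  induction is generalizing P with
  | nil => simp [fin, run]
  | cons i is ih => rw [fin, ih, ZZ_flP, List.map_map]; rfl

lemma str_eq {l1 l2 : List ℕ} {i : ℕ} {P Q : RL n × RL n} (h : str (l1 ++ i :: l2) P = str (l1 ++ i :: l2) Q) :
    ((ZZ P).map fun X => ind i (run l1 X)).sum = ((ZZ Q).map fun X => ind i (run l1 X)).sum := by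
  induction l1 generalizing P Q with
  | nil =>
    simp only [List.nil_append, str, List.cons.injEq, fcP_ZZ] at h
    exact h.1
  | cons a l1 ih =>
    simp only [List.cons_append, str, List.cons.injEq] at h
    have := ih h.2
    rw [ZZ_flP, ZZ_flP, List.map_map, List.map_map] at this
    exact this

lemma pf_split (N m : ℕ) (h : m ≤ N) : ∃ l2, pf N (N + 1) = pf N m ++ (N - m) :: l2 := by
  obtain ⟨k, rfl⟩ := Nat.exists_eq_add_of_le h
  refine ⟨((List.range k).map (m + 1 + ·)).map (m + k - ·), ?_⟩
  rw [pf, show m + k + 1 = (m + 1) + k by omega, List.range_add, List.range_succ]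
  simp [pf]

lemma stg_split (N M m : ℕ) (h : m ≤ N) (hM : N < M) : ∃ l2, stg M = (stg N ++ pf N m) ++ (N - m) :: l2 := by
  induction M with
  | zero => omega
  | succ M ih =>
    by_cases hNM : N = M
    · subst hNM
      obtain ⟨l2, h2⟩ := pf_split N m h
      exact ⟨l2, by rw [stg, h2, List.append_assoc]⟩
    · obtain ⟨l2, h2⟩ := ih (by omega)
      exact ⟨l2 ++ pf M (M + 1), by rw [stg, h2]; simp⟩

lemma sum_eq_of_add {α : Type*} (L L' : List α) (f g h : α → ℕ) (e : ∀ X, f X + g X = h X)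
    (h1 : (L.map f).sum = (L'.map f).sum) (h2 : (L.map h).sum = (L'.map h).sum) :
    (L.map g).sum = (L'.map g).sum := by
  have key : ∀ L : List α, (L.map f).sum + (L.map g).sum = (L.map h).sum := by
    intro L; induction L with
    | nil => rfl
    | cons X L ih => simp only [List.map_cons, List.sum_cons, ← e, ← ih]; omega
  have := key L; have := key L'; omega

lemma min_sums {P Q : RL n × RL n} (hn : 0 < n) (h : str (stg (n - 1)) P = str (stg (n - 1)) Q)
    (hs : (ZZ P).map card = (ZZ Q).map card) (d : ℕ) (hd : d ≤ n) (j : ℕ) (hj : j ≤ n - d) :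
    ((ZZ P).map fun X => min j (pp X (n - d))).sum = ((ZZ Q).map fun X => min j (pp X (n - d))).sum := by
  induction d generalizing j with
  | zero =>
    have : ∀ Z : RL n, (Z.map fun X => min j (pp X (n - 0))) = (Z.map card).map (min j) := by
      intro Z; rw [List.map_map]; apply List.map_congr_left; intro X _
      rw [Nat.sub_zero, pp_n X le_rfl]; rfl
    rw [this, this, hs]
  | succ d ih =>
    cases j with
    | zero => simp
    | succ j =>
      set N := n - (d + 1) - 1 with hN
      obtain ⟨l2, e⟩ := stg_split N (n - 1) (N - j) (by omega) (by omega)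
      rw [e] at h
      have h1 := str_eq h
      have e1 : N - (N - j) = j := by omega
      rw [e1] at h1
      have hv : n - (d + 1) = N + 1 := by omega
      have hv' : n - d = N + 2 := by omega
      rw [hv]
      refine sum_eq_of_add _ _ _ _ _ ?_ h1 (hv' ▸ ih (by omega) (j + 1) (by omega))
      intro X
      have h2 := ind_fl j (run (stg N ++ pf N (N - j)) X) (by omega)
      have h3 := run_pf N (by omega) X (run_stg N (by omega) X) (N - j) (by omega) (j + 1)
      have h4 := run_pf N (by omega) X (run_stg N (by omega) X) (N - j + 1) (by omega) (j + 1)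
      have e2 : stg N ++ pf N (N - j + 1) = (stg N ++ pf N (N - j)) ++ [j] := by
        simp [pf, List.range_succ]; omega
      rw [e2, run_append, run, run] at h4
      rw [if_pos (by omega)] at h3
      rw [if_neg (by omega), if_pos (by omega)] at h4
      rw [h3, h4] at h2
      exact h2

end comb
end RS

namespace RS
open Finset

section comb2
variable {n : ℕ}

lemma pp_cnt (X : Finset (Fin n)) (x : Fin n) : pp X ((x : ℕ) + 1) = cnt X x := by
  unfold pp cnt; congr 1; apply filter_congr; intro a _; rw [Nat.lt_succ_iff]; rfl

lemma pp_min (X : Finset (Fin n)) (v : ℕ) : pp X v = pp X (min v n) := by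
  rcases le_total v n with h | h
  · rw [min_eq_left h]
  · rw [min_eq_right h, pp_n X h, pp_n X le_rfl]

lemma pp_ind {X Y : Finset (Fin n)} {p : ℕ → ℕ → ℕ → Prop} (h0 : p 0 0 0) (h : ∀ x : Fin n, p (cnt X x) (cnt Y x) (x + 1))
    (v : ℕ) : p (pp X v) (pp Y v) (min v n) := by
  rw [pp_min X v, pp_min Y v]
  rcases Nat.eq_zero_or_pos (min v n) with e | e
  · rw [e, pp_zero, pp_zero]; exact h0
  · have := h ⟨min v n - 1, by omega⟩
    rw [← pp_cnt, ← pp_cnt] at this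
    simp only [show min v n - 1 + 1 = min v n by omega] at this
    exact this

lemma RowStd.pw {L : RL n} (h : RowStd L) : L.Pairwise (fun X Y => ∀ v, pp Y v ≤ pp X v) := by
  have h1 : L.IsChain (fun X Y => ∀ v, pp Y v ≤ pp X v) := by
    refine List.IsChain.imp ?_ h
    intro X Y hh v
    exact pp_ind (p := fun a b _ => b ≤ a) le_rfl hh v
  have : IsTrans (Finset (Fin n)) (fun X Y => ∀ v, pp Y v ≤ pp X v) := ⟨fun a b c h1 h2 v => (h2 v).trans (h1 v)⟩
  exact List.isChain_iff_pairwise.1 h1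

lemma Std.cross {L L' : RL n} (h : Std L L') {X Y : Finset (Fin n)} (hX : X ∈ L) (hY : Y ∈ L') (v : ℕ) :
    pp X v + pp Y v ≤ min v n := by
  obtain ⟨h1, h2, h3⟩ := h
  have h1 := h1.pw
  have h2 := h2.pw
  cases L with
  | nil => simp at hX
  | cons A L =>
    cases L' with
    | nil => simp at hY
    | cons B L' =>
      have h4 := pp_ind (X := A) (Y := B) (p := fun a b c => a + b ≤ c) le_rfl h3 v
      have h5 : pp X v ≤ pp A v := by
        rcases List.mem_cons.1 hX with rfl | hX
        · exact le_rfl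
        · exact (List.pairwise_cons.1 h1).1 X hX v
      have h6 : pp Y v ≤ pp B v := by
        rcases List.mem_cons.1 hY with rfl | hY
        · exact le_rfl
        · exact (List.pairwise_cons.1 h2).1 Y hY v
      omega

lemma Std.ZZ {P : RL n × RL n} (h : Std P.1 P.2) : (ZZ P).Pairwise (fun X Y => ∀ v, pp X v ≤ pp Y v) := by
  rw [RS.ZZ, List.pairwise_append, List.pairwise_reverse, List.pairwise_map]
  refine ⟨h.1.pw, h.2.1.pw.imp ?_, ?_⟩
  · intro X Y hh v
    have := hh v; have := pp_compl X v; have := pp_compl Y v; omega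
  · intro X hX Z hZ v
    obtain ⟨Y, hY, rfl⟩ := List.mem_map.1 hZ
    have := h.cross (List.mem_reverse.1 hX) hY v
    have := pp_compl Y v; omega

lemma ZZ_inj {P Q : RL n × RL n} (hl : P.1.length = Q.1.length) (h : ZZ P = ZZ Q) : P = Q := by
  obtain ⟨h1, h2⟩ := List.append_inj h (by simpa using hl)
  refine Prod.ext (List.reverse_injective h1) (List.map_injective_iff.2 compl_injective h2)

lemma shp_length' {L M : RL n} (h : shp L = shp M) : L.length = M.length := by
  have := congrArg List.length h; simpa [shp] using this

lemma ZZ_card {P Q : RL n × RL n} (h : shp P.1 = shp Q.1) (hsnd : shp P.2 = shp Q.2) :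
    (ZZ P).map card = (ZZ Q).map card := by
  have key : ∀ P : RL n × RL n, (ZZ P).map card = (shp P.1).reverse ++ (shp P.2).map (n - ·) := by
    intro P; simp [ZZ, shp, card_compl]
  rw [key, key, h, hsnd]

/-- uniqueness of standard pairs with given strings -/
lemma std_uniq (hn : 0 < n) {P Q : RL n × RL n} (hP : Std P.1 P.2) (hQ : Std Q.1 Q.2) (h : shp P.1 = shp Q.1)
    (h' : shp P.2 = shp Q.2) (hs : str (stg (n - 1)) P = str (stg (n - 1)) Q) : P = Q := by
  apply ZZ_inj (shp_length' h)
  have hc := ZZ_card h h'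
  have hlen : (ZZ P).length = (ZZ Q).length := by simpa using congrArg List.length hc
  have key : ∀ v ≤ n, (ZZ P).map (fun X => pp X v) = (ZZ Q).map (fun X => pp X v) := by
    intro v hv
    have hp : ((ZZ P).map (fun X => pp X v)).Perm ((ZZ Q).map (fun X => pp X v)) := by
      apply perm_of_min _ _ (by simpa using hlen)
      intro j
      rw [List.map_map, List.map_map]
      have e : (min j ∘ fun X : Finset (Fin n) => pp X v) = fun X => min (min j v) (pp X (n - (n - v))) := by
        funext X; simp only [Function.comp, show n - (n - v) = v by omega]
        have := pp_le X v; omega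
      rw [e]
      exact min_sums hn hs hc (n - v) (by omega) _ (by omega)
    refine hp.eq_of_pairwise' (r := (· ≤ ·)) ?_ ?_
    · exact List.pairwise_map.2 (hP.ZZ.imp fun h => h v)
    · exact List.pairwise_map.2 (hQ.ZZ.imp fun h => h v)
  apply List.ext_getElem hlen
  intro i h1 h2
  apply pp_ext
  intro v hv
  have := key v hv
  have := List.getElem_of_eq this (i := i) (by simpa using h1)
  simpa using this

lemma run_full (hn : 0 < n) (X : Finset (Fin n)) (x : ℕ) : pp (run (stg (n - 1)) X) x = min x X.card := by
  rw [run_stg (n - 1) (by omega), show n - 1 + 1 = n by omega, pp_n X le_rfl]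
  have : X.card ≤ n := by simpa using card_le_univ X
  split_ifs with h
  · rfl
  · rw [pp_n X (by omega)]; omega

lemma run_full_card (hn : 0 < n) (X : Finset (Fin n)) (x : ℕ) :
    pp (run (stg (n - 1)) X) x = min x (run (stg (n - 1)) X).card := by
  rw [run_full hn, ← pp_n (run _ X) le_rfl, run_full hn]
  have : X.card ≤ n := by simpa using card_le_univ X
  omega

lemma fin_mem (hn : 0 < n) (P : RL n × RL n) {X : Finset (Fin n)} (h : X ∈ ZZ (fin (stg (n - 1)) P)) (x : ℕ) :
    pp X x = min x X.card := by
  rw [ZZ_fin] at h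
  obtain ⟨Y, _, rfl⟩ := List.mem_map.1 h
  exact run_full_card hn Y x

lemma fin_eq (hn : 0 < n) {P Q : RL n × RL n} (h : shp P.1 = shp Q.1)
    (h' : shp P.2 = shp Q.2) : fin (stg (n - 1)) P = fin (stg (n - 1)) Q := by
  apply ZZ_inj
  · apply shp_length'; rw [(shp_fin _ _).1, (shp_fin _ _).1, h]
  · have hc := ZZ_card h h'
    have hlen : (ZZ P).length = (ZZ Q).length := by simpa using congrArg List.length hc
    rw [ZZ_fin, ZZ_fin]
    apply List.ext_getElem (by simpa using hlen)
    intro i h1 h2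
    rw [List.getElem_map, List.getElem_map]
    apply pp_ext
    intro x _
    rw [run_full hn, run_full hn]
    have := List.getElem_of_eq hc (i := i) (by simpa using h1)
    simp only [List.getElem_map] at this
    rw [this]

lemma fin_top (hn : 0 < n) (P : RL n × RL n) :
    pw (fin (stg (n - 1)) P).1 - pw (fin (stg (n - 1)) P).2 = top n (shp P.1) (shp P.2) := by
  rw [← (shp_fin (stg (n - 1)) P).1, ← (shp_fin (stg (n - 1)) P).2]
  have key := fun X h x => fin_mem hn P (X := X) h x
  generalize fin (stg (n - 1)) P = Q at *
  funext x
  rw [Pi.sub_apply, pw_apply, pw_apply, top, shp, shp, List.map_map, List.map_map]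
  congr 2
  · apply List.map_congr_left
    intro X hX
    rw [key X (by simp [ZZ, hX])]; rfl
  · apply List.map_congr_left
    intro Y hY
    have h1 := key Yᶜ (by rw [ZZ, List.mem_append]; right; exact List.mem_map_of_mem hY) x
    have h2 := pp_compl Y x
    rw [card_compl, Fintype.card_fin] at h1
    simp only [Function.comp]
    omega

lemma sum_ite_zero {l : List ℕ} {p : ℕ → Prop} [DecidablePred p] (h : ∀ a ∈ l, ¬ p a) :
    (l.map fun a => if p a then 1 else 0).sum = 0 := by
  induction l with
  | nil => rfl
  | cons a l ih =>
    simp only [List.map_cons, List.sum_cons]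
    rw [if_neg (h a (by simp)), ih fun b hb => h b (by simp [hb])]

lemma top_cast (l l' : List ℕ) (x : ℕ) : top n l l' x = ((l.map fun a => min x a).sum : ℕ) -
    ((l'.map fun b => min x n - min x (n - b)).sum : ℕ) := by
  rw [top]
  congr 1
  · induction l with
    | nil => rfl
    | cons a l ih => simp only [List.map_cons, List.sum_cons, ih]; push_cast; rfl
  · induction l' with
    | nil => rfl
    | cons a l ih =>
      simp only [List.map_cons, List.sum_cons, ih]; push_cast [show min x (n - a) ≤ min x n by omega]; rfl

lemma sum_step (l : List ℕ) (f g h : ℕ → ℕ) (e : ∀ a ∈ l, f a = g a + h a) :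
    (l.map f).sum = (l.map g).sum + (l.map h).sum := by
  rw [← List.sum_map_add]; congr 1; exact List.map_congr_left e

lemma top_det {l l' m m' : List ℕ} (hl : ∀ a ∈ l, ∀ b ∈ l', a + b ≤ n) (hm : ∀ a ∈ m, ∀ b ∈ m', a + b ≤ n)
    (bl' : ∀ b ∈ l', b ≤ n) (bm' : ∀ b ∈ m', b ≤ n)
    (h : top n l l' = top n m m') (x : ℕ) (hx : x ≤ n) :
    (l.map fun a => min x a).sum = (m.map fun a => min x a).sum ∧
    (l'.map fun b => min x n - min x (n - b)).sum = (m'.map fun b => min x n - min x (n - b)).sum := by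
  induction x with
  | zero => simp
  | succ x ih =>
    obtain ⟨i1, i2⟩ := ih (by omega)
    have h1 := congrFun h (x + 1)
    rw [top_cast, top_cast] at h1
    have e1 : ∀ l : List ℕ, (l.map fun a => min (x + 1) a).sum = (l.map fun a => min x a).sum +
        (l.map fun a => if x < a then 1 else 0).sum := by
      intro l; apply sum_step; intro a _; split_ifs <;> omega
    have e2 : ∀ l : List ℕ, (∀ b ∈ l, b ≤ n) → (l.map fun b => min (x + 1) n - min (x + 1) (n - b)).sum =
        (l.map fun b => min x n - min x (n - b)).sum + (l.map fun b => if n - b ≤ x then 1 else 0).sum := by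
      intro l hb; apply sum_step; intro a ha
      have := hb a ha
      split_ifs <;> omega
    have e3 : ∀ l l' : List ℕ, (∀ a ∈ l, ∀ b ∈ l', a + b ≤ n) → 
        (l.map fun a => if x < a then 1 else 0).sum = 0 ∨ (l'.map fun b => if n - b ≤ x then 1 else 0).sum = 0 := by
      intro l l' hh
      by_cases hc : ∃ a ∈ l, x < a
      · obtain ⟨a, ha, hxa⟩ := hc
        right; apply sum_ite_zero; intro b hb; have := hh a ha b hb; omega
      · left; apply sum_ite_zero; intro a ha hxa; exact hc ⟨a, ha, hxa⟩
    have c1 := e3 _ _ hl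
    have c2 := e3 _ _ hm
    rw [e1 l, e1 m, e2 l' bl', e2 m' bm'] at h1 ⊢
    rw [i1, i2] at h1 ⊢
    omega

lemma shape_det {l l' m m' : List ℕ} (hl : ∀ a ∈ l, ∀ b ∈ l', a + b ≤ n) (hm : ∀ a ∈ m, ∀ b ∈ m', a + b ≤ n)
    (bl : ∀ b ∈ l, b ≤ n) (bm : ∀ b ∈ m, b ≤ n)
    (bl' : ∀ b ∈ l', b ≤ n) (bm' : ∀ b ∈ m', b ≤ n) (sl : l.Pairwise (· ≥ ·)) (sm : m.Pairwise (· ≥ ·))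
    (sl' : l'.Pairwise (· ≥ ·)) (sm' : m'.Pairwise (· ≥ ·))
    (h : top n l l' = top n m m') : l.sum = m.sum ∧ l'.sum = m'.sum ∧ (l.length = m.length → l = m) ∧
      (l'.length = m'.length → l' = m') := by
  have hd := top_det hl hm bl' bm' h
  have k0 : ∀ (l : List ℕ), (∀ b ∈ l, b ≤ n) → ∀ j, (l.map fun b => min j b).sum = (l.map fun b => min (min j n) b).sum := by
    intro l hb j; congr 1; apply List.map_congr_left; intro b h1; have := hb b h1; omega
  have A1 : ∀ j, (l.map (min j)).sum = (m.map (min j)).sum := by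
    intro j
    have := (hd (min j n) (by omega)).1
    rw [← k0 l bl, ← k0 m bm] at this; exact this
  have k1 : ∀ (l : List ℕ), (∀ b ∈ l, b ≤ n) → ∀ j, (l.map fun b => min n n - min n (n - b)).sum =
      (l.map fun b => min j b).sum + (l.map fun b => min (n - j) n - min (n - j) (n - b)).sum := by
    intro l hb j; apply sum_step; intro b h1; have := hb b h1; omega
  have A2 : ∀ j, (l'.map (min j)).sum = (m'.map (min j)).sum := by
    intro j
    have h1 := k1 l' bl' j
    have h2 := k1 m' bm' j
    have h3 := (hd n le_rfl).2
    have h4 := (hd (n - j) (by omega)).2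
    rw [h3, h4] at h1
    have : (l'.map fun b => min j b).sum = (m'.map fun b => min j b).sum := by omega
    exact this
  have k2 : ∀ (l : List ℕ), (∀ b ∈ l, b ≤ n) → (l.map (min n)).sum = l.sum := by
    intro l hb
    conv_rhs => rw [← List.map_id l]
    congr 1; apply List.map_congr_left; intro b h1; have := hb b h1; simp; omega
  refine ⟨?_, ?_, ?_, ?_⟩
  · rw [← k2 l bl, ← k2 m bm, A1]
  · rw [← k2 l' bl', ← k2 m' bm', A2]
  · intro hh; exact (perm_of_min _ _ hh A1).eq_of_pairwise' sl sm
  · intro hh; exact (perm_of_min _ _ hh A2).eq_of_pairwise' sl' sm'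

lemma shp_le {L : RL n} : ∀ b ∈ shp L, b ≤ n := by
  intro b hb; simp only [shp, List.mem_map] at hb
  obtain ⟨X, _, rfl⟩ := hb; simpa using card_le_univ X

lemma RowStd.sorted {L : RL n} (h : RowStd L) : (shp L).Pairwise (· ≥ ·) := by
  rw [shp, List.pairwise_map]
  refine h.pw.imp ?_
  intro X Y hh; have := hh n; rwa [pp_n _ le_rfl, pp_n _ le_rfl] at this

lemma Std.sum_le {L L' : RL n} (h : Std L L') : ∀ a ∈ shp L, ∀ b ∈ shp L', a + b ≤ n := by
  intro a ha b hb
  simp only [shp, List.mem_map] at ha hb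
  obtain ⟨X, hX, rfl⟩ := ha
  obtain ⟨Y, hY, rfl⟩ := hb
  have := h.cross hX hY n
  rw [pp_n _ le_rfl, pp_n _ le_rfl] at this; omega

/-- the shape and the size are determined by the top weight -/
lemma std_shape {r s k k' : ℕ} (hk : k ≤ min r s) (hk' : k' ≤ min r s) {S T : RL n × RL n} (hS : Std S.1 S.2) (hT : Std T.1 T.2)
    (h1 : Sz (r - k) S.1) (h2 : Sz (s - k) S.2) (h3 : Sz (r - k') T.1) (h4 : Sz (s - k') T.2)
    (h : top n (shp S.1) (shp S.2) = top n (shp T.1) (shp T.2)) : k = k' ∧ shp S.1 = shp T.1 ∧ shp S.2 = shp T.2 := by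
  obtain ⟨a1, a2, a3, a4⟩ := shape_det hS.sum_le hT.sum_le shp_le shp_le shp_le shp_le hS.1.sorted hT.1.sorted
    hS.2.1.sorted hT.2.1.sorted h
  have hkk : k = k' := by
    have := h1.2; have := h3.2; omega
  subst hkk
  refine ⟨rfl, a3 ?_, a4 ?_⟩
  · simp [shp, h1.1, h3.1]
  · simp [shp, h2.1, h4.1]

end comb2
end RS

namespace RS
open Finset TensorProduct

lemma surj_of_tri {R : Type*} [CommRing R] {ι κ : Type*} [Fintype ι] [LinearOrder κ] (key : ι → κ)
    (hi : Function.Injective key) (M : Matrix ι ι R) (h : ∀ i j, M i j ≠ 0 → key j ≤ key i) (hd : ∀ i, IsUnit (M i i))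
    (y : ι → R) : ∃ x, M.mulVec x = y := by
  classical
  letI : LinearOrder ι := LinearOrder.lift' key hi
  have hu : IsUnit M.det := by
    rw [Matrix.det_of_lowerTriangular M]
    · exact IsUnit.prod_univ_iff.2 hd
    · intro i j hij
      by_contra hc
      have h1 := h i j hc
      have h2 : key i < key j := hij
      exact absurd h2 (not_lt.2 h1)
  refine ⟨M⁻¹.mulVec y, ?_⟩
  rw [Matrix.mulVec_mulVec, Matrix.mul_nonsing_inv _ hu, Matrix.one_mulVec]

/-- index set -/
abbrev BT (n r s : ℕ) := {B : Fin (min r s + 1) × (RL n × RL n) × (RL n × RL n) //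
  Sz (r - B.1) B.2.1.1 ∧ Sz (s - B.1) B.2.1.2 ∧ shp B.2.2.1 = shp B.2.1.1 ∧ shp B.2.2.2 = shp B.2.1.2 ∧
    Std B.2.1.1 B.2.1.2 ∧ Std B.2.2.1 B.2.2.2}

instance BT_fin (n r s : ℕ) : Finite (BT n r s) := by
  have f : ∀ m, {l : RL n | l.length ≤ m}.Finite := fun m => List.finite_length_le _ m
  have g := ((Set.finite_univ (α := Fin (min r s + 1))).prod (((f r).prod (f s)).prod ((f r).prod (f s))))
  refine Set.Finite.subset g ?_
  rintro ⟨k, ⟨S, S'⟩, ⟨T, T'⟩⟩ ⟨h1, h2, h3, h4, -, -⟩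
  have h3 := shp_length' h3
  have h4 := shp_length' h4
  have := h1.1; have := h2.1
  simp only [Set.mem_prod, Set.mem_univ, Set.mem_setOf_eq, true_and] at *
  omega

section asm
variable {R : Type*} [CommRing R] (θ : Rˣ) {n : ℕ} [NeZero n]

/-- evaluation map -/
noncomputable def ev (r s : ℕ) : CR (n := n) θ r s →ₗ[R] (BT n r s → R) where
  toFun φ B := NN θ ((Phi θ)^[B.1.1] φ.1) B.1.2.1 B.1.2.2
  map_add' φ ψ := by
    funext B
    simp only [Pi.add_apply, NN, ← Module.End.coe_pow, Submodule.coe_add, map_add, LinearMap.add_apply]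
  map_smul' c φ := by
    funext B
    simp only [Pi.smul_apply, NN, ← Module.End.coe_pow, Submodule.coe_smul, map_smul, LinearMap.smul_apply,
      RingHom.id_apply]

/-- candidate preimages -/
noncomputable def cb (r s : ℕ) (B : BT n r s) : CR (n := n) θ r s :=
  ⟨psi θ (stg (n - 1)) B.1.2.1 B.1.2.2 * prs r s, GG_CR θ (psi_GG θ _ _ _) r s⟩

lemma ev_cb (r s : ℕ) (B C : BT n r s) :
    ev θ r s (cb θ r s C) B = NN θ (psi θ (stg (n - 1)) C.1.2.1 C.1.2.2) B.1.2.1 B.1.2.2 := by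
  have hk : (B.1.1 : ℕ) ≤ min r s := by omega
  simp only [ev, cb, LinearMap.coe_mk, AddHom.coe_mk]
  rw [Phi_GG_iter θ (psi_GG θ _ _ _) _ _ _ hk, NN, NN, Module.End.mul_apply, prs_bs, wd_length, wd_length,
    if_pos]
  exact ⟨B.2.1.2, B.2.2.1.2⟩

theorem ev_bij (r s : ℕ) : Function.Bijective (ev (n := n) θ r s) := by
  classical
  have hn : 0 < n := Nat.pos_of_ne_zero (NeZero.ne n)
  cases nonempty_fintype (BT n r s)
  constructor
  · intro φ ψ hh
    have h : ev θ r s (φ + (-1 : R) • ψ) = 0 := by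
      rw [map_add, map_smul, hh]; funext B; simp
    have e : (φ + (-1 : R) • ψ).1 = 0 := by
      refine inj_main θ r s _ (φ + (-1 : R) • ψ).2 ?_
      intro k hk S S' T T' h1 h2 h3 h4 h5 h6
      exact congrFun h (⟨(⟨k, by omega⟩, (S, S'), (T, T')), h1, h2, h3, h4, h5, h6⟩ : BT n r s)
    apply Subtype.ext
    calc φ.1 = φ.1 + ((-1 : R) + 1) • ψ.1 := by rw [neg_add_cancel, zero_smul, add_zero]
      _ = (φ + (-1 : R) • ψ).1 + ψ.1 := by rw [add_smul, one_smul, ← add_assoc]; rfl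
      _ = ψ.1 := by rw [e, zero_add]
  · intro y
    let key : BT n r s → (Lex (ℕ → ℤ)) ×ₗ (List ℕ ×ₗ List ℕ) := fun B =>
      toLex (toLex (top n (shp B.1.2.1.1) (shp B.1.2.1.2)), toLex (str (stg (n - 1)) B.1.2.1, str (stg (n - 1)) B.1.2.2))
    have hkey : Function.Injective key := by
      rintro ⟨⟨k, S, T⟩, h1, h2, h3, h4, h5, h6⟩ ⟨⟨k', S', T'⟩, g1, g2, g3, g4, g5, g6⟩ h
      simp only [key] at h
      have h := toLex.injective h
      obtain ⟨a, b⟩ := Prod.ext_iff.1 h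
      have a := toLex.injective a
      obtain ⟨b, c⟩ := Prod.ext_iff.1 (toLex.injective b)
      simp only at *
      obtain ⟨e1, e2, e3⟩ := std_shape (r := r) (s := s) (by omega) (by omega) h5 g5 h1 h2 g1 g2 a
      have e4 : S = S' := std_uniq hn h5 g5 e2 e3 b
      have e5 : T = T' := std_uniq hn h6 g6 (by rw [h3, e2, g3]) (by rw [h4, e3, g4]) c
      have e6 : k = k' := Fin.ext e1
      subst e4 e5 e6; rfl
    obtain ⟨x, hx⟩ := surj_of_tri key hkey (Matrix.of fun B C => ev θ r s (cb θ r s C) B) (by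
      intro B C hne
      rw [Matrix.of_apply, ev_cb] at hne
      obtain ⟨a, b, c⟩ := NN_ne θ _ _ _ _ _ B.2.2.2.1.symm B.2.2.2.2.1.symm hne
      exact Prod.Lex.toLex_mono ⟨Pi.toLex_monotone a, Prod.Lex.toLex_mono ⟨b, c⟩⟩) (by
      intro B
      rw [Matrix.of_apply, ev_cb]
      exact NN_diag θ _ _ _ B.2.2.2.1.symm B.2.2.2.2.1.symm (fin_eq hn B.2.2.2.1.symm B.2.2.2.2.1.symm) (fin_top hn _)) y
    refine ⟨∑ C, x C • cb θ r s C, ?_⟩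
    rw [← hx]
    funext B
    simp only [map_sum, map_smul, Finset.sum_apply, Pi.smul_apply, Matrix.mulVec, dotProduct, Matrix.of_apply, smul_eq_mul]
    exact Finset.sum_congr rfl fun C _ => mul_comm _ _

/-- basis of the abstract centralizer -/
noncomputable def CRbasis (r s : ℕ) : Module.Basis (BT n r s) R (CR (n := n) θ r s) :=
  haveI := Fintype.ofFinite (BT n r s)
  Module.Basis.ofEquivFun (LinearEquiv.ofBijective (ev θ r s) (ev_bij θ r s))

end asm
end RS

namespace RS
open Finset TensorProduct

section bdry
variable {R : Type*} [CommRing R] (θ : Rˣ) {n : ℕ}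

lemma SS_short (t : ℕ) (w : W n) (h : w.length ≤ t + 1) : SS θ t (bs w) = 0 := by
  induction t generalizing w with
  | zero =>
    match w with
    | [] => exact S0_nil θ
    | [a] => exact S0_one θ a
    | a :: b :: u => simp at h
  | succ t ih =>
    match w with
    | [] => simp [SS]
    | a :: u =>
      simp only [List.length_cons] at h
      rw [SS, shift_bs_cons, ih u (by omega), map_zero]

lemma SS_bs (t : ℕ) (w : W n) (h : t + 1 < w.length) : SS θ t (bs w) =
    if w[t] = w[t + 1] then (-((θ⁻¹ : Rˣ) : R)) • bs w
      else if w[t + 1] < w[t] then bs ((w.set t w[t + 1]).set (t + 1) w[t])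
      else bs ((w.set t w[t + 1]).set (t + 1) w[t]) + ((θ : R) - ((θ⁻¹ : Rˣ) : R)) • bs w := by
  induction t generalizing w with
  | zero =>
    match w with
    | [] => simp at h
    | [a] => simp at h
    | a :: b :: u => rw [SS, S0_cons]; simp
  | succ t ih =>
    match w with
    | [] => simp at h
    | a :: u =>
      simp only [List.length_cons] at h
      rw [SS, shift_bs_cons, ih u (by omega)]
      simp only [List.getElem_cons_succ, List.set_cons_succ]
      split_ifs <;> simp [cs_bs]

lemma swap_perm (t : ℕ) (w : W n) (h : t + 1 < w.length) : ((w.set t w[t + 1]).set (t + 1) w[t]).Perm w := by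
  induction t generalizing w with
  | zero =>
    match w with
    | [] => simp at h
    | [a] => simp at h
    | a :: b :: u => simpa using List.Perm.swap a b u
  | succ t ih =>
    match w with
    | [] => simp at h
    | a :: u =>
      simp only [List.length_cons] at h
      simpa using ih u (by omega)

/-- weight factor -/
def dv (v : W n) : Rˣ := θ ^ (v.map Fin.val).sum

lemma dv_perm {v w : W n} (h : v.Perm w) : dv θ v = dv θ w := by
  unfold dv; rw [(h.map _).sum_eq]

lemma dv_cons (a : Fin n) (v : W n) : dv θ (a :: v) = θ ^ (a : ℕ) * dv θ v := by
  simp [dv, pow_add]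

variable {r s : ℕ}

/-- reversed word of the V-part -/
def xw (r s : ℕ) (j : Fin (r + s) → Fin n) : W n := List.ofFn fun i : Fin r => j ⟨r - 1 - i, by omega⟩
/-- word of the dual part -/
def yw (r s : ℕ) (j : Fin (r + s) → Fin n) : W n := List.ofFn fun i : Fin s => j ⟨r + i, by omega⟩

@[simp] lemma xw_length (j : Fin (r + s) → Fin n) : (xw r s j).length = r := by simp [xw]
@[simp] lemma yw_length (j : Fin (r + s) → Fin n) : (yw r s j).length = s := by simp [yw]
lemma xw_get (j : Fin (r + s) → Fin n) (i : ℕ) (h : i < (xw r s j).length) :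
    (xw r s j)[i] = j ⟨r - 1 - i, by simp at h; omega⟩ := by simp [xw]
lemma yw_get (j : Fin (r + s) → Fin n) (i : ℕ) (h : i < (yw r s j).length) :
    (yw r s j)[i] = j ⟨r + i, by simp at h; omega⟩ := by simp [yw]

lemma swap_get (j : Fin (r + s) → Fin n) (p : ℕ) (hp : p + 1 < r + s) (x : Fin (r + s)) :
    swapIdx j p hp x = if (x : ℕ) = p + 1 then j ⟨p, by omega⟩ else if (x : ℕ) = p then j ⟨p + 1, hp⟩ else j x := by
  simp only [swapIdx, Function.update_apply, Fin.ext_iff]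

lemma xw_swap (j : Fin (r + s) → Fin n) (p : ℕ) (hp : p + 1 < r) : xw r s (swapIdx j p (by omega)) =
    ((xw r s j).set (r - 2 - p) (j ⟨p, by omega⟩)).set (r - 2 - p + 1) (j ⟨p + 1, by omega⟩) := by
  apply List.ext_getElem (by simp)
  intro i h1 h2
  rw [xw_get, swap_get]
  simp only [List.getElem_set, xw_get]
  simp only [xw_length] at h1
  split_ifs <;> first | rfl | omega

lemma yw_swap' (j : Fin (r + s) → Fin n) (p : ℕ) (hp : p + 1 < r) : yw r s (swapIdx j p (by omega)) = yw r s j := by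
  apply List.ext_getElem (by simp)
  intro i h1 h2
  rw [yw_get, yw_get, swap_get]
  simp only
  rw [if_neg (by omega), if_neg (by omega)]

lemma yw_swap (j : Fin (r + s) → Fin n) (p : ℕ) (hp : p + 1 < s) : yw r s (swapIdx j (r + p) (by omega)) =
    ((yw r s j).set p (j ⟨r + p + 1, by omega⟩)).set (p + 1) (j ⟨r + p, by omega⟩) := by
  apply List.ext_getElem (by simp)
  intro i h1 h2
  rw [yw_get, swap_get]
  simp only [List.getElem_set, yw_get]
  simp only [yw_length] at h1
  split_ifs <;> first | rfl | omega

lemma xw_swap' (j : Fin (r + s) → Fin n) (p : ℕ) (hp : p + 1 < s) :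
    xw r s (swapIdx j (r + p) (by omega)) = xw r s j := by
  apply List.ext_getElem (by simp)
  intro i h1 h2
  rw [xw_get, xw_get, swap_get]
  simp only [xw_length] at h1
  simp only
  rw [if_neg (by omega), if_neg (by omega)]

/-- multi-index from words -/
def jw [NeZero n] (r s : ℕ) (u v : W n) : Fin (r + s) → Fin n := fun i =>
  if (i : ℕ) < r then u.getD (r - 1 - i) 0 else v.getD (i - r) 0

lemma jw_xy [NeZero n] (j : Fin (r + s) → Fin n) : jw r s (xw r s j) (yw r s j) = j := by
  funext i
  unfold jw
  split_ifs with h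
  · rw [List.getD_eq_getElem _ _ (by simp; omega), xw_get]
    congr 1; ext; simp only; omega
  · rw [List.getD_eq_getElem _ _ (by simp; omega), yw_get]
    congr 1; ext; simp only; omega

lemma xw_jw [NeZero n] (u v : W n) (hu : u.length = r) : xw r s (jw r s u v) = u := by
  apply List.ext_getElem (by simp [hu])
  intro i h1 h2
  rw [xw_get, jw]
  simp only [xw_length] at h1
  rw [if_pos (by simp only; omega), List.getD_eq_getElem _ _ (by simp only; omega)]
  congr 1; simp only; omega

lemma yw_jw [NeZero n] (u v : W n) (hv : v.length = s) : yw r s (jw r s u v) = v := by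
  apply List.ext_getElem (by simp [hv])
  intro i h1 h2
  rw [yw_get, jw]
  simp only [yw_length] at h1
  rw [if_neg (by simp only; omega), List.getD_eq_getElem _ _ (by simp only; omega)]
  congr 1; simp only; omega

/-- comparison map -/
noncomputable def Xi (r s : ℕ) : Mx R n (r + s) →ₗ[R] TT R n :=
  lc fun j => ((dv θ (yw r s j) : Rˣ) : R) • (bs (xw r s j) ⊗ₜ bs (yw r s j))

/-- its one-sided inverse -/
noncomputable def Xj [NeZero n] (r s : ℕ) : TT R n →ₗ[R] Mx R n (r + s) :=
  (lc fun w : W n × W n => if w.1.length = r ∧ w.2.length = s then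
    (((dv θ w.2)⁻¹ : Rˣ) : R) • bs (jw r s w.1 w.2) else 0) ∘ₗ et.toLinearMap

lemma Xi_bs (j : Fin (r + s) → Fin n) : Xi θ r s (bs j) =
    ((dv θ (yw r s j) : Rˣ) : R) • (bs (xw r s j) ⊗ₜ bs (yw r s j)) := by simp [Xi]

lemma Xj_bs [NeZero n] (u v : W n) : Xj θ r s (bs u ⊗ₜ bs v) = if u.length = r ∧ v.length = s then
    (((dv θ v)⁻¹ : Rˣ) : R) • bs (jw r s u v) else 0 := by simp [Xj]

lemma Xj_Xi [NeZero n] : Xj θ r s ∘ₗ Xi θ r s = (LinearMap.id : Mx R n (r + s) →ₗ[R] _) := by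
  apply ext_bs; intro j
  rw [LinearMap.comp_apply, Xi_bs, map_smul, Xj_bs, if_pos (by simp), smul_smul, Units.mul_inv, one_smul, jw_xy]; rfl

lemma Xi_Xj [NeZero n] : Xi θ r s ∘ₗ Xj θ r s = prs (R := R) (n := n) r s := by
  apply ext_tt; intro u v
  rw [LinearMap.comp_apply, Xj_bs, prs_bs]
  split_ifs with h
  · rw [map_smul, Xi_bs, xw_jw _ _ h.1, yw_jw _ _ h.2, smul_smul, Units.inv_mul, one_smul]
  · simp

lemma prs_Xi [NeZero n] : prs (R := R) (n := n) r s ∘ₗ Xi θ r s = Xi θ r s := by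
  rw [← Xi_Xj θ, LinearMap.comp_assoc, Xj_Xi, LinearMap.comp_id]
lemma Xj_prs [NeZero n] : Xj θ r s ∘ₗ prs (R := R) (n := n) r s = Xj θ r s := by
  rw [← Xi_Xj θ, ← LinearMap.comp_assoc, Xj_Xi, LinearMap.id_comp]

lemma Xj_of_Xi [NeZero n] {g : Module.End R (TT R n)} {h : Module.End R (Mx R n (r + s))}
    (hg : g * prs r s = prs r s * g) (e : g ∘ₗ Xi θ r s = Xi θ r s ∘ₗ h) : Xj θ r s ∘ₗ g = h ∘ₗ Xj θ r s := by
  calc Xj θ r s ∘ₗ g = Xj θ r s ∘ₗ (prs r s * g) := by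
        rw [Module.End.mul_eq_comp, ← LinearMap.comp_assoc, Xj_prs]
    _ = Xj θ r s ∘ₗ (g ∘ₗ Xi θ r s) ∘ₗ Xj θ r s := by rw [← hg, LinearMap.comp_assoc, Xi_Xj]; rfl
    _ = (Xj θ r s ∘ₗ Xi θ r s) ∘ₗ h ∘ₗ Xj θ r s := by rw [e]; simp only [LinearMap.comp_assoc]
    _ = _ := by rw [Xj_Xi, LinearMap.id_comp]

end bdry

section gen
variable {R : Type*} [CommRing R] (q : Rˣ) {n : ℕ} {r s : ℕ}

lemma lxSS_Xi (p : ℕ) (hp : p + 1 < r) : lx (SS (-q) (r - 2 - p)) ∘ₗ Xi (-q) r s =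
    Xi (n := n) (-q) r s ∘ₗ heckeOpX R q n (r + s) p (by omega) := by
  apply ext_bs; intro j
  rw [LinearMap.comp_apply, LinearMap.comp_apply, Xi_bs, map_smul, lx_tmul, SS_bs _ _ _ (by simp; omega)]
  have e1 : (xw r s j)[r - 2 - p]'(by simp; omega) = j ⟨p + 1, by omega⟩ := by
    rw [xw_get]; congr 1; ext; simp only; omega
  have e2 : (xw r s j)[r - 2 - p + 1]'(by simp; omega) = j ⟨p, by omega⟩ := by
    rw [xw_get]; congr 1; ext; simp only; omega
  rw [e1, e2, ← xw_swap j p hp]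
  have e3 : heckeOpX R q n (r + s) p (by omega) (bs j) = if j ⟨p, by omega⟩ = j ⟨p + 1, by omega⟩ then
      ((q⁻¹ : Rˣ) : R) • bs j
    else if j ⟨p, by omega⟩ < j ⟨p + 1, by omega⟩ then
      bs (swapIdx j p (by omega))
    else
      bs (swapIdx j p (by omega)) + (((q⁻¹ : Rˣ) : R) - (q : R)) • bs j := by
    simp only [heckeOpX, bs, Finsupp.linearCombination_single, one_smul]
  rw [e3]
  simp only [eq_comm (a := j ⟨p + 1, by omega⟩)]
  split_ifs
  · rw [map_smul, Xi_bs, smul_comm, ← TensorProduct.smul_tmul', inv_neg]; simp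
  · rw [Xi_bs, yw_swap' j p hp]
  · rw [map_add, map_smul, Xi_bs, Xi_bs, yw_swap' j p hp, TensorProduct.add_tmul, smul_add, ← TensorProduct.smul_tmul',
      smul_comm, inv_neg]
    congr 2; simp; ring

lemma lySS_Xi (p : ℕ) (hp : p + 1 < s) : ly (SS (-q) p) ∘ₗ Xi (-q) r s =
    Xi (n := n) (-q) r s ∘ₗ heckeOpStar R q n (r + s) (r + p) (by omega) := by
  apply ext_bs; intro j
  rw [LinearMap.comp_apply, LinearMap.comp_apply, Xi_bs, map_smul, ly_tmul, SS_bs _ _ _ (by simp; omega)]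
  have hper := swap_perm p (yw r s j) (by simp; omega)
  have e1 : (yw r s j)[p]'(by simp; omega) = j ⟨r + p, by omega⟩ := by rw [yw_get]
  have e2 : (yw r s j)[p + 1]'(by simp; omega) = j ⟨r + p + 1, by omega⟩ := by rw [yw_get]; rfl
  rw [e1, e2, ← yw_swap j p hp] at hper ⊢
  have hdv := dv_perm (-q) hper
  have e3 : heckeOpStar R q n (r + s) (r + p) (by omega) (bs j) = if j ⟨r + p, by omega⟩ = j ⟨r + p + 1, by omega⟩ then
      ((q⁻¹ : Rˣ) : R) • bs j
    else if j ⟨r + p + 1, by omega⟩ < j ⟨r + p, by omega⟩ then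
      bs (swapIdx j (r + p) (by omega))
    else
      bs (swapIdx j (r + p) (by omega)) + (((q⁻¹ : Rˣ) : R) - (q : R)) • bs j := by
    simp only [heckeOpStar, bs, Finsupp.linearCombination_single, one_smul]
  rw [e3]
  split_ifs
  · rw [map_smul, Xi_bs, smul_comm, TensorProduct.tmul_smul, inv_neg]; simp
  · rw [Xi_bs, xw_swap' j p hp, hdv]
  · rw [map_add, map_smul, Xi_bs, Xi_bs, xw_swap' j p hp, hdv, TensorProduct.tmul_add, smul_add, TensorProduct.tmul_smul,
      smul_comm, inv_neg]
    congr 2; simp; ring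

lemma lxSS_Xi0 (t : ℕ) (h : r ≤ t + 1) : lx (SS (-q) t) ∘ₗ Xi (n := n) (-q) r s = 0 := by
  apply ext_bs; intro j
  rw [LinearMap.comp_apply, Xi_bs, map_smul, lx_tmul, SS_short _ _ _ (by simpa using h)]; simp

lemma lySS_Xi0 (t : ℕ) (h : s ≤ t + 1) : ly (SS (-q) t) ∘ₗ Xi (n := n) (-q) r s = 0 := by
  apply ext_bs; intro j
  rw [LinearMap.comp_apply, Xi_bs, map_smul, ly_tmul, SS_short _ _ _ (by simpa using h)]; simp

lemma lxpr_Xi (t : ℕ) : lx (pr t) ∘ₗ Xi (-q) r s = Xi (n := n) (-q) r s ∘ₗ (if r = t then 1 else 0) := by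
  apply ext_bs; intro j
  rw [LinearMap.comp_apply, LinearMap.comp_apply, Xi_bs, map_smul, lx_tmul, pr_bs, xw_length]
  split_ifs
  · rw [Module.End.one_apply, Xi_bs]
  · simp

lemma lypr_Xi (t : ℕ) : ly (pr t) ∘ₗ Xi (-q) r s = Xi (n := n) (-q) r s ∘ₗ (if s = t then 1 else 0) := by
  apply ext_bs; intro j
  rw [LinearMap.comp_apply, LinearMap.comp_apply, Xi_bs, map_smul, ly_tmul, pr_bs, yw_length]
  split_ifs
  · rw [Module.End.one_apply, Xi_bs]
  · simp

lemma xw_succ (j : Fin (r + 1 + (s + 1)) → Fin n) : xw (r + 1) (s + 1) j =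
    j ⟨r, by omega⟩ :: List.ofFn fun i : Fin r => j ⟨r - 1 - i, by omega⟩ := by
  rw [xw, List.ofFn_succ]
  congr 1
  congr 1; funext i; congr 1; ext; simp only [Fin.val_succ]; omega

lemma yw_succ (j : Fin (r + 1 + (s + 1)) → Fin n) : yw (r + 1) (s + 1) j =
    j ⟨r + 1, by omega⟩ :: List.ofFn fun i : Fin s => j ⟨r + 2 + i, by omega⟩ := by
  rw [yw, List.ofFn_succ]
  congr 1
  congr 1; funext i; congr 1; ext; simp only [Fin.val_succ]; omega

lemma E_Xi : (((q ^ (1 - (n : ℤ)) : Rˣ) : R) • (io (-q) * po (-q))) ∘ₗ Xi (-q) r s =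
    Xi (n := n) (-q) r s ∘ₗ wallE R q n r s := by
  apply ext_bs; intro j
  rw [LinearMap.comp_apply, LinearMap.comp_apply, Xi_bs, map_smul, LinearMap.smul_apply, Module.End.mul_apply]
  rcases Nat.eq_zero_or_pos r with hr | hr
  · subst hr
    have : xw 0 s j = [] := List.length_eq_zero_iff.1 (by simp)
    rw [this, po_nil1]; simp [wallE]
  rcases Nat.eq_zero_or_pos s with hs | hs
  · subst hs
    have : yw r 0 j = [] := List.length_eq_zero_iff.1 (by simp)
    rw [this, po_nil2]; simp [wallE]
  obtain ⟨r, rfl⟩ := Nat.exists_eq_add_of_le' hr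
  obtain ⟨s, rfl⟩ := Nat.exists_eq_add_of_le' hs
  have e3 : wallE R q n (r + 1) (s + 1) (bs j) = if j ⟨r, by omega⟩ = j ⟨r + 1, by omega⟩ then
        ((q ^ (2 * ((j ⟨r, by omega⟩ : ℕ) : ℤ) + 2 - (n : ℤ) - 1) : Rˣ) : R) •
          ∑ u : Fin n, bs (Function.update (Function.update j ⟨r, by omega⟩ u) ⟨r + 1, by omega⟩ u)
      else 0 := by
    rw [wallE, dif_pos ⟨hr, hs⟩]
    simp only [bs, Finsupp.linearCombination_single, one_smul]
    rfl
  rw [e3, xw_succ, yw_succ, po_cons]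
  split_ifs with h
  · rw [map_smul, map_smul, map_sum, io_tmul, smul_smul, smul_smul, smul_sum, smul_sum]
    apply sum_congr rfl
    intro u _
    rw [Xi_bs, xw_succ, yw_succ, dv_cons, dv_cons, smul_smul, smul_smul, cs_bs, cs_bs]
    have a1 : ∀ i (hi : i < r + 1 + (s + 1)), i ≠ r → i ≠ r + 1 → 
        Function.update (Function.update j ⟨r, by omega⟩ u) ⟨r + 1, by omega⟩ u ⟨i, hi⟩ = j ⟨i, hi⟩ := by
      intro i hi h1 h2
      simp [Function.update_apply, h1, h2]
    have a2 : Function.update (Function.update j ⟨r, by omega⟩ u) ⟨r + 1, by omega⟩ u ⟨r, by omega⟩ = u := by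
      simp [Function.update_apply]
    have a3 : Function.update (Function.update j ⟨r, by omega⟩ u) ⟨r + 1, by omega⟩ u ⟨r + 1, by omega⟩ = u := by
      simp [Function.update_apply]
    have a4 : (List.ofFn fun i : Fin r => Function.update (Function.update j ⟨r, by omega⟩ u) ⟨r + 1, by omega⟩ u
        ⟨r - 1 - i, by omega⟩) = List.ofFn fun i : Fin r => j ⟨r - 1 - i, by omega⟩ := by
      congr 1; funext i; apply a1 <;> omega
    have a5 : (List.ofFn fun i : Fin s => Function.update (Function.update j ⟨r, by omega⟩ u) ⟨r + 1, by omega⟩ u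
        ⟨r + 2 + i, by omega⟩) = List.ofFn fun i : Fin s => j ⟨r + 2 + i, by omega⟩ := by
      congr 1; funext i; apply a1 <;> omega
    rw [a2, a3, a4, a5]
    congr 1
    rw [← h]
    generalize ((j ⟨r, by omega⟩ : Fin n) : ℕ) = a
    generalize dv (-q) (List.ofFn fun i : Fin s => j ⟨r + 2 + i, by omega⟩) = d
    have e : (q ^ (2 * (a : ℤ) + 2 - (n : ℤ) - 1) : Rˣ) = q ^ (1 - (n : ℤ)) * ((-q) ^ a * (-q) ^ a) := by
      rw [← mul_pow, neg_mul_neg, show 2 * (a : ℤ) + 2 - (n : ℤ) - 1 = (1 - (n : ℤ)) + (2 * a : ℕ) by push_cast; ring,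
        zpow_add, zpow_natCast, pow_mul, sq]
    rw [e]; push_cast; ring
  · simp

end gen
end RS

namespace RS
open Finset TensorProduct

section eqv
variable {R : Type*} [CommRing R] (q : Rˣ) {n : ℕ} [NeZero n] {r s : ℕ}

/-- transport to the big space -/
noncomputable def upM (φ : Module.End R (Mx R n (r + s))) : Module.End R (TT R n) :=
  Xi (-q) r s ∘ₗ φ ∘ₗ Xj (-q) r s
/-- transport back -/
noncomputable def dnM (ψ : Module.End R (TT R n)) : Module.End R (Mx R n (r + s)) :=
  Xj (-q) r s ∘ₗ ψ ∘ₗ Xi (-q) r s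

lemma up_comm {g : Module.End R (TT R n)} {h φ : Module.End R (Mx R n (r + s))}
    (hg : g * prs r s = prs r s * g) (e : g ∘ₗ Xi (-q) r s = Xi (-q) r s ∘ₗ h) (hc : h * φ = φ * h) :
    g * upM q φ = upM q φ * g := by
  have e' := Xj_of_Xi (-q) hg e
  calc g * upM q φ = (g ∘ₗ Xi (-q) r s) ∘ₗ φ ∘ₗ Xj (-q) r s := rfl
    _ = Xi (-q) r s ∘ₗ (h * φ) ∘ₗ Xj (-q) r s := by rw [e]; rfl
    _ = Xi (-q) r s ∘ₗ φ ∘ₗ (h ∘ₗ Xj (-q) r s) := by rw [hc]; rfl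
    _ = _ := by rw [← e']; rfl

lemma dn_comm {g ψ : Module.End R (TT R n)} {h : Module.End R (Mx R n (r + s))}
    (hg : g * prs r s = prs r s * g) (e : g ∘ₗ Xi (-q) r s = Xi (-q) r s ∘ₗ h) (hc : g * ψ = ψ * g) :
    h * dnM q ψ = dnM q ψ * h := by
  have e' := Xj_of_Xi (-q) hg e
  calc h * dnM q ψ = (h ∘ₗ Xj (-q) r s) ∘ₗ ψ ∘ₗ Xi (-q) r s := rfl
    _ = Xj (-q) r s ∘ₗ (g * ψ) ∘ₗ Xi (-q) r s := by rw [← e']; rfl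
    _ = Xj (-q) r s ∘ₗ ψ ∘ₗ (g ∘ₗ Xi (-q) r s) := by rw [hc]; rfl
    _ = _ := by rw [e]; rfl

lemma io_po_scale (g : Module.End R (TT R n)) (φ : Module.End R (TT R n)) (c : Rˣ) :
    ((c : R) • g) * φ = φ * ((c : R) • g) ↔ g * φ = φ * g := by
  rw [smul_mul_assoc, mul_smul_comm]
  constructor
  · intro h
    have := congrArg (fun x => ((c⁻¹ : Rˣ) : R) • x) h
    simpa [smul_smul] using this
  · intro h; rw [h]

lemma upM_mem {φ : Module.End R (Mx R n (r + s))} (h : φ ∈ Subalgebra.centralizer R (wallSet R q n r s)) :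
    upM q φ ∈ CR (-q) r s := by
  rw [Subalgebra.mem_centralizer_iff] at h
  have hp := (mem_CB (-q)).1 (prs_CB (n := n) (-q) r s)
  refine ⟨(mem_CB _).2 ⟨?_, ?_, ?_, ?_, ?_⟩, ?_⟩
  · intro t
    by_cases ht : t + 1 < r
    · have e := lxSS_Xi (n := n) (r := r) (s := s) q (r - 2 - t) (by omega)
      rw [show r - 2 - (r - 2 - t) = t by omega] at e
      exact up_comm q (hp.1 t) e (h _ (Or.inr (Or.inl ⟨r - 2 - t, by omega, rfl⟩)))
    · exact up_comm q (hp.1 t) (h := 0) ((lxSS_Xi0 q t (by omega)).trans (LinearMap.comp_zero _).symm) (by simp)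
  · intro t
    by_cases ht : t + 1 < s
    · exact up_comm q (hp.2.1 t) (lySS_Xi q t ht) (h _ (Or.inr (Or.inr ⟨_, ht, rfl⟩)))
    · exact up_comm q (hp.2.1 t) (h := 0) ((lySS_Xi0 q t (by omega)).trans (LinearMap.comp_zero _).symm) (by simp)
  · intro t
    exact up_comm q (hp.2.2.1 t) (lxpr_Xi q t) (by split_ifs <;> simp)
  · intro t
    exact up_comm q (hp.2.2.2.1 t) (lypr_Xi q t) (by split_ifs <;> simp)
  · rw [← io_po_scale _ _ (q ^ (1 - (n : ℤ)))]
    exact up_comm q ((io_po_scale _ _ _).2 hp.2.2.2.2) (E_Xi q) (h _ (Or.inl rfl))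
  · calc upM q φ * prs r s = Xi (-q) r s ∘ₗ φ ∘ₗ (Xj (-q) r s ∘ₗ prs r s) := rfl
      _ = _ := by rw [Xj_prs]; rfl

lemma dnM_mem {ψ : Module.End R (TT R n)} (h : ψ ∈ CR (-q) r s) :
    dnM q ψ ∈ Subalgebra.centralizer R (wallSet R q n r s) := by
  have hp := (mem_CB (-q)).1 (prs_CB (n := n) (-q) r s)
  have hh := (mem_CB (-q)).1 h.1
  rw [Subalgebra.mem_centralizer_iff]
  rintro g (rfl | ⟨p, hp', rfl⟩ | ⟨p, hp', rfl⟩)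
  · exact dn_comm q ((io_po_scale _ _ _).2 hp.2.2.2.2) (E_Xi q) ((io_po_scale _ _ _).2 hh.2.2.2.2)
  · exact dn_comm q (hp.1 _) (lxSS_Xi q p hp') (hh.1 _)
  · exact dn_comm q (hp.2.1 _) (lySS_Xi q p hp') (hh.2.1 _)

lemma dn_up (φ : Module.End R (Mx R n (r + s))) : dnM q (upM q φ) = φ := by
  calc dnM q (upM q φ) = (Xj (-q) r s ∘ₗ Xi (-q) r s) ∘ₗ φ ∘ₗ (Xj (-q) r s ∘ₗ Xi (-q) r s) := rfl
    _ = φ := by rw [Xj_Xi, LinearMap.id_comp, LinearMap.comp_id]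

lemma up_dn {ψ : Module.End R (TT R n)} (h : ψ ∈ CR (-q) r s) : upM q (dnM (r := r) (s := s) q ψ) = ψ := by
  calc upM q (dnM (r := r) (s := s) q ψ) = (Xi (-q) r s ∘ₗ Xj (-q) r s) ∘ₗ ψ ∘ₗ (Xi (-q) r s ∘ₗ Xj (-q) r s) := rfl
    _ = prs r s * (ψ * prs r s) := by rw [Xi_Xj]; rfl
    _ = ψ := by rw [h.2, CB_prs _ h.1, h.2]

variable (R n r s) in
/-- the centralizer is isomorphic to the abstract one -/
noncomputable def cenEquiv : CR (n := n) (-q) r s ≃ₗ[R] Subalgebra.centralizer R (wallSet R q n r s) where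
  toFun ψ := ⟨dnM q ψ.1, dnM_mem q ψ.2⟩
  map_add' a b := by
    apply Subtype.ext
    show dnM q (a.1 + b.1) = dnM q a.1 + dnM q b.1
    simp only [dnM, LinearMap.add_comp, LinearMap.comp_add]
  map_smul' c a := by
    apply Subtype.ext
    show dnM q (c • a.1) = c • dnM q a.1
    simp only [dnM, LinearMap.smul_comp, LinearMap.comp_smul]
  invFun φ := ⟨upM q φ.1, upM_mem q φ.2⟩
  left_inv ψ := Subtype.ext (up_dn q ψ.2)
  right_inv φ := Subtype.ext (dn_up q φ.1)

end eqv
end RS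

namespace RS
open Finset

section tabs
variable {n : ℕ} [NeZero n]

/-- set of entries of a row -/
def rows {p : ℕ → ℕ} (T : Tab n p) (i : ℕ) : Finset (Fin n) := (range (p i)).image (T.entry i)

/-- list of row sets -/
def rl (m : ℕ) {p : ℕ → ℕ} (T : Tab n p) : RL n := (List.range m).map (rows T)

lemma row_inj {p : ℕ → ℕ} {T : Tab n p} (h : IsStdTab T) (i : ℕ) : Set.InjOn (T.entry i) (range (p i)) := by
  intro a ha b hb e
  simp only [coe_range, Set.mem_Iio] at ha hb
  rcases lt_trichotomy a b with hab | hab | hab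
  · exact absurd e (h.1 i a b hab hb).ne
  · exact hab
  · exact absurd e (h.1 i b a hab ha).ne'

lemma rows_card {p : ℕ → ℕ} {T : Tab n p} (h : IsStdTab T) (i : ℕ) : (rows T i).card = p i := by
  rw [rows, card_image_of_injOn (row_inj h i), card_range]

lemma rows_cnt {p : ℕ → ℕ} {T : Tab n p} (h : IsStdTab T) (i : ℕ) (x : Fin n) :
    cnt (rows T i) x = ((range (p i)).filter fun j => T.entry i j ≤ x).card := by
  rw [cnt, rows, filter_image, card_image_of_injOn]
  exact (row_inj h i).mono (by intro a; simp; tauto)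

lemma rows_anti {p : ℕ → ℕ} (hp : ∀ ⦃i j : ℕ⦄, i ≤ j → p j ≤ p i) {T : Tab n p} (h : IsStdTab T) (i : ℕ) (x : Fin n) :
    cnt (rows T (i + 1)) x ≤ cnt (rows T i) x := by
  rw [rows_cnt h, rows_cnt h]
  apply card_le_card
  intro j hj
  simp only [mem_filter, mem_range] at hj ⊢
  exact ⟨hj.1.trans_le (hp (by omega)), (h.2 i j hj.1).trans hj.2⟩

lemma rl_RowStd {p : ℕ → ℕ} (hp : ∀ ⦃i j : ℕ⦄, i ≤ j → p j ≤ p i) {T : Tab n p} (h : IsStdTab T) (m : ℕ) :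
    RowStd (rl m T) := by
  rw [RowStd, List.isChain_iff_getElem]
  intro i hi x
  simp only [rl, List.getElem_map, List.getElem_range]
  exact rows_anti hp h i x

lemma rl_head {p : ℕ → ℕ} {m : ℕ} (hp : ∀ i, m ≤ i → p i = 0) (T : Tab n p) : (rl m T).headD ∅ = rows T 0 := by
  cases m with
  | zero => simp [rl, rows, hp 0 le_rfl]
  | succ m => simp [rl, List.range_succ_eq_map]

lemma rl_shp {p : ℕ → ℕ} {T : Tab n p} (h : IsStdTab T) (m : ℕ) : shp (rl m T) = (List.range m).map p := by
  rw [shp, rl, List.map_map]; apply List.map_congr_left; intro i _; exact rows_card h i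

lemma rl_Sz {m : ℕ} (ρ : RPartition m) {T : Tab n ρ.part} (h : IsStdTab T) : Sz m (rl m T) := by
  refine ⟨by simp [rl], ?_⟩
  rw [rl_shp h]
  conv_rhs => rw [← ρ.sum_eq]
  rfl

lemma rl_Std {m m' : ℕ} (ρ : RPartition m) (σ : RPartition m') {T : Tab n ρ.part} {T' : Tab n σ.part}
    (h : IsStdRatPair T T') : Std (rl m T) (rl m' T') := by
  refine ⟨rl_RowStd ρ.antitone' h.1 m, rl_RowStd σ.antitone' h.2.1 m', ?_⟩
  intro x
  rw [rl_head ρ.vanish, rl_head σ.vanish, rows_cnt h.1, rows_cnt h.2.1]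
  exact h.2.2 x

lemma tab_ext {p : ℕ → ℕ} {T T' : Tab n p} (h : IsStdTab T) (h' : IsStdTab T') (e : ∀ i, rows T i = rows T' i) : T = T' := by
  have key : T.entry = T'.entry := by
    funext i j
    by_cases hj : p i ≤ j
    · rw [T.outside i j hj, T'.outside i j hj]
    · have a1 := Finset.orderEmbOfFin_unique (rows_card h i) (f := fun x : Fin (p i) => T.entry i x)
        (fun x => mem_image_of_mem _ (mem_range.2 x.2)) (fun a b hab => h.1 i a b hab b.2)
      have a2 := Finset.orderEmbOfFin_unique (rows_card h i) (f := fun x : Fin (p i) => T'.entry i x)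
        (fun x => by rw [e i]; exact mem_image_of_mem _ (mem_range.2 x.2)) (fun a b hab => h'.1 i a b hab b.2)
      exact congrFun (a1.trans a2.symm) ⟨j, by omega⟩
  cases T; cases T'; simp only at key; subst key; rfl

/-- tableau from row sets -/
noncomputable def tabOf (p : ℕ → ℕ) (X : ℕ → Finset (Fin n)) (hX : ∀ i, (X i).card = p i) : Tab n p where
  entry i j := if h : j < p i then (X i).orderEmbOfFin (hX i) ⟨j, h⟩ else 0
  outside i j h := dif_neg (by omega)

lemma tabOf_rows (p : ℕ → ℕ) (X : ℕ → Finset (Fin n)) (hX : ∀ i, (X i).card = p i) (i : ℕ) :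
    rows (tabOf p X hX) i = X i := by
  ext x
  rw [← Finset.mem_coe (s := X i), ← Finset.range_orderEmbOfFin (X i) (hX i)]
  simp only [rows, mem_image, mem_range, tabOf, Set.mem_range]
  constructor
  · rintro ⟨j, hj, rfl⟩; exact ⟨⟨j, hj⟩, by rw [dif_pos hj]⟩
  · rintro ⟨j, rfl⟩; exact ⟨j, j.2, by rw [dif_pos j.2]⟩

lemma tabOf_std (p : ℕ → ℕ) (X : ℕ → Finset (Fin n)) (hX : ∀ i, (X i).card = p i)
    (h : ∀ i x, cnt (X (i + 1)) x ≤ cnt (X i) x) (hp : ∀ i, p (i + 1) ≤ p i) : IsStdTab (tabOf p X hX) := by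
  have h1 : ∀ i j1 j2, j1 < j2 → j2 < p i → (tabOf p X hX).entry i j1 < (tabOf p X hX).entry i j2 := by
    intro i j1 j2 h1 h2
    simp only [tabOf]
    rw [dif_pos h2, dif_pos (h1.trans h2)]
    exact (Finset.orderEmbOfFin _ _).strictMono h1
  refine ⟨h1, ?_⟩
  intro i j hj
  have inj : ∀ i, Set.InjOn ((tabOf p X hX).entry i) (range (p i)) := by
    intro i a ha b hb e
    simp only [coe_range, Set.mem_Iio] at ha hb
    rcases lt_trichotomy a b with hab | hab | hab
    · exact absurd e (h1 i a b hab hb).ne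
    · exact hab
    · exact absurd e (h1 i b a hab ha).ne'
  have rc : ∀ i x, cnt (X i) x = ((range (p i)).filter fun j => (tabOf p X hX).entry i j ≤ x).card := by
    intro i x
    rw [← tabOf_rows p X hX i, cnt, rows, filter_image, card_image_of_injOn]
    exact (inj i).mono (by intro a; simp; tauto)
  by_contra hc
  rw [not_le] at hc
  set x := (tabOf p X hX).entry (i + 1) j
  have c1 : j + 1 ≤ cnt (X (i + 1)) x := by
    rw [rc, ← card_range (j + 1)]
    apply card_le_card
    intro a ha
    simp only [mem_range, mem_filter] at ha ⊢
    refine ⟨by omega, ?_⟩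
    rcases Nat.lt_succ_iff_lt_or_eq.1 ha with ha | rfl
    · exact (h1 (i + 1) a j ha hj).le
    · exact le_rfl
  have c2 : cnt (X i) x ≤ j := by
    rw [rc, ← card_range j]
    apply card_le_card
    intro a ha
    simp only [mem_range, mem_filter] at ha ⊢
    by_contra hja
    rcases (not_lt.1 hja).lt_or_eq with hl | rfl
    · exact absurd (hc.trans (h1 i j a hl ha.1)) (not_lt.2 ha.2)
    · exact absurd hc (not_lt.2 ha.2)
  have := h i x
  omega

lemma RowStd.step {L : RL n} (h : RowStd L) (i : ℕ) (x : Fin n) :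
    cnt (L.getD (i + 1) ∅) x ≤ cnt (L.getD i ∅) x := by
  by_cases hi : i + 1 < L.length
  · rw [List.getD_eq_getElem _ _ hi, List.getD_eq_getElem _ _ (by omega)]
    exact (List.isChain_iff_getElem.1 h) i hi x
  · rw [List.getD_eq_default _ _ (by omega)]; simp [cnt]

lemma RowStd.step_card {L : RL n} (h : RowStd L) (i : ℕ) : (L.getD (i + 1) ∅).card ≤ (L.getD i ∅).card := by
  have := pp_ind (X := L.getD (i + 1) ∅) (Y := L.getD i ∅) (p := fun a b _ => a ≤ b) le_rfl (h.step i) n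
  rwa [pp_n _ le_rfl, pp_n _ le_rfl] at this

lemma map_getD {m : ℕ} {L : RL n} (h : L.length = m) : (List.range m).map (fun i => L.getD i ∅) = L := by
  apply List.ext_getElem (by simp [h])
  intro i h1 h2
  simp [h2]

/-- partition from a list of rows -/
def parOf {m : ℕ} (L : RL n) (h : Sz m L) (h' : RowStd L) : RPartition m where
  part i := (L.getD i ∅).card
  antitone' := antitone_nat_of_succ_le h'.step_card
  vanish i hi := by rw [List.getD_eq_default _ _ (by rw [h.1]; exact hi)]; rfl
  sum_eq := by
    conv_rhs => rw [← h.2]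
    conv_rhs => rw [← map_getD h.1, shp, List.map_map]
    rfl

lemma shp_getD {L M : RL n} (h : shp L = shp M) (i : ℕ) : (L.getD i ∅).card = (M.getD i ∅).card := by
  have key : ∀ L : RL n, (L.getD i ∅).card = (shp L).getD i 0 := by
    intro L; rw [shp, ← card_empty (α := Fin n), List.getD_map]
  rw [key, key, h]

lemma tabOf_pair {L L' : RL n} {p p' : ℕ → ℕ} (hp : ∀ i, (L.getD i ∅).card = p i) (hp' : ∀ i, (L'.getD i ∅).card = p' i)
    (h : Std L L') : IsStdRatPair (tabOf p (fun i => L.getD i ∅) hp) (tabOf p' (fun i => L'.getD i ∅) hp') := by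
  have s1 := tabOf_std p (fun i => L.getD i ∅) hp h.1.step (fun i => by rw [← hp, ← hp]; exact h.1.step_card i)
  have s2 := tabOf_std p' (fun i => L'.getD i ∅) hp' h.2.1.step (fun i => by rw [← hp', ← hp']; exact h.2.1.step_card i)
  refine ⟨s1, s2, ?_⟩
  intro x
  have := h.2.2 x
  rw [firstRowCount, firstRowCount, ← rows_cnt s1, ← rows_cnt s2, tabOf_rows, tabOf_rows]
  have e : ∀ L : RL n, L.getD 0 ∅ = L.headD ∅ := by intro L; cases L <;> rfl
  rw [e, e]; exact this

/-- comparison of index sets -/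
def toBT {r s : ℕ} (B : StdRatBitab n r s) : BT n r s :=
  ⟨(⟨B.1.k, Nat.lt_succ_of_le B.1.hk⟩, (rl (r - B.1.k) B.1.t1, rl (s - B.1.k) B.1.t2),
      (rl (r - B.1.k) B.1.t1', rl (s - B.1.k) B.1.t2')),
    rl_Sz B.1.ρ B.2.1.1, rl_Sz B.1.σ B.2.1.2.1,
    by simp only; rw [rl_shp B.2.1.1, rl_shp B.2.2.1], by simp only; rw [rl_shp B.2.1.2.1, rl_shp B.2.2.2.1],
    rl_Std _ _ B.2.1, rl_Std _ _ B.2.2⟩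

lemma par_ext {m : ℕ} {ρ ρ' : RPartition m} {T : Tab n ρ.part} {T' : Tab n ρ'.part} (h : IsStdTab T) (h' : IsStdTab T')
    (e : rl m T = rl m T') : ρ = ρ' := by
  have key : ρ.part = ρ'.part := by
    funext i
    by_cases hi : i < m
    · have e1 := congrArg shp e
      rw [rl_shp h, rl_shp h'] at e1
      exact List.map_inj_left.1 e1 i (List.mem_range.2 hi)
    · rw [ρ.vanish i (by omega), ρ'.vanish i (by omega)]
  cases ρ; cases ρ'; simp only at key; subst key; rfl

lemma rl_ext {m : ℕ} {ρ : RPartition m} {T T' : Tab n ρ.part} (h : IsStdTab T) (h' : IsStdTab T')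
    (e : rl m T = rl m T') : T = T' := by
  apply tab_ext h h'
  intro i
  by_cases hi : i < m
  · exact List.map_inj_left.1 e i (List.mem_range.2 hi)
  · rw [rows, rows, ρ.vanish i (by omega)]; rfl

lemma toBT_inj {r s : ℕ} : Function.Injective (toBT (n := n) (r := r) (s := s)) := by
  rintro ⟨⟨k, hk, ρ, σ, hrow, t1, t2, t1', t2'⟩, h1, h2⟩ ⟨⟨k_, hk_, ρ_, σ_, hrow_, u1, u2, u1', u2'⟩, g1, g2⟩ e
  have e := congrArg Subtype.val e
  simp only [toBT, Prod.mk.injEq, Fin.mk.injEq] at e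
  obtain ⟨rfl, ⟨e1, e2⟩, e3, e4⟩ := e
  simp only at h1 h2 g1 g2
  obtain rfl := par_ext h1.1 g1.1 e1
  obtain rfl := par_ext h1.2.1 g1.2.1 e2
  obtain rfl := rl_ext h1.1 g1.1 e1
  obtain rfl := rl_ext h1.2.1 g1.2.1 e2
  obtain rfl := rl_ext h2.1 g2.1 e3
  obtain rfl := rl_ext h2.2.1 g2.2.1 e4
  rfl

lemma rl_tabOf {m : ℕ} {L : RL n} {p : ℕ → ℕ} (hp : ∀ i, (L.getD i ∅).card = p i) (h : L.length = m) :
    rl m (tabOf p (fun i => L.getD i ∅) hp) = L := by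
  rw [rl]
  conv_rhs => rw [← map_getD h]
  apply List.map_congr_left; intro i _; exact tabOf_rows _ _ _ _

lemma toBT_surj {r s : ℕ} : Function.Surjective (toBT (n := n) (r := r) (s := s)) := by
  rintro ⟨⟨⟨k, hk⟩, ⟨S, S'⟩, ⟨T, T'⟩⟩, h1, h2, h3, h4, h5, h6⟩
  simp only at h1 h2 h3 h4 h5 h6
  have hrow : (S.getD 0 ∅).card + (S'.getD 0 ∅).card ≤ n := by
    have e : ∀ L : RL n, L.getD 0 ∅ = L.headD ∅ := by intro L; cases L <;> rfl
    rw [e, e]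
    have := pp_ind (X := S.headD ∅) (Y := S'.headD ∅) (p := fun a b c => a + b ≤ c) le_rfl h5.2.2 n
    rwa [pp_n _ le_rfl, pp_n _ le_rfl, min_self] at this
  refine ⟨⟨⟨k, (by omega), parOf S h1 h5.1, parOf S' h2 h5.2.1, hrow,
      tabOf _ (fun i => S.getD i ∅) (fun i => rfl), tabOf _ (fun i => S'.getD i ∅) (fun i => rfl),
      tabOf _ (fun i => T.getD i ∅) (fun i => shp_getD h3 i),
      tabOf _ (fun i => T'.getD i ∅) (fun i => shp_getD h4 i)⟩, ?_, ?_⟩, ?_⟩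
  · exact tabOf_pair _ _ h5
  · exact tabOf_pair _ _ h6
  · apply Subtype.ext
    exact Prod.ext rfl (Prod.ext (Prod.ext (rl_tabOf _ h1.1) (rl_tabOf _ h2.1))
      (Prod.ext (rl_tabOf _ ((shp_length' h3).trans h1.1)) (rl_tabOf _ ((shp_length' h4).trans h2.1))))

end tabs
end RS

set_option synthInstance.maxHeartbeats 1000000 in
/-- the centralizer algebra
`S_q(n;r,s) = End_{𝔅_{r,s}^n(q)}(V^{⊗r} ⊗ (V*)^{⊗s})` (the set of
endomorphisms of mixed tensor space commuting with `E` and with all `S_t`,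
`Ŝ_t`) is a free `R`-module with a basis indexed by the pairs of standard
rational `(ρ,σ)`-tableaux with entries in `{1,…,n}`, where the pairs range
over all `0 ≤ k ≤ min(r,s)` and all `ρ ∈ Λ⁺(r−k)`, `σ ∈ Λ⁺(s−k)`; in
particular its rank is independent of `R` and of `q`. -/
theorem stmt1 (R : Type*) [CommRing R] (q : Rˣ) (n : ℕ) [NeZero n] (r s : ℕ) :
    Nonempty (Module.Basis (StdRatBitab n r s) R
      (Subalgebra.centralizer R (wallSet R q n r s))) := by
  exact ⟨((RS.CRbasis (n := n) (-q) r s).map (RS.cenEquiv R q n r s)).reindex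
    (Equiv.ofBijective RS.toBT ⟨RS.toBT_inj, RS.toBT_surj⟩).symm⟩
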